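/- Let p > 3 be a prime. If p ≡ 1 (mod 3), write p = x^2 + 3y^2 with integers x, y; then Σ_{n=0}^{p−1} (−1)^n·n^2·A_n ≡ (8/9)x^2 − (17/18)p + p^2/(72x^2) (mod p^3) and Σ_{n=0}^{p−1} (−1)^n·n^3·A_n ≡ −(1/3)x^2 + p/2 − p^2/(12x^2) (mod p^3). If p ≡ 2 (mod 3), then Σ_{n=0}^{p−1} (−1)^n·n^2·A_n ≡ (2/9)R_3(p) + p/2 (mod p^2) and Σ_{n=0}^{p−1} (−1)^n·n^3·A_n ≡ −(1/3)R_3(p) − (1/3)p (mod p^2). -/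

import Mathlib

/-- `a ≡ b (mod p^r)` for rationals: the numerator of `a - b` in lowest terms
is divisible by `p^r`. -/
def ratCongr (p r : ℕ) (a b : ℚ) : Prop := (p : ℤ)^r ∣ (a - b).num
/-- `R_3(p)`. -/
def R3 (p : ℕ) : ℚ :=
  (1 + 2*(p:ℚ) + 4/3*(2^(p-1) - 1) - 3/2*(3^(p-1) - 1)) *
    (((p-1)/2).choose (p/6) : ℚ)^2

/-- The Apéry numbers `A_n = Σ_{k=0}^{n} C(n,k)^2·C(n+k,k)^2`. -/
def apery (n : ℕ) : ℚ :=
  ∑ k ∈ Finset.range (n+1), (n.choose k : ℚ)^2 * ((n+k).choose k : ℚ)^2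


open Finset

/-- `P_k(x) = ∏_{i<k} (x(x+1) - i(i+1))`. -/
def apP {R : Type*} [CommRing R] (k : ℕ) (x : R) : R :=
  ∏ i ∈ range k, (x * (x + 1) - (i : R) * ((i : R) + 1))

/-- `E_k(x) = (x-k) P_k(x)`. -/
def apE {R : Type*} [CommRing R] (k : ℕ) (x : R) : R := (x - (k : R)) * apP k x

section
variable {R : Type*} [CommRing R]

@[simp] theorem apP_zero (x : R) : apP 0 x = 1 := by simp [apP]

theorem apP_succ (k : ℕ) (x : R) :
    apP (k+1) x = apP k x * (x * (x + 1) - (k : R) * ((k : R) + 1)) := by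
  simp [apP, prod_range_succ]

theorem apP_up (k : ℕ) (x : R) :
    apP (k+1) (x+1) = (x + k + 2) * (x + k + 1) * apP k x := by
  induction k with
  | zero => simp [apP]; ring
  | succ k ih =>
    rw [apP_succ, ih, apP_succ]; push_cast; ring

theorem apP_dn (k : ℕ) (x : R) :
    apP (k+1) (x-1) = (x - k) * (x - k - 1) * apP k x := by
  induction k with
  | zero => simp [apP]; ring
  | succ k ih =>
    rw [apP_succ, ih, apP_succ]; push_cast; ring

theorem apE_up (k : ℕ) (x : R) : apE k (x+1) = (x + 1 + k) * apP k x := by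
  cases k with
  | zero => simp [apE]
  | succ k => rw [apE, apP_up, apP_succ]; push_cast; ring

/-- recurrence for the alternating sums of `P_k^2` -/
theorem apT_rec (k : ℕ) (x : R) :
    2 * apP (k+1) x ^ 2 - (2*k+1)^3 * (k+1) * apP k x ^ 2 =
      (x^2 - (k+1)*(3*k+2)) * apE k x ^ 2 +
      ((x+1)^2 - (k+1)*(3*k+2)) * apE k (x+1) ^ 2 := by
  rw [apE_up, apE, apP_succ]; ring

theorem apU_rec (k : ℕ) (x : R) :
    (2*x+1) * (apP (k+1) x ^ 2 - 2*(2*k+1)*(k+1)^3 * apP k x ^ 2) =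
      (x^3 - 3*(k+1)^2*x) * apE k x ^ 2 +
      ((x+1)^3 - 3*(k+1)^2*(x+1)) * apE k (x+1) ^ 2 := by
  rw [apE_up, apE, apP_succ]; ring

theorem apN_rec (k : ℕ) (x : R) :
    (2*(x*(x+1)) + 2*k^2 + 2*k + 1) * apP k x ^ 2 =
      apE k x ^ 2 + apE k (x+1) ^ 2 := by
  rw [apE_up, apE]; ring

theorem alt_tele (G : R → R) (x : R) (n : ℕ) :
    ∑ i ∈ range n, (-1:R)^i * (G (x+i) + G (x+i+1)) = G x - (-1)^n * G (x+n) := by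
  induction n with
  | zero => simp
  | succ n ih => rw [sum_range_succ, ih]; push_cast; rw [pow_succ, add_assoc x]; ring

theorem alt_tele_odd (G : R → R) (x : R) (n : ℕ) (hn : Odd n) :
    ∑ i ∈ range n, (-1:R)^i * (G (x+i) + G (x+i+1)) = G x + G (x+n) := by
  rw [alt_tele, hn.neg_one_pow]; ring

/-- Apéry recurrence certificate -/
theorem apP_cert (k : ℕ) (x : R) :
    (x+1)^3 * apP (k+1) (x+1) ^ 2 - (2*x+1)*(17*x^2+17*x+5) * apP (k+1) x ^ 2
      + x^3 * apP (k+1) (x-1) ^ 2 =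
    4*(2*x+1)*((k+1)*(2*(k+1)+1) - (2*x+1)^2) * apP (k+1) x ^ 2
     - (k+1)^4 * (4*(2*x+1)*(k*(2*k+1) - (2*x+1)^2) * apP k x ^ 2) := by
  rw [apP_up, apP_dn, apP_succ]; ring

theorem apP_nat (k n : ℕ) :
    (apP k (n:R)) = (n.choose k : R) * ((n+k).choose k : R) * (k.factorial : R)^2 := by
  have h : (apP k (n:ℤ)) = (n.choose k : ℤ) * ((n+k).choose k : ℤ) * (k.factorial : ℤ)^2 := by
    induction k with
    | zero => simp
    | succ k ih =>
      rw [apP_succ, ih]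
      have h1 : ((n.choose (k+1) : ℤ)) * (k+1) = n.choose k * (n - k) := by
        rcases le_or_gt k n with h | h
        · have := Nat.choose_succ_right_eq n k
          zify [h] at this; exact this
        · rw [Nat.choose_eq_zero_of_lt h, Nat.choose_eq_zero_of_lt (by omega)]; simp
      have h2 : (((n+(k+1)).choose (k+1) : ℕ) : ℤ) * (k+1) = ((n+k).choose k : ℤ) * (n+k+1) := by
        have := Nat.add_one_mul_choose_eq (n+k) k
        zify at this
        rw [← add_assoc]; linarith
      rw [Nat.factorial_succ]; push_cast
      linear_combination (-(k.factorial:ℤ)^2*((((n+(k+1)).choose (k+1) : ℕ) : ℤ) * (k+1))) * h1 - (k.factorial:ℤ)^2*(n.choose k * (n - k)) * h2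
  have := congrArg (Int.cast : ℤ → R) h
  rw [← Int.cast_natCast n] at *
  simpa [apP] using this
end

open Finset

section
variable {R : Type*} [CommRing R]

/-- truncated Apéry function with weights `w k = 1/k!^4` -/
def apA (w : ℕ → R) (N : ℕ) (x : R) : R := ∑ k ∈ range N, w k * apP k x ^ 2

theorem apA_rec (w : ℕ → R) (N : ℕ) (h0 : w 0 = 1)
    (hw : ∀ k, k < N → w (k+1) * ((k:R)+1)^4 = w k) (x : R) :
    (x+1)^3 * apA w (N+1) (x+1) - (2*x+1)*(17*x^2+17*x+5) * apA w (N+1) x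
      + x^3 * apA w (N+1) (x-1) =
    w N * (4*(2*x+1)*(N*(2*N+1) - (2*x+1)^2) * apP N x ^ 2) := by
  induction N with
  | zero => simp [apA, h0]; ring
  | succ N ih =>
    have ih' := ih (fun k hk => hw k (by omega))
    have hc := apP_cert N x
    have hN := hw N (by omega)
    have e : ∀ y : R, apA w (N+1+1) y = apA w (N+1) y + w (N+1) * apP (N+1) y ^ 2 := by
      intro y; rw [apA, sum_range_succ]; rfl
    rw [e, e, e]; push_cast
    linear_combination ih' + w (N+1) * hc - (4*(2*x+1)*(N*(2*N+1) - (2*x+1)^2) * apP N x ^ 2) * hN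
end

/-- integer Apéry numbers -/
def az (n : ℕ) : ℤ := ∑ k ∈ range (n+1), (n.choose k : ℤ)^2 * ((n+k).choose k : ℤ)^2

theorem apA_eq_az {K : Type*} [Field K] (N n : ℕ) (hn : n < N)
    (hN : ∀ k, k < N → (k.factorial : K) ≠ 0) :
    apA (fun k => ((k.factorial : K)^4)⁻¹) N (n : K) = (az n : K) := by
  have h1 : apA (fun k => ((k.factorial : K)^4)⁻¹) N (n : K)
     = ∑ k ∈ range N, ((n.choose k : K)^2 * ((n+k).choose k : K)^2) := by
    apply sum_congr rfl
    intro k hk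
    have := hN k (mem_range.1 hk)
    rw [apP_nat]; field_simp
  rw [h1, az]; push_cast
  symm
  apply sum_subset
  · intro k; simp only [mem_range]; omega
  · intro k _ hk
    rw [mem_range] at hk
    rw [Nat.choose_eq_zero_of_lt (by omega)]; simp

theorem az_rec (n : ℕ) :
    ((n:ℤ)+2)^3 * az (n+2) - (2*n+3)*(17*(n+1)^2+17*(n+1)+5) * az (n+1) + (n+1)^3 * az n = 0 := by
  have hf : ∀ k, k < n+3 → (k.factorial : ℚ) ≠ 0 := fun k _ => by
    exact_mod_cast k.factorial_ne_zero
  have h := apA_rec (fun k => ((k.factorial : ℚ)^4)⁻¹) (n+2) (by simp) (by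
    intro k _
    have := k.factorial_ne_zero
    simp only [Nat.factorial_succ]; push_cast
    field_simp) ((n:ℚ)+1)
  have e1 := apA_eq_az (K := ℚ) (n+3) n (by omega) hf
  have e2 := apA_eq_az (K := ℚ) (n+3) (n+1) (by omega) hf
  have e3 := apA_eq_az (K := ℚ) (n+3) (n+2) (by omega) hf
  have e4 := apP_nat (R := ℚ) (n+2) (n+1)
  rw [Nat.choose_eq_zero_of_lt (by omega)] at e4
  push_cast at e2 e3 e4
  rw [show (n:ℚ)+1+1 = n+2 by ring, show (n:ℚ)+1-1 = n by ring, e1, e2, e3, e4] at h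
  have : (((((n:ℤ)+2)^3 * az (n+2) - (2*n+3)*(17*(n+1)^2+17*(n+1)+5) * az (n+1) + (n+1)^3 * az n : ℤ)) : ℚ) = 0 := by
    push_cast
    linear_combination h
  exact_mod_cast this

theorem az_zero : az 0 = 1 := by simp [az]
theorem az_one : az 1 = 5 := by decide

theorem apery_step0 (M : ℕ) :
    ∑ m ∈ range (M+1), (-1:ℤ)^m * ((2*m+1)*(18*(m*(m+1))+6)) * az m
      = (-1)^M * (M+1)^3 * (az (M+1) + az M) := by
  induction M with
  | zero => simp [az_zero, az_one]
  | succ M ih =>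
    rw [sum_range_succ, ih]
    have := az_rec M
    push_cast; rw [pow_succ]
    linear_combination ((-1)^M) * this

section poly
open Polynomial

variable {F : Type*} [CommRing F]

/-- `θ = X d/dX` -/
noncomputable def th (f : F[X]) : F[X] := X * derivative f

theorem th_add (f g : F[X]) : th (f+g) = th f + th g := by simp [th, mul_add]
theorem th_sub (f g : F[X]) : th (f-g) = th f - th g := by simp [th, mul_sub]
theorem th_mul (f g : F[X]) : th (f*g) = th f * g + f * th g := by simp [th]; ring
theorem th_X : th (X : F[X]) = X := by simp [th]
theorem th_one : th (1 : F[X]) = 0 := by simp [th]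
theorem th_C (a : F) : th (C a : F[X]) = 0 := by simp [th]
theorem th_coeff (f : F[X]) (n : ℕ) : (th f).coeff n = n * f.coeff n := by
  cases n with
  | zero => simp [th]
  | succ n => rw [th, coeff_X_mul, coeff_derivative]; push_cast; ring
theorem th_CXn (a : F) (n : ℕ) : th (C a * X^n : F[X]) = C (n*a) * X^n := by
  ext m; rw [th_coeff, coeff_C_mul_X_pow, coeff_C_mul_X_pow]; split_ifs with h <;> simp [h]

/-- The invariant bilinear form. -/
noncomputable def Bil (u0 u1 u2 v0 v1 v2 : F[X]) : F[X] :=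
  (1 - C 34 * X + X^2) * (u0*v2 + u2*v0 - u1*v1) + (X^2 - C 17 * X) * (u0*v1+u1*v0)
    + (X^2 - C 10 * X) * (u0*v0)

/-- The Apéry operator -/
noncomputable def Dop (u0 u1 u2 u3 : F[X]) : F[X] :=
  (1 - C 34 * X + X^2) * u3 + (C 3 * X^2 - C 51 * X) * u2 + (C 3 * X^2 - C 27 * X) * u1
   + (X^2 - C 5 * X) * u0

theorem th_Bil (u0 u1 u2 u3 v0 v1 v2 v3 a0 a1 a2 b0 b1 b2 : F[X])
    (hu0 : th u0 = u1 - a0) (hu1 : th u1 = u2 - a1) (hu2 : th u2 = u3 - a2)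
    (hv0 : th v0 = v1 - b0) (hv1 : th v1 = v2 - b1) (hv2 : th v2 = v3 - b2) :
    th (Bil u0 u1 u2 v0 v1 v2) = u0 * Dop v0 v1 v2 v3 + v0 * Dop u0 u1 u2 u3
      - Bil a0 a1 a2 v0 v1 v2 - Bil u0 u1 u2 b0 b1 b2 := by
  have h2 : ∀ f : F[X], f^2 = f*f := fun f => by ring
  simp only [Bil, Dop, h2, th_add, th_sub, th_mul, th_X, th_one, th_C, hu0, hu1, hu2, hv0, hv1, hv2]
  have e34 : (C 34 : F[X]) = 34 := rfl
  have e17 : (C 17 : F[X]) = 17 := rfl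
  have e10 : (C 10 : F[X]) = 10 := rfl
  have e3 : (C 3 : F[X]) = 3 := rfl
  have e51 : (C 51 : F[X]) = 51 := rfl
  have e27 : (C 27 : F[X]) = 27 := rfl
  have e5 : (C 5 : F[X]) = 5 := rfl
  rw [e34, e17, e10, e3, e51, e27, e5]
  ring
end poly

open Finset

section poly
open Polynomial

/-- `θ^i` of the truncated generating function -/
noncomputable def yz (i M : ℕ) : ℤ[X] := ∑ n ∈ range M, C ((n:ℤ)^i * az n) * X^n

theorem yz_succ (i M : ℕ) : yz i (M+1) = yz i M + C ((M:ℤ)^i * az M) * X^M := by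
  rw [yz, sum_range_succ]; rfl

theorem th_yz (i M : ℕ) : th (yz i M) = yz (i+1) M := by
  induction M with
  | zero => simp [yz, th]
  | succ M ih => rw [yz_succ, th_add, ih, th_CXn, yz_succ, pow_succ]; congr 3; ring

theorem yz_coeff (i M n : ℕ) : (yz i M).coeff n = if n < M then (n:ℤ)^i * az n else 0 := by
  simp only [yz, finsetSum_coeff, coeff_C_mul_X_pow, Finset.sum_ite_eq, mem_range]

theorem Dop_yz (M : ℕ) : Dop (yz 0 (M+1)) (yz 1 (M+1)) (yz 2 (M+1)) (yz 3 (M+1)) =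
    C (((M:ℤ)+1)^3) * (C (az M) * X^(M+2) - C (az (M+1)) * X^(M+1)) := by
  induction M with
  | zero => simp [yz, Dop, az_zero, az_one]
  | succ M ih =>
    have hr := congrArg (fun z : ℤ => (C z : ℤ[X])) (az_rec M)
    simp only [yz_succ _ (M+1)]
    simp only [Dop] at ih ⊢
    simp only [map_add, map_sub, map_mul, map_pow, map_natCast, map_one, map_zero, map_ofNat, Nat.cast_add, Nat.cast_one] at hr ih ⊢
    linear_combination ih + X^(M+2) * hr

theorem natDegree_yz (i M : ℕ) : (yz i (M+1)).natDegree ≤ M := by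
  rw [natDegree_le_iff_coeff_eq_zero]
  intro n hn; rw [yz_coeff, if_neg (by omega)]

theorem Bil_natDegree {F : Type*} [CommRing F] (M : ℕ) (u0 u1 u2 v0 v1 v2 : F[X])
    (a0 : u0.natDegree ≤ M) (a1 : u1.natDegree ≤ M) (a2 : u2.natDegree ≤ M)
    (b0 : v0.natDegree ≤ M) (b1 : v1.natDegree ≤ M) (b2 : v2.natDegree ≤ M) :
    (Bil u0 u1 u2 v0 v1 v2).natDegree ≤ 2*M+2 := by
  have hm : ∀ {f g : F[X]}, f.natDegree ≤ M → g.natDegree ≤ M → (f*g).natDegree ≤ 2*M :=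
    fun hf hg => natDegree_mul_le.trans (by omega)
  have hq : ∀ a b c : F, (C a + C b * X + C c * X^2).natDegree ≤ 2 := by
    intro a b c; compute_degree
  have e1 : (1 - C 34 * X + X^2 : F[X]) = C 1 + C (-34) * X + C 1 * X^2 := by simp; ring
  have e2 : (X^2 - C 17 * X : F[X]) = C 0 + C (-17) * X + C 1 * X^2 := by simp; ring
  have e3 : (X^2 - C 10 * X : F[X]) = C 0 + C (-10) * X + C 1 * X^2 := by simp; ring
  have hmm : ∀ {f g : F[X]}, f.natDegree ≤ 2 → g.natDegree ≤ 2*M → (f*g).natDegree ≤ 2*M+2 :=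
    fun hf hg => natDegree_mul_le.trans (by omega)
  rw [Bil, e1, e2, e3]
  refine natDegree_add_le_of_degree_le (natDegree_add_le_of_degree_le ?_ ?_) ?_
  · refine hmm (hq _ _ _) ?_
    exact natDegree_sub_le_of_le (natDegree_add_le_of_degree_le (hm a0 b2) (hm a2 b0)) (hm a1 b1) |>.trans (by simp)
  · exact hmm (hq _ _ _) (natDegree_add_le_of_degree_le (hm a0 b1) (hm a1 b0))
  · exact hmm (hq _ _ _) (hm a0 b0)

theorem az_p {p : ℕ} (hp : p.Prime) : (p:ℤ) ∣ az p - 5 := by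
  have := Fact.mk hp
  have hm : ∀ k ∈ range (p-1), (p:ℤ) ∣ (p.choose (k+1) : ℤ)^2 * ((p+(k+1)).choose (k+1) : ℤ)^2 := by
    intro k hk
    rw [mem_range] at hk
    have : p ∣ p.choose (k+1) := hp.dvd_choose_self (by omega) (by omega)
    exact Dvd.dvd.mul_right (dvd_pow (by exact_mod_cast this) two_ne_zero) _
  have h2 : ((p:ℤ)) ∣ ((p+p).choose p : ℤ) - 2 := by
    have := Choose.choose_modEq_choose_mod_mul_choose_div (n := p+p) (k := p) (p := p)
    have e : (p+p)/p = 2 := by rw [← two_mul]; exact Nat.mul_div_cancel _ hp.pos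
    simp [e, Nat.div_self hp.pos] at this
    exact this.symm.dvd
  rw [az, sum_range_succ, show p = (p-1)+1 by have := hp.pos; omega, sum_range_succ', ← show p = (p-1)+1 by have := hp.pos; omega]
  have := Finset.dvd_sum hm
  obtain ⟨a, ha⟩ := this
  obtain ⟨b, hb⟩ := h2
  have hb' : ((p+p).choose p : ℤ) = 2 + p*b := by linarith
  rw [ha, hb']
  simp
  exact ⟨a + 4*b+p*b^2, by ring⟩

theorem az_p1 {p : ℕ} (hp : p.Prime) : (p:ℤ) ∣ az (p-1) - 1 := by
  have hm : ∀ k ∈ range (p-1), (p:ℤ) ∣ ((p-1).choose (k+1) : ℤ)^2 * ((p-1+(k+1)).choose (k+1) : ℤ)^2 := by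
    intro k hk
    rw [mem_range] at hk
    have : p ∣ (p-1+(k+1)).choose (k+1) := by
      rw [add_comm]
      exact hp.dvd_choose_add (by omega) (by omega) (by omega)
    exact Dvd.dvd.mul_left (dvd_pow (by exact_mod_cast this) two_ne_zero) _
  rw [az, sum_range_succ']
  simpa using Finset.dvd_sum hm

/-- power sums -/
def aS (p i : ℕ) : ℤ := ∑ n ∈ range p, (-1)^n * (n:ℤ)^i * az n

theorem yz_eval (i p : ℕ) : (yz i p).eval (-1) = aS p i := by
  simp only [yz, eval_finsetSum, eval_mul, eval_C, eval_pow, eval_X, aS]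
  apply sum_congr rfl; intros; ring

theorem step2 {p : ℕ} (hp : p.Prime) (hp3 : 3 < p) :
    (p:ℤ)^3 ∣ 72 * aS p 0 * (aS p 2 + aS p 1) + 20 * (aS p 0)^2
      - 9 * (2 * aS p 1 + aS p 0)^2 - 11 * (p:ℤ)^2 := by
  obtain ⟨M, rfl⟩ : ∃ M, p = M+1 := ⟨p-1, by omega⟩
  set I := Bil (yz 0 (M+1)) (yz 1 (M+1)) (yz 2 (M+1)) (yz 0 (M+1)) (yz 1 (M+1)) (yz 2 (M+1)) with hI
  have hth : th I = C 2 * (yz 0 (M+1) * (C (((M:ℤ)+1)^3) * (C (az M) * X^(M+2) - C (az (M+1)) * X^(M+1)))) := by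
    rw [hI, th_Bil _ _ _ (yz 3 (M+1)) _ _ _ (yz 3 (M+1)) 0 0 0 0 0 0 (by simp [th_yz]) (by simp [th_yz]) (by simp [th_yz]) (by simp [th_yz]) (by simp [th_yz]) (by simp [th_yz]), Dop_yz]
    simp [Bil]; ring
  have hco : ∀ m : ℕ, (m:ℤ) * I.coeff m = 2 * ((M:ℤ)+1)^3 *
      (az M * (if M+2 ≤ m then (yz 0 (M+1)).coeff (m-(M+2)) else 0)
       - az (M+1) * (if M+1 ≤ m then (yz 0 (M+1)).coeff (m-(M+1)) else 0)) := by
    intro m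
    rw [← th_coeff, hth, show C 2 * (yz 0 (M+1) * (C (((M:ℤ)+1)^3) * (C (az M) * X^(M+2) - C (az (M+1)) * X^(M+1)))) = C (2*((M:ℤ)+1)^3) * (C (az M) * (yz 0 (M+1) * X^(M+2)) - C (az (M+1)) * (yz 0 (M+1) * X^(M+1))) by rw [C_mul]; ring]
    rw [coeff_C_mul, coeff_sub, coeff_C_mul, coeff_C_mul, coeff_mul_X_pow', coeff_mul_X_pow']
  have hev : I.eval (-1) = ∑ m ∈ range (2*M+3), I.coeff m * (-1)^m :=
    eval_eq_sum_range' (by have := Bil_natDegree M _ _ _ _ _ _ (natDegree_yz 0 M) (natDegree_yz 1 M) (natDegree_yz 2 M) (natDegree_yz 0 M) (natDegree_yz 1 M) (natDegree_yz 2 M); rw [← hI] at this; omega) _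
  have hev2 : I.eval (-1) = 72 * aS (M+1) 0 * (aS (M+1) 2 + aS (M+1) 1) + 20 * (aS (M+1) 0)^2
      - 9 * (2 * aS (M+1) 1 + aS (M+1) 0)^2 := by
    rw [hI, Bil]
    simp only [eval_add, eval_mul, eval_sub, eval_pow, eval_X, eval_C, eval_one, yz_eval]; ring
  have c0 : I.coeff 0 = 0 := by
    rw [coeff_zero_eq_eval_zero, hI, Bil]
    have h1 : (yz 1 (M+1)).eval 0 = 0 := by
      rw [← coeff_zero_eq_eval_zero, yz_coeff]; simp
    have h2 : (yz 2 (M+1)).eval 0 = 0 := by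
      rw [← coeff_zero_eq_eval_zero, yz_coeff]; simp
    simp [h1, h2]
  have hM : ((M:ℤ)+1) ≠ 0 := by positivity
  have hodd : Odd (M+1) := hp.odd_of_ne_two (by omega)
  have key : ∀ m ∈ range (2*M+3), (((M:ℤ)+1)^3) ∣ I.coeff m * (-1)^m -
      ((if m = M+1 then 2*((M:ℤ)+1)^2*az (M+1) else 0) + (if m = 2*M+2 then ((M:ℤ)+1)^2*(az M)^2 else 0)) := by
    intro m hm
    rw [mem_range] at hm
    have h := hco m
    rcases Nat.lt_trichotomy m (M+1) with h1 | h1 | h1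
    · rw [if_neg (by omega), if_neg (by omega)] at h
      rw [if_neg (by omega), if_neg (by omega)]
      rcases Nat.eq_zero_or_pos m with rfl | h0
      · simp [c0]
      · have : I.coeff m = 0 := by
          have h0' : (m:ℤ) ≠ 0 := by positivity
          apply mul_left_cancel₀ h0'; rw [h]; simp
        simp [this]
    · subst h1
      rw [if_neg (by omega), if_pos (by omega), yz_coeff] at h
      simp [az_zero] at h
      rw [if_pos rfl, if_neg (by omega), hodd.neg_one_pow]
      have : I.coeff (M+1) = -2*((M:ℤ)+1)^2*az (M+1) := by
        apply mul_left_cancel₀ hM; rw [h]; ring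
      rw [this]; exact ⟨0, by ring⟩
    · rcases Nat.lt_or_ge m (2*M+2) with h2 | h2
      · rw [if_neg (by omega), if_neg (by omega)]
        have hc : IsCoprime (((M:ℤ)+1)^3) (m:ℤ) := by
          apply IsCoprime.pow_left
          have : Nat.Coprime (M+1) m := by
            rw [hp.coprime_iff_not_dvd]
            rintro ⟨k, rfl⟩
            rcases k with _ | _ | k
            · omega
            · omega
            · nlinarith
          exact_mod_cast Nat.isCoprime_iff_coprime.2 this
        have : (((M:ℤ)+1)^3) ∣ I.coeff m := hc.dvd_of_dvd_mul_left (by rw [h]; exact (Dvd.intro_left _ rfl).mul_right _)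
        simpa using this.mul_right ((-1)^m)
      · have : m = 2*M+2 := by omega
        subst this
        rw [if_pos (by omega), if_pos (by omega), yz_coeff, yz_coeff, if_pos (by omega), if_neg (by omega)] at h
        rw [if_neg (by omega), if_pos rfl]
        have e : 2*M+2-(M+2) = M := by omega
        rw [e] at h
        have : I.coeff (2*M+2) = ((M:ℤ)+1)^2*(az M)^2 := by
          have : (2*((M:ℤ)+1)) ≠ 0 := by positivity
          apply mul_left_cancel₀ this; push_cast at h; linear_combination h
        rw [this, show (2*M+2) = 2*(M+1) by ring, pow_mul]; simp
  have hs := Finset.dvd_sum key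
  rw [sum_sub_distrib, ← hev, hev2, sum_add_distrib, sum_ite_eq', sum_ite_eq', if_pos (by simp; omega), if_pos (by simp)] at hs
  obtain ⟨a, ha⟩ := az_p hp
  obtain ⟨b, hb⟩ := az_p1 hp
  rw [Nat.add_sub_cancel] at hb
  push_cast at ha hb ⊢
  have ha' : az (M+1) = 5 + (M+1)*a := by linarith
  have hb' : az M = 1 + (M+1)*b := by linarith
  rw [ha', hb'] at hs
  refine (dvd_add hs (⟨2*a+2*b+(M+1)*b^2, ?_⟩ : ((M:ℤ)+1)^3 ∣ 2*((M:ℤ)+1)^3*a + 2*((M:ℤ)+1)^3*b+((M:ℤ)+1)^4*b^2)).trans (dvd_of_eq ?_)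
  · ring
  · ring
end poly

open Finset

theorem sum_range_zmod {A : Type*} [AddCommMonoid A] {p : ℕ} [Fact p.Prime] (f : ZMod p → A) :
    ∑ k ∈ range p, f (k : ZMod p) = ∑ x : ZMod p, f x := by
  refine Finset.sum_nbij' (fun k => (k : ZMod p)) (fun x => x.val) ?_ ?_ ?_ ?_ ?_
  · intros; simp
  · intro x _; simpa using ZMod.val_lt x
  · intro k hk; rw [mem_range] at hk; exact ZMod.val_cast_of_lt hk
  · intro x _; simp
  · intros; rfl

theorem sum_inv_sq_zmod {p : ℕ} [hp : Fact p.Prime] (hp3 : 3 < p) :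
    ∑ k ∈ range p, ((k : ZMod p)^2)⁻¹ = 0 := by
  rw [sum_range_zmod (fun x => (x^2)⁻¹)]
  rw [← FiniteField.sum_pow_lt_card_sub_one (ZMod p) (p-3) (by rw [ZMod.card]; omega)]
  apply sum_congr rfl
  intro x _
  by_cases hx : x = 0
  · subst hx; rw [zero_pow two_ne_zero, zero_pow (by omega), inv_zero]
  · have := ZMod.pow_card_sub_one_eq_one hx
    rw [show p-1 = (p-3)+2 by omega, pow_add] at this
    exact (eq_inv_of_mul_eq_one_left this).symm

section
variable {R : Type*} [CommRing R]

theorem apP_succ_E (k : ℕ) (x : R) : apP (k+1) x = (x+k+1) * apE k x := by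
  rw [apP_succ, apE]; ring

theorem apE_succ (k : ℕ) (x : R) : apE (k+1) x = (x^2-(k+1)^2) * apE k x := by
  rw [apE, apP_succ_E]; push_cast; ring

theorem apP_refl (k : ℕ) (x : R) : apP k (-1-x) = apP k x := by
  rw [apP, apP]; apply prod_congr rfl; intros; ring

theorem apP_split (k : ℕ) (x : R) : apP k x = (∏ i ∈ range k, (x - i)) * ∏ i ∈ range k, (x+i+1) := by
  rw [apP, ← prod_mul_distrib]; apply prod_congr rfl; intros; ring

theorem apE_sq (k : ℕ) (x : R) : ∃ q, apE k x ^ 2 = (k.factorial:R)^4 * x^2 + x^3 * q := by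
  have : ∃ q, apE k x = x * ((-1)^k * (k.factorial:R)^2 + x * q) := by
    induction k with
    | zero => exact ⟨0, by simp [apE]⟩
    | succ k ih =>
      obtain ⟨q, hq⟩ := ih
      rw [apE_succ, hq, Nat.factorial_succ]
      refine ⟨x*((-1)^k * (k.factorial:R)^2 + x * q) - (k+1)^2*q, ?_⟩
      push_cast; ring
  obtain ⟨q, hq⟩ := this
  refine ⟨2*(-1)^k * (k.factorial:R)^2*q + x*q^2, ?_⟩
  have h1 : ((-1:R)^k)^2 = 1 := by rw [← pow_mul, mul_comm, pow_mul]; simp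
  rw [hq]
  linear_combination (k.factorial:R)^4 * x^2 * h1

end

section gram
open Polynomial

theorem gram_id {R : Type*} [CommRing R] (a b c x0 x1 x2 y0 y1 y2 z0 z1 z2 k e : R)
    (h00 : a*(x0*x2+x2*x0-x1*x1)+b*(x0*x1+x1*x0)+c*(x0*x0) = 0)
    (h01 : a*(x0*y2+x2*y0-x1*y1)+b*(x0*y1+x1*y0)+c*(x0*y0) = 0)
    (h02 : a*(x0*z2+x2*z0-x1*z1)+b*(x0*z1+x1*z0)+c*(x0*z0) = k)
    (h11 : a*(y0*y2+y2*y0-y1*y1)+b*(y0*y1+y1*y0)+c*(y0*y0) = -k)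
    (h12 : a*(y0*z2+y2*z0-y1*z1)+b*(y0*z1+y1*z0)+c*(y0*z0) = 0)
    (h22 : a*(z0*z2+z2*z0-z1*z1)+b*(z0*z1+z1*z0)+c*(z0*z0) = e) :
    k * (k * (2*x0*z0 - y0^2)) = k * (e * x0^2) := by
  have key : ∀ g00 g01 g02 g11 g12 g22 : R, 
     a*(x0*x2+x2*x0-x1*x1)+b*(x0*x1+x1*x0)+c*(x0*x0) = g00 →
     a*(x0*y2+x2*y0-x1*y1)+b*(x0*y1+x1*y0)+c*(x0*y0) = g01 →
     a*(x0*z2+x2*z0-x1*z1)+b*(x0*z1+x1*z0)+c*(x0*z0) = g02 →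
     a*(y0*y2+y2*y0-y1*y1)+b*(y0*y1+y1*y0)+c*(y0*y0) = g11 →
     a*(y0*z2+y2*z0-y1*z1)+b*(y0*z1+y1*z0)+c*(y0*z0) = g12 →
     a*(z0*z2+z2*z0-z1*z1)+b*(z0*z1+z1*z0)+c*(z0*z0) = g22 →
     x0^2*(g11*g22-g12^2) + y0^2*(g00*g22-g02^2) + z0^2*(g00*g11-g01^2)
      - 2*x0*y0*(g01*g22-g02*g12) + 2*x0*z0*(g01*g12-g02*g11) - 2*y0*z0*(g00*g12-g01*g02) = 0 := by
    rintro _ _ _ _ _ _ rfl rfl rfl rfl rfl rfl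
    ring
  have := key _ _ _ _ _ _ h00 h01 h02 h11 h12 h22
  linear_combination this

variable {p : ℕ} [hp : Fact p.Prime]

theorem th_th_eq_zero {f : (ZMod p)[X]} (h : th (th f) = 0) : th f = 0 := by
  ext n
  have := congrArg (fun g => coeff g n) h
  simp only [th_coeff, coeff_zero] at this ⊢
  rcases mul_eq_zero.1 this with h | h
  · simp [h]
  · exact h

/-- deformed Apéry numbers -/
noncomputable def ad (p : ℕ) [Fact p.Prime] (n : ℕ) : (ZMod p)[X] :=
  apA (fun k => C (((k.factorial : ZMod p)^4)⁻¹)) p (X + C (n : ZMod p))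

theorem fact_ne {k : ℕ} (hk : k < p) : (k.factorial : ZMod p) ≠ 0 := by
  rw [Ne, ZMod.natCast_eq_zero_iff, hp.out.dvd_factorial]; omega

theorem ad_rec_aux (n : ℕ) (hn : n < p) :
    (X:(ZMod p)[X])^3 ∣ (X + C (n:ZMod p) : (ZMod p)[X]) * (X + C (n:ZMod p) + 1) * apP (p-1) (X + C (n:ZMod p)) ^ 2 := by
  have h1 : ∀ n, n < p - 1 → (X:(ZMod p)[X]) ∣ ∏ i ∈ range (p-1), (X + C (n:ZMod p) - (i:(ZMod p)[X])) := by
    intro n hn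
    refine dvd_trans (dvd_of_eq ?_) (dvd_prod_of_mem _ (mem_range.2 hn))
    simp
  have h2 : ∀ n, 0 < n → n < p → (X:(ZMod p)[X]) ∣ ∏ i ∈ range (p-1), (X + C (n:ZMod p) + (i:(ZMod p)[X]) + 1) := by
    intro n hn0 hn
    refine dvd_trans (dvd_of_eq ?_) (dvd_prod_of_mem _ (mem_range.2 (show p-1-n < p-1 by omega)))
    have : ((n + (p-1-n) + 1 : ℕ) : (ZMod p)[X]) = 0 := by
      rw [show n + (p-1-n) + 1 = p by omega]
      exact CharP.cast_eq_zero _ _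
    push_cast at this
    simp only [map_natCast]
    linear_combination -this
  rw [apP_split]
  have hp2 := hp.out.two_le
  rcases Nat.eq_zero_or_pos n with rfl | hn0
  · obtain ⟨a, ha⟩ := h1 0 (by omega)
    rw [ha]; simp only [Nat.cast_zero, map_zero, add_zero]
    exact ⟨(X+1) * a^2 * (∏ i ∈ range (p-1), (X + (i:(ZMod p)[X]) + 1))^2, by ring⟩
  · rcases Nat.lt_or_ge n (p-1) with hn1 | hn1
    · obtain ⟨a, ha⟩ := h1 n hn1
      obtain ⟨b, hb⟩ := h2 n hn0 hn
      rw [ha, hb]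
      exact ⟨(X + C (n:ZMod p) : (ZMod p)[X]) * (X + C (n:ZMod p) + 1) * X * a^2*b^2, by ring⟩
    · have : ((n + 1 : ℕ) : (ZMod p)[X]) = 0 := by
        rw [show n + 1 = p by omega]
        exact CharP.cast_eq_zero _ _
      push_cast at this
      obtain ⟨b, hb⟩ := h2 n hn0 hn
      rw [hb]
      have e : (X + C (n:ZMod p) + 1 : (ZMod p)[X]) = X := by
        simp only [map_natCast]; linear_combination this
      rw [e]
      exact ⟨(X + C (n:ZMod p)) * b^2 * (∏ i ∈ range (p-1), (X + C (n:ZMod p) - (i:(ZMod p)[X])))^2, by ring⟩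

theorem ad_rec (n : ℕ) (hn : n < p) : ∃ q : (ZMod p)[X],
    (X + C (n:ZMod p) + 1)^3 * ad p (n+1) - (2*(X + C (n:ZMod p))+1)*(17*(X + C (n:ZMod p))^2+17*(X + C (n:ZMod p))+5) * ad p n
      + (X + C (n:ZMod p))^3 * apA (fun k => C (((k.factorial : ZMod p)^4)⁻¹)) p (X + C (n : ZMod p) - 1) = X^3 * q := by
  obtain ⟨q, hq⟩ := ad_rec_aux n hn
  have hp2 := hp.out.two_le
  have h := apA_rec (fun k => C (((k.factorial : ZMod p)^4)⁻¹)) (p-1) (by simp) (by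
    intro k hk
    have h1 := fact_ne (p := p) (k := k+1) (by omega)
    have h2 := fact_ne (p := p) (k := k) (by omega)
    have : ((k:(ZMod p)[X])+1)^4 = C (((k:ZMod p)+1)^4) := by simp
    rw [this, ← C_mul]
    rw [Nat.factorial_succ] at h1 ⊢
    push_cast at h1 ⊢
    have h3 : (k:ZMod p)+1 ≠ 0 := left_ne_zero_of_mul h1
    congr 1
    field_simp) (X + C (n : ZMod p))
  have e : p - 1 + 1 = p := by omega
  have ep : ((p-1:ℕ) : (ZMod p)[X]) = -1 := by
    have : ((p-1+1 : ℕ) : (ZMod p)[X]) = 0 := by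
      rw [e]; exact CharP.cast_eq_zero _ _
    push_cast at this
    linear_combination this
  rw [e, ep] at h
  refine ⟨C ((((p-1).factorial : ZMod p)^4)⁻¹) * (-16*(2*(X + C (n:ZMod p))+1)) * q, ?_⟩
  have e2 : ad p (n+1) = apA (fun k => C (((k.factorial : ZMod p)^4)⁻¹)) p (X + C (n : ZMod p)+1) := by
    rw [ad]; push_cast; simp only [map_add, map_one, add_assoc]
  rw [e2, ad, h]
  linear_combination C ((((p-1).factorial : ZMod p)^4)⁻¹) * (-16*(2*(X + C (n:ZMod p))+1)) * hq

/-- `v_i^{(j)}` truncated at `M` -/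
noncomputable def vv (p : ℕ) [Fact p.Prime] (i j M : ℕ) : (ZMod p)[X] :=
  ∑ n ∈ range M, C (((X + C (n : ZMod p))^j * ad p n).coeff i) * X^n

theorem vv_succ (i j M : ℕ) : vv p i j (M+1) = vv p i j M + C (((X + C (M : ZMod p))^j * ad p M).coeff i) * X^M := by
  rw [vv, sum_range_succ]; rfl

theorem vv_coeff (i j M n : ℕ) : (vv p i j M).coeff n = if n < M then ((X + C (n : ZMod p))^j * ad p n).coeff i else 0 := by
  simp only [vv, finsetSum_coeff, coeff_C_mul_X_pow, Finset.sum_ite_eq, mem_range]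

theorem th_vv0 (j M : ℕ) : th (vv p 0 j M) = vv p 0 (j+1) M - 0 := by
  ext n
  rw [th_coeff, sub_zero, vv_coeff, vv_coeff]
  split_ifs
  · rw [pow_succ, mul_assoc, mul_comm (X + C (n:ZMod p)), ← mul_assoc, mul_add, coeff_add]
    simp; ring
  · simp

theorem th_vv (i j M : ℕ) : th (vv p (i+1) j M) = vv p (i+1) (j+1) M - vv p i j M := by
  ext n
  rw [th_coeff, coeff_sub, vv_coeff, vv_coeff, vv_coeff]
  split_ifs
  · rw [pow_succ, mul_assoc, mul_comm (X + C (n:ZMod p)), ← mul_assoc, mul_add, coeff_add, coeff_mul_X, coeff_mul_C]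
    ring
  · simp

theorem natDegree_vv (i j M : ℕ) : (vv p i j (M+1)).natDegree ≤ M := by
  rw [natDegree_le_iff_coeff_eq_zero]
  intro n hn; rw [vv_coeff, if_neg (by omega)]

theorem coeff_X3 {i : ℕ} (hi : i < 3) (q : (ZMod p)[X]) : (X^3 * q).coeff i = 0 := by
  rw [coeff_X_pow_mul', if_neg (by omega)]

theorem Dop_vv {i : ℕ} (hi : i < 3) (M : ℕ) (hM : M < p) :
    Dop (vv p i 0 (M+1)) (vv p i 1 (M+1)) (vv p i 2 (M+1)) (vv p i 3 (M+1)) =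
    C (((X + C (M : ZMod p) + 1)^3 * ad p M).coeff i) * X^(M+2)
      - C (((X + C (M : ZMod p) + 1)^3 * ad p (M+1)).coeff i) * X^(M+1) := by
  have lin : ∀ (x a : (ZMod p)[X]), C (((x+1)^3*a).coeff i) = C ((x^3*a).coeff i) + 3 * C ((x^2*a).coeff i) + 3 * C ((x^1*a).coeff i) + C ((x^0*a).coeff i) := by
    intro x a
    rw [show (x+1)^3*a = x^3*a + C 3 * (x^2*a) + C 3 * (x^1*a) + x^0*a by simp only [map_ofNat]; ring]
    simp only [coeff_add, coeff_C_mul, map_add, map_mul]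
    simp only [map_ofNat]
  have lin2 : ∀ (x a : (ZMod p)[X]), C (((2*x+1)*(17*x^2+17*x+5)*a).coeff i) = 34 * C ((x^3*a).coeff i) + 51 * C ((x^2*a).coeff i) + 27 * C ((x^1*a).coeff i) + 5 * C ((x^0*a).coeff i) := by
    intro x a
    rw [show (2*x+1)*(17*x^2+17*x+5)*a = C 34 * (x^3*a) + C 51 * (x^2*a) + C 27 * (x^1*a) + C 5 * (x^0*a) by simp only [map_ofNat]; ring]
    simp only [coeff_add, coeff_C_mul, map_add, map_mul]
    simp only [map_ofNat]
  induction M with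
  | zero =>
    obtain ⟨q, hq⟩ := ad_rec (p := p) 0 hp.out.pos
    have h := congrArg (fun f => (C (coeff f i) : (ZMod p)[X])) hq
    simp only [coeff_add, coeff_sub, coeff_X3 hi, map_add, map_sub, map_zero, lin2, Nat.cast_zero, add_zero] at h
    have e0 : ((X:(ZMod p)[X])^3 * ad p 0).coeff i = 0 := coeff_X3 hi _
    simp only [vv, zero_add, sum_range_one, Dop, Nat.cast_zero, map_zero, add_zero] at h ⊢
    rw [lin X (ad p 0)]
    rw [e0]
    simp only [map_zero, map_ofNat] at h ⊢
    linear_combination X * h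
  | succ M ih =>
    have ih' := ih (by omega)
    obtain ⟨q, hq⟩ := ad_rec (p := p) (M+1) hM
    have h := congrArg (fun f => (C (coeff f i) : (ZMod p)[X])) hq
    simp only [coeff_add, coeff_sub, coeff_X3 hi, map_add, map_sub, map_zero, lin2] at h
    simp only [vv_succ _ _ (M+1)]
    rw [lin (X + C ((M+1:ℕ):ZMod p)) (ad p (M+1))]
    have e1 : (X + C (M:ZMod p) + 1 : (ZMod p)[X]) = X + C ((M+1:ℕ):ZMod p) := by
      push_cast; simp only [map_add, map_one, add_assoc]
    have e2 : apA (fun k => C (((k.factorial : ZMod p)^4)⁻¹)) p (X + C ((M+1:ℕ) : ZMod p) - 1) = ad p M := by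
      rw [ad, ← e1, add_sub_cancel_right]
    rw [e2] at h
    rw [e1] at ih'
    simp only [Dop, map_ofNat] at ih' h ⊢
    linear_combination ih' + X^(M+2) * h

end gram

open Finset

section gram
open Polynomial

theorem Bil_top {F : Type*} [CommRing F] (M : ℕ) (u0 u1 u2 v0 v1 v2 : F[X])
    (a0 : u0.natDegree ≤ M) (a1 : u1.natDegree ≤ M) (a2 : u2.natDegree ≤ M)
    (b0 : v0.natDegree ≤ M) (b1 : v1.natDegree ≤ M) (b2 : v2.natDegree ≤ M) :
    (Bil u0 u1 u2 v0 v1 v2).coeff (2+(M+M)) =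
      u0.coeff M * v2.coeff M + u2.coeff M * v0.coeff M - u1.coeff M * v1.coeff M
       + (u0.coeff M * v1.coeff M + u1.coeff M * v0.coeff M) + u0.coeff M * v0.coeff M := by
  have hm : ∀ {f g : F[X]}, f.natDegree ≤ M → g.natDegree ≤ M → (f*g).natDegree ≤ M+M :=
    fun hf hg => natDegree_mul_le.trans (by omega)
  have hq : ∀ a b c : F, (C a + C b * X + C c * X^2).natDegree ≤ 2 := by
    intro a b c; compute_degree
  have hqc : ∀ a b c : F, (C a + C b * X + C c * X^2).coeff 2 = c := by
    intro a b c; simp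
  have e1 : (1 - C 34 * X + X^2 : F[X]) = C 1 + C (-34) * X + C 1 * X^2 := by simp; ring
  have e2 : (X^2 - C 17 * X : F[X]) = C 0 + C (-17) * X + C 1 * X^2 := by simp; ring
  have e3 : (X^2 - C 10 * X : F[X]) = C 0 + C (-10) * X + C 1 * X^2 := by simp; ring
  have d1 : (u0*v2+u2*v0-u1*v1).natDegree ≤ M+M :=
    natDegree_sub_le_of_le (natDegree_add_le_of_degree_le (hm a0 b2) (hm a2 b0)) (hm a1 b1) |>.trans (by simp)
  have d2 : (u0*v1+u1*v0).natDegree ≤ M+M := natDegree_add_le_of_degree_le (hm a0 b1) (hm a1 b0)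
  rw [Bil, e1, e2, e3, coeff_add, coeff_add, coeff_mul_add_eq_of_natDegree_le (hq _ _ _) d1,
    coeff_mul_add_eq_of_natDegree_le (hq _ _ _) d2, coeff_mul_add_eq_of_natDegree_le (hq _ _ _) (hm a0 b0),
    hqc, hqc, hqc, coeff_sub, coeff_add, coeff_add, coeff_mul_add_eq_of_natDegree_le a0 b2,
    coeff_mul_add_eq_of_natDegree_le a2 b0, coeff_mul_add_eq_of_natDegree_le a1 b1,
    coeff_mul_add_eq_of_natDegree_le a0 b1, coeff_mul_add_eq_of_natDegree_le a1 b0,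
    coeff_mul_add_eq_of_natDegree_le a0 b0]
  ring

theorem Bil_bot {F : Type*} [CommRing F] (u0 u1 u2 v0 v1 v2 : F[X]) :
    (Bil u0 u1 u2 v0 v1 v2).coeff 0 =
      u0.coeff 0 * v2.coeff 0 + u2.coeff 0 * v0.coeff 0 - u1.coeff 0 * v1.coeff 0 := by
  simp [coeff_zero_eq_eval_zero, Bil]

theorem apP_map {R S : Type*} [CommRing R] [CommRing S] (f : R →+* S) (k : ℕ) (x : R) :
    f (apP k x) = apP k (f x) := by
  simp [apP, map_prod]

variable {p : ℕ} [hp : Fact p.Prime]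

theorem cast_p1 {S : Type*} [CommRing S] [CharP S p] : ((p-1:ℕ) : S) = -1 := by
  have : ((p-1+1 : ℕ) : S) = 0 := by
    rw [Nat.sub_add_cancel hp.out.pos]; exact CharP.cast_eq_zero _ _
  push_cast at this
  linear_combination this

theorem sum_range_p {A : Type*} [AddCommMonoid A] (f : ℕ → A) :
    ∑ k ∈ range p, f k = ∑ k ∈ range (p-1), f (k+1) + f 0 := by
  have h : ∀ q, 0 < q → ∑ k ∈ range q, f k = ∑ k ∈ range (q-1), f (k+1) + f 0 := by
    intro q hq
    obtain ⟨r, rfl⟩ : ∃ r, q = r+1 := ⟨q-1, by omega⟩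
    rw [sum_range_succ']; rfl
  exact h p hp.out.pos

theorem ad_refl (n : ℕ) (hn : n < p) : ad p (p-1-n) = (ad p n).comp (-X) := by
  rw [← coe_compRingHom_apply, ad, ad, apA, apA, map_sum]
  apply sum_congr rfl
  intro k _
  rw [map_mul, map_pow, apP_map, coe_compRingHom_apply, coe_compRingHom_apply, C_comp, add_comp, X_comp, C_comp]
  rw [← apP_refl k (-X + _)]
  congr 3
  have : ((p-1-n:ℕ):ZMod p) = -1 - n := by
    rw [Nat.cast_sub (by omega), cast_p1 (p := p)]
  rw [this]; simp; ring

theorem ad_zero (hp3 : 3 < p) : ∃ q, ad p 0 = 1 + X^3 * q := by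
  choose e he using fun k => apE_sq k (X : (ZMod p)[X])
  have : ad p 0 = 1 + ∑ k ∈ range (p-1), C ((((k+1).factorial : ZMod p)^4)⁻¹) * ((X+(k:(ZMod p)[X])+1)^2 * ((k.factorial:(ZMod p)[X])^4 * X^2 + X^3 * e k)) := by
    rw [ad, apA]
    rw [sum_range_p, add_comm]
    have t0 : C (((Nat.factorial 0 : ZMod p)^4)⁻¹) * apP 0 (X + C ((0:ℕ):ZMod p))^2 = 1 := by simp
    rw [t0, add_right_inj]
    refine sum_congr rfl fun k _ => ?_
    rw [← he k, apP_succ_E, Nat.cast_zero, C_0, add_zero, mul_pow]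
  have hs : ∑ k ∈ range (p-1), (((k:ZMod p)+1)^2)⁻¹ = 0 := by
    have := sum_inv_sq_zmod (p := p) hp3
    rw [sum_range_p] at this
    simpa using this
  have hs2 : ∑ k ∈ range (p-1), C ((((k+1).factorial : ZMod p)^4)⁻¹) * (C ((k:ZMod p)+1)^2 * ((k.factorial:(ZMod p)[X])^4 * X^2)) = 0 := by
    have : ∀ k ∈ range (p-1), C ((((k+1).factorial : ZMod p)^4)⁻¹) * (C ((k:ZMod p)+1)^2 * ((k.factorial:(ZMod p)[X])^4 * X^2)) = C ((((k:ZMod p)+1)^2)⁻¹) * X^2 := by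
      intro k hk
      rw [mem_range] at hk
      have h1 := fact_ne (p := p) (k := k+1) (by omega)
      have h2 := fact_ne (p := p) (k := k) (by omega)
      rw [Nat.factorial_succ] at h1 ⊢
      push_cast at h1 ⊢
      have h3 : (k:ZMod p)+1 ≠ 0 := left_ne_zero_of_mul h1
      rw [← mul_assoc, ← mul_assoc]
      congr 1
      rw [show (k.factorial : (ZMod p)[X]) = C (k.factorial : ZMod p) by simp, ← C_pow, ← C_pow, ← C_mul, ← C_mul]
      congr 1; field_simp
    rw [sum_congr rfl this, ← sum_mul, ← map_sum, hs]; simp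
  refine ⟨∑ k ∈ range (p-1), C ((((k+1).factorial : ZMod p)^4)⁻¹) * ((X+2*((k:(ZMod p)[X])+1)) * (k.factorial:(ZMod p)[X])^4 + (X+(k:(ZMod p)[X])+1)^2 * e k), ?_⟩
  rw [this, mul_sum, ← add_zero (∑ k ∈ range (p-1), X^3 * _), ← hs2, ← sum_add_distrib]
  rw [add_right_inj]
  refine sum_congr rfl fun k _ => ?_
  simp only [map_add, map_natCast, map_one]
  ring

theorem ad_last (hp3 : 3 < p) : ∃ q, ad p (p-1) = 1 + X^3 * q := by
  obtain ⟨q, hq⟩ := ad_zero (p := p) hp3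
  have := ad_refl (p := p) 0 hp.out.pos
  rw [Nat.sub_zero, hq] at this
  refine ⟨-(q.comp (-X)), ?_⟩
  rw [this]; simp; ring

theorem Dop_vv_zero {i : ℕ} (hi : i < 3) :
    Dop (vv p i 0 p) (vv p i 1 p) (vv p i 2 p) (vv p i 3 p) = 0 := by
  have h := Dop_vv (p := p) hi (p-1) (by have := hp.out.pos; omega)
  rw [Nat.sub_add_cancel hp.out.pos] at h
  rw [h, cast_p1 (p := p)]
  have e : (X + C (-1:ZMod p) + 1 : (ZMod p)[X]) = X := by simp
  rw [e, coeff_X3 hi, coeff_X3 hi]; simp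

/-- Gram entries -/
noncomputable def Gm (p : ℕ) [Fact p.Prime] (i j : ℕ) : (ZMod p)[X] :=
  Bil (vv p i 0 p) (vv p i 1 p) (vv p i 2 p) (vv p j 0 p) (vv p j 1 p) (vv p j 2 p)

theorem Gm_comm (i j : ℕ) : Gm p i j = Gm p j i := by
  simp only [Gm, Bil]; ring

theorem Bil_zero_l {F : Type*} [CommRing F] (v0 v1 v2 : F[X]) : Bil 0 0 0 v0 v1 v2 = 0 := by
  simp [Bil]
theorem Bil_zero_r {F : Type*} [CommRing F] (v0 v1 v2 : F[X]) : Bil v0 v1 v2 0 0 0 = 0 := by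
  simp [Bil]

theorem th_Gm00 : th (Gm p 0 0) = 0 := by
  rw [Gm, th_Bil _ _ _ (vv p 0 3 p) _ _ _ (vv p 0 3 p) 0 0 0 0 0 0 (th_vv0 _ _) (th_vv0 _ _) (th_vv0 _ _) (th_vv0 _ _) (th_vv0 _ _) (th_vv0 _ _), Dop_vv_zero (by omega), Bil_zero_l, Bil_zero_r]; simp

theorem th_Gm0 (j : ℕ) (hj : j+1 < 3) : th (Gm p 0 (j+1)) = - Gm p 0 j := by
  rw [Gm, th_Bil _ _ _ (vv p 0 3 p) _ _ _ (vv p (j+1) 3 p) 0 0 0 _ _ _ (th_vv0 _ _) (th_vv0 _ _) (th_vv0 _ _) (th_vv _ _ _) (th_vv _ _ _) (th_vv _ _ _), Dop_vv_zero (i := 0) (by omega), Dop_vv_zero hj, Bil_zero_l, Gm]; simp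

theorem th_Gm (i j : ℕ) (hi : i+1 < 3) (hj : j+1 < 3) : th (Gm p (i+1) (j+1)) = - Gm p i (j+1) - Gm p (i+1) j := by
  rw [Gm, th_Bil _ _ _ (vv p (i+1) 3 p) _ _ _ (vv p (j+1) 3 p) _ _ _ _ _ _ (th_vv _ _ _) (th_vv _ _ _) (th_vv _ _ _) (th_vv _ _ _) (th_vv _ _ _) (th_vv _ _ _), Dop_vv_zero (i := i+1) hi, Dop_vv_zero (i := j+1) hj, Gm, Gm]; simp

theorem th_neg {F : Type*} [CommRing F] (f : F[X]) : th (-f) = -th f := by simp [th]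

theorem Q_zero (hp3 : 3 < p) :
    2 * vv p 0 0 p * vv p 2 0 p - (vv p 1 0 p)^2 = 0 := by
  have t00 := th_Gm00 (p := p)
  have t01 := th_Gm0 (p := p) 0 (by omega)
  have t02 := th_Gm0 (p := p) 1 (by omega)
  have t11 := th_Gm (p := p) 0 0 (by omega) (by omega)
  have t12 := th_Gm (p := p) 0 1 (by omega) (by omega)
  have t22 := th_Gm (p := p) 1 1 (by omega) (by omega)
  simp only [zero_add, Nat.reduceAdd] at t01 t02 t11 t12 t22
  have two : (2:(ZMod p)[X]) ≠ 0 := by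
    intro h
    have : ((2:ℕ):(ZMod p)) = 0 := by
      have := congrArg (fun f => coeff f 0) h
      simpa using this
    rw [ZMod.natCast_eq_zero_iff] at this
    have := Nat.le_of_dvd (by norm_num) this
    omega
  have g00 : Gm p 0 0 = 0 := by
    have : th (Gm p 0 1) = 0 := th_th_eq_zero (by rw [t01, th_neg, t00, neg_zero])
    rw [t01] at this; simpa using this
  have g01 : Gm p 0 1 = 0 := by
    have : th (Gm p 0 2) = 0 := th_th_eq_zero (by rw [t02, th_neg, t01, g00]; simp)
    rw [t02] at this; simpa using this
  rw [Gm_comm 1 0, g01] at t11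
  rw [g01] at t02
  rw [Gm_comm 2 1] at t22
  have g1102 : Gm p 1 1 = - Gm p 0 2 := by
    have : th (Gm p 1 2) = 0 := th_th_eq_zero (by rw [t12, th_sub, th_neg, t02, t11]; simp)
    rw [t12] at this
    linear_combination -this
  have g12 : Gm p 1 2 = 0 := by
    have : th (Gm p 2 2) = 0 := th_th_eq_zero (by rw [t22, th_sub, th_neg, t12, g1102]; simp)
    rw [t22] at this
    apply mul_left_cancel₀ two; linear_combination -this
  have tb : th (Gm p 2 2) = 0 := by rw [t22, g12]; simp
  obtain ⟨q0, hq0⟩ := ad_zero (p := p) hp3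
  obtain ⟨q1, hq1⟩ := ad_last (p := p) hp3
  have v0 : ∀ i j, i < 3 → (vv p i j p).coeff 0 = if i = j then 1 else 0 := by
    intro i j hi
    rw [vv_coeff, if_pos hp.out.pos, hq0]
    rw [show (X + C ((0:ℕ):ZMod p))^j * (1 + X^3*q0) = X^j + X^3*(X^j*q0) by simp; ring, coeff_add, coeff_X3 hi, coeff_X_pow, add_zero]
  have v1 : ∀ i j, i < 3 → (vv p i j p).coeff (p-1) = ((X-1:(ZMod p)[X])^j).coeff i := by
    intro i j hi
    rw [vv_coeff, if_pos (by have := hp.out.pos; omega), hq1, cast_p1 (p := p)]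
    rw [show (X + C (-1:ZMod p))^j * (1 + X^3*q1) = (X-1)^j + X^3*((X-1)^j*q1) by simp; ring, coeff_add, coeff_X3 hi, add_zero]
  have q2 : (X-1:(ZMod p)[X])^2 = X^2 - C 2 * X + 1 := by simp only [map_ofNat]; ring
  have hdeg : ∀ i j, (vv p i j p).natDegree ≤ p-1 := by
    intro i j
    have := natDegree_vv (p := p) i j (p-1)
    rwa [Nat.sub_add_cancel hp.out.pos] at this
  have hpp : 2 + ((p-1)+(p-1)) = 2*p := by omega
  have k0 : (Gm p 0 2).coeff 0 = 1 := by
    rw [Gm, Bil_bot]; simp only [v0 0 _ (by omega), v0 2 _ (by omega)]; simp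
  have k2 : (Gm p 0 2).coeff (2*p) = 1 := by
    rw [← hpp, Gm, Bil_top _ _ _ _ _ _ _ (hdeg _ _) (hdeg _ _) (hdeg _ _) (hdeg _ _) (hdeg _ _) (hdeg _ _)]; simp only [v1 0 _ (by omega), v1 2 _ (by omega), q2]
    simp [coeff_X, coeff_one]
  have b0 : (Gm p 2 2).coeff 0 = 0 := by
    rw [Gm, Bil_bot]; simp only [v0 2 _ (by omega)]; simp
  have b2 : (Gm p 2 2).coeff (2*p) = 0 := by
    rw [← hpp, Gm, Bil_top _ _ _ _ _ _ _ (hdeg _ _) (hdeg _ _) (hdeg _ _) (hdeg _ _) (hdeg _ _) (hdeg _ _)]; simp only [v1 2 _ (by omega), q2]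
    simp [coeff_X, coeff_one]
  have bdeg : (Gm p 2 2).natDegree ≤ 2*p := by
    have := Bil_natDegree (p-1) _ _ _ _ _ _ (hdeg 2 0) (hdeg 2 1) (hdeg 2 2) (hdeg 2 0) (hdeg 2 1) (hdeg 2 2)
    rw [Gm]; omega
  have kdeg : 2*p ≤ (Gm p 0 2).natDegree := le_natDegree_of_ne_zero (by rw [k2]; simp)
  have bform : Gm p 2 2 = C ((Gm p 2 2).coeff p) * X^p := by
    ext n
    rw [coeff_C_mul_X_pow]
    split_ifs with h
    · rw [h]
    · by_cases hn0 : n = 0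
      · rw [hn0, b0]
      by_cases hn2 : n = 2*p
      · rw [hn2, b2]
      by_cases hn : 2*p < n
      · exact coeff_eq_zero_of_natDegree_lt (by omega)
      · have := congrArg (fun f => coeff f n) tb
        simp only [th_coeff, coeff_zero] at this
        rcases mul_eq_zero.1 this with h1 | h1
        · exfalso
          rw [ZMod.natCast_eq_zero_iff] at h1
          obtain ⟨c, rfl⟩ := h1
          rcases c with _ | _ | c
          · omega
          · omega
          · rcases c with _ | c
            · omega
            · nlinarith [hp.out.pos]
        · exact h1
  have k_ne : Gm p 0 2 ≠ 0 := by
    intro h; rw [h] at k0; simp at k0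
  have main : Gm p 0 2 * (2 * vv p 0 0 p * vv p 2 0 p - (vv p 1 0 p)^2) = Gm p 2 2 * (vv p 0 0 p)^2 := by
    apply mul_left_cancel₀ k_ne
    exact gram_id (1 - C 34 * X + X^2) (X^2 - C 17 * X) (X^2 - C 10 * X) _ (vv p 0 1 p) (vv p 0 2 p) _ (vv p 1 1 p) (vv p 1 2 p) _ (vv p 2 1 p) (vv p 2 2 p) _ _ g00 g01 rfl g1102 g12 rfl
  by_contra hQ
  have hX : X^p ∣ 2 * vv p 0 0 p * vv p 2 0 p - (vv p 1 0 p)^2 := by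
    apply prime_X.pow_dvd_of_dvd_mul_left p (a := Gm p 0 2)
    · rw [X_dvd_iff, k0]; exact one_ne_zero
    · rw [main, bform]; exact (Dvd.intro_left _ rfl).mul_right _
  have hd : p ≤ (2 * vv p 0 0 p * vv p 2 0 p - (vv p 1 0 p)^2).natDegree := by
    have := natDegree_le_of_dvd hX hQ
    rwa [natDegree_X_pow] at this
  have h1 := congrArg natDegree main
  rw [natDegree_mul k_ne hQ, bform] at h1
  have h2 : (C ((Gm p 2 2).coeff p) * X^p * (vv p 0 0 p)^2).natDegree ≤ p + 2*(p-1) := by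
    refine natDegree_mul_le.trans (add_le_add (natDegree_C_mul_X_pow_le _ _) (natDegree_pow_le.trans (Nat.mul_le_mul_left _ (hdeg _ _))))
  have := hp.out.pos
  omega

theorem vv_eval (i : ℕ) : (vv p i 0 p).eval (-1) = ∑ n ∈ range p, (-1)^n * (ad p n).coeff i := by
  simp only [vv, eval_finsetSum, eval_mul, eval_C, eval_pow, eval_X, pow_zero, one_mul]
  apply sum_congr rfl; intros; ring

theorem ad_coeff0 (n : ℕ) (hn : n < p) : (ad p n).coeff 0 = (az n : ZMod p) := by
  rw [← apA_eq_az p n hn (fun k hk => fact_ne hk), coeff_zero_eq_eval_zero, ad, apA, apA, ← coe_evalRingHom, map_sum]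
  apply sum_congr rfl
  intro k _
  rw [map_mul, map_pow, apP_map]; simp

theorem alt_ad2 (hp3 : 3 < p) (h0 : ((aS p 0 : ℤ) : ZMod p) ≠ 0) :
    ∑ n ∈ range p, (-1)^n * (ad p n).coeff 2 = 0 := by
  have hQ := congrArg (eval (-1)) (Q_zero (p := p) hp3)
  simp only [eval_sub, eval_mul, eval_pow, vv_eval, eval_ofNat, eval_zero] at hQ
  have e0 : ∑ n ∈ range p, (-1)^n * (ad p n).coeff 0 = ((aS p 0 : ℤ) : ZMod p) := by
    rw [aS]; push_cast
    apply sum_congr rfl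
    intro n hn
    rw [ad_coeff0 n (mem_range.1 hn)]; simp
  have two : (2:ZMod p) ≠ 0 := by
    intro h
    have : ((2:ℕ):(ZMod p)) = 0 := by simpa using h
    rw [ZMod.natCast_eq_zero_iff] at this
    have := Nat.le_of_dvd (by norm_num) this
    omega
  have hodd : Odd p := hp.out.odd_of_ne_two (by omega)
  have e1 : ∑ n ∈ range p, (-1)^n * (ad p n).coeff 1 = 0 := by
    have : ∑ n ∈ range p, (-1)^n * (ad p n).coeff 1 = - ∑ n ∈ range p, (-1)^n * (ad p n).coeff 1 := by
      conv_lhs => rw [← sum_range_reflect]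
      rw [← sum_neg_distrib]
      apply sum_congr rfl
      intro n hn
      rw [mem_range] at hn
      rw [ad_refl n hn, show (-X:(ZMod p)[X]) = C (-1) * X by simp, comp_C_mul_X_coeff]
      have : (-1:ZMod p)^(p-1-n) = (-1)^n := by
        have h1 : (-1:ZMod p)^(p-1-n) * (-1)^n = 1 := by
          rw [← pow_add, show p-1-n+n = p-1 by omega]
          exact (Nat.Odd.sub_odd hodd odd_one).neg_one_pow
        have h2 : (-1:ZMod p)^n * (-1)^n = 1 := by
          rw [← pow_add]; exact Even.neg_one_pow ⟨n, rfl⟩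
        have h3 : (-1:ZMod p)^n ≠ 0 := pow_ne_zero _ (by simp)
        exact mul_right_cancel₀ h3 (h1.trans h2.symm)
      rw [this]; ring
    apply mul_left_cancel₀ two; linear_combination this
  rw [e0, e1] at hQ
  have : (2 * ((aS p 0 : ℤ) : ZMod p)) * ∑ n ∈ range p, (-1)^n * (ad p n).coeff 2 = 0 := by linear_combination hQ
  exact (mul_eq_zero.1 this).resolve_left (mul_ne_zero two h0)

/-- the correction coefficients -/
def cK (K : Type*) [Field K] : ℕ → K
  | 0 => 0
  | k+1 => ((2*k+1)^3 * cK K k - (3*k+2)) / (2*(k+1)^3)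

theorem sum_cK (hp3 : 3 < p) (h0 : ((aS p 0 : ℤ) : ZMod p) ≠ 0) :
    ∑ k ∈ range p, cK (ZMod p) k = 0 := by
  have two : (2:ZMod p) ≠ 0 := by
    intro h
    have : ((2:ℕ):(ZMod p)) = 0 := by simpa using h
    rw [ZMod.natCast_eq_zero_iff] at this
    have := Nat.le_of_dvd (by norm_num) this
    omega
  have hodd : Odd p := hp.out.odd_of_ne_two (by omega)
  set tau : ℕ → (ZMod p)[X] := fun k => ∑ n ∈ range p, (-1)^n * apP k (X + C (n:ZMod p))^2 with htau
  have hrec : ∀ k : ℕ, 2 * tau (k+1) - (2*(k:(ZMod p)[X])+1)^3*((k:(ZMod p)[X])+1) * tau k = 2 * ((X^2 - ((k:(ZMod p)[X])+1)*(3*(k:(ZMod p)[X])+2)) * apE k X ^ 2) := by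
    intro k
    have := alt_tele_odd (fun x : (ZMod p)[X] => (x^2 - ((k:(ZMod p)[X])+1)*(3*(k:(ZMod p)[X])+2)) * apE k x ^ 2) X p hodd
    rw [CharP.cast_eq_zero (ZMod p)[X] p, add_zero, ← two_mul] at this
    rw [← this, htau]
    simp only [mul_sum, ← sum_sub_distrib]
    apply sum_congr rfl
    intro n _
    rw [← apT_rec k (X + (n:(ZMod p)[X]))]
    simp only [map_natCast]; ring
  have hc : ∀ k, k < p → (tau k).coeff 2 = 2 * (k.factorial : ZMod p)^4 * cK (ZMod p) k := by
    intro k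
    induction k with
    | zero =>
      intro _
      simp only [htau, apP_zero, cK]
      have : ∑ n ∈ range p, (-1:(ZMod p)[X])^n * 1^2 = 1 := by
        simp only [one_pow, mul_one]
        rw [neg_one_geom_sum, if_neg (by simpa using hodd)]
      rw [this, coeff_one]; simp
    | succ k ih =>
      intro hk
      have ih' := ih (by omega)
      have h := congrArg (fun f => coeff f 2) (hrec k)
      obtain ⟨q, hq⟩ := apE_sq k (X : (ZMod p)[X])
      have e1 : 2 * tau (k+1) - (2*(k:(ZMod p)[X])+1)^3*((k:(ZMod p)[X])+1) * tau k = C 2 * tau (k+1) - C ((2*(k:ZMod p)+1)^3*(k+1)) * tau k := by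
        simp only [map_mul, map_add, map_pow, map_natCast, map_one, map_ofNat]
      have e2 : 2 * ((X^2 - ((k:(ZMod p)[X])+1)*(3*(k:(ZMod p)[X])+2)) * apE k X ^ 2) = X^3 * (2*X*(k.factorial:(ZMod p)[X])^4 + 2*X^2*q-2*((k:(ZMod p)[X])+1)*(3*(k:(ZMod p)[X])+2)*q) - C (2*((k:ZMod p)+1)*(3*k+2)*(k.factorial:ZMod p)^4) * X^2 := by
        simp only [map_mul, map_add, map_pow, map_natCast, map_one, map_ofNat, hq]; ring
      simp only [e1, e2, coeff_sub, coeff_C_mul, coeff_X3 (show 2 < 3 by omega), coeff_X_pow, ih', if_true] at h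
      apply mul_left_cancel₀ two
      have h1 := fact_ne (p := p) (k := k+1) (by omega)
      rw [Nat.factorial_succ] at h1 ⊢
      push_cast at h1 ⊢
      have h3 : (k:ZMod p)+1 ≠ 0 := left_ne_zero_of_mul h1
      have hcK : cK (ZMod p) (k+1) * (2*((k:ZMod p)+1)^3) = (2*k+1)^3 * cK (ZMod p) k - (3*k+2) := by
        rw [cK]; field_simp
      linear_combination h - 2*((k:ZMod p)+1)*(k.factorial:ZMod p)^4 * hcK
  have h := alt_ad2 hp3 h0
  have e : ∑ n ∈ range p, (-1:ZMod p)^n * (ad p n).coeff 2 = ∑ k ∈ range p, ((k.factorial : ZMod p)^4)⁻¹ * (tau k).coeff 2 := by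
    simp only [ad, apA, htau, finsetSum_coeff, mul_sum]
    rw [sum_comm]
    apply sum_congr rfl; intro k _
    apply sum_congr rfl; intro n _
    rw [coeff_C_mul]
    have : ((-1:(ZMod p)[X])^n * apP k (X + C (n:ZMod p))^2).coeff 2 = (-1)^n * (apP k (X + C (n:ZMod p))^2).coeff 2 := by
      rw [show (-1:(ZMod p)[X])^n = C ((-1)^n) by simp, coeff_C_mul]
    rw [this]; ring
  rw [e] at h
  apply mul_left_cancel₀ two
  rw [mul_zero, ← h, mul_sum]
  apply sum_congr rfl
  intro k hk
  rw [hc k (mem_range.1 hk)]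
  have := fact_ne (p := p) (mem_range.1 hk)
  field_simp

end gram

open Finset

section cong
variable {p : ℕ} [hp : Fact p.Prime]

/-- `p`-integrality -/
def Oi (p : ℕ) [Fact p.Prime] : Subring ℚ_[p] := PadicInt.subring p

/-- congruence modulo `p^r` in `ℚ_p` -/
def cg (p r : ℕ) [Fact p.Prime] (a b : ℚ_[p]) : Prop := ∃ c ∈ Oi p, a - b = (p:ℚ_[p])^r * c

/-- units -/
def un (p : ℕ) [Fact p.Prime] (a : ℚ_[p]) : Prop := a ≠ 0 ∧ a ∈ Oi p ∧ a⁻¹ ∈ Oi p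

theorem mem_Oi {a : ℚ_[p]} : a ∈ Oi p ↔ ‖a‖ ≤ 1 := Iff.rfl

theorem p_ne : (p:ℚ_[p]) ≠ 0 := by exact_mod_cast hp.out.ne_zero

theorem cg.refl {r : ℕ} (a : ℚ_[p]) : cg p r a a := ⟨0, zero_mem _, by simp⟩
theorem cg.of_eq {r : ℕ} {a b : ℚ_[p]} (h : a = b) : cg p r a b := h ▸ cg.refl a
theorem cg.symm {r : ℕ} {a b : ℚ_[p]} (h : cg p r a b) : cg p r b a := by
  obtain ⟨c, hc, h⟩ := h
  exact ⟨-c, neg_mem hc, by linear_combination -h⟩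
theorem cg.trans {r : ℕ} {a b c : ℚ_[p]} (h : cg p r a b) (h' : cg p r b c) : cg p r a c := by
  obtain ⟨x, hx, h⟩ := h
  obtain ⟨y, hy, h'⟩ := h'
  exact ⟨x+y, add_mem hx hy, by linear_combination h+h'⟩
theorem cg.add {r : ℕ} {a b c d : ℚ_[p]} (h : cg p r a b) (h' : cg p r c d) : cg p r (a+c) (b+d) := by
  obtain ⟨x, hx, h⟩ := h
  obtain ⟨y, hy, h'⟩ := h'
  exact ⟨x+y, add_mem hx hy, by linear_combination h+h'⟩
theorem cg.neg {r : ℕ} {a b : ℚ_[p]} (h : cg p r a b) : cg p r (-a) (-b) := by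
  obtain ⟨x, hx, h⟩ := h
  exact ⟨-x, neg_mem hx, by linear_combination -h⟩
theorem cg.sub {r : ℕ} {a b c d : ℚ_[p]} (h : cg p r a b) (h' : cg p r c d) : cg p r (a-c) (b-d) := by
  rw [sub_eq_add_neg, sub_eq_add_neg]; exact h.add h'.neg
theorem cg.mul_left {r : ℕ} {a b c : ℚ_[p]} (hc : c ∈ Oi p) (h : cg p r a b) : cg p r (c*a) (c*b) := by
  obtain ⟨x, hx, h⟩ := h
  exact ⟨c*x, mul_mem hc hx, by linear_combination c*h⟩
theorem cg.mul_right {r : ℕ} {a b c : ℚ_[p]} (hc : c ∈ Oi p) (h : cg p r a b) : cg p r (a*c) (b*c) := by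
  rw [mul_comm a, mul_comm b]; exact h.mul_left hc
theorem cg.mul {r : ℕ} {a b c d : ℚ_[p]} (hb : b ∈ Oi p) (hc : c ∈ Oi p) (h : cg p r a b) (h' : cg p r c d) :
    cg p r (a*c) (b*d) := (h.mul_right hc).trans (h'.mul_left hb)
theorem cg.mono {r s : ℕ} (hs : s ≤ r) {a b : ℚ_[p]} (h : cg p r a b) : cg p s a b := by
  obtain ⟨x, hx, h⟩ := h
  refine ⟨p^(r-s)*x, mul_mem (pow_mem (natCast_mem _ _) _) hx, ?_⟩
  rw [h, ← mul_assoc, ← pow_add, Nat.add_sub_cancel' hs]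
theorem cg.sum {ι : Type*} {s : Finset ι} {r : ℕ} {f g : ι → ℚ_[p]} (h : ∀ i ∈ s, cg p r (f i) (g i)) :
    cg p r (∑ i ∈ s, f i) (∑ i ∈ s, g i) := by
  classical
  induction s using Finset.induction_on with
  | empty => simpa using cg.refl _
  | insert a s ha ih =>
    rw [sum_insert ha, sum_insert ha]
    exact (h a (mem_insert_self _ _)).add (ih fun i hi => h i (mem_insert_of_mem hi))
theorem cg.pmul {r : ℕ} (s : ℕ) {a b : ℚ_[p]} (h : cg p r a b) : cg p (r+s) ((p:ℚ_[p])^s*a) ((p:ℚ_[p])^s*b) := by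
  obtain ⟨x, hx, h⟩ := h
  exact ⟨x, hx, by rw [pow_add]; linear_combination (p:ℚ_[p])^s * h⟩
theorem cg.pcancel {r : ℕ} (s : ℕ) {a b : ℚ_[p]} (h : cg p (r+s) ((p:ℚ_[p])^s*a) ((p:ℚ_[p])^s*b)) : cg p r a b := by
  obtain ⟨x, hx, h⟩ := h
  refine ⟨x, hx, ?_⟩
  apply mul_left_cancel₀ (pow_ne_zero s (p_ne (p := p)))
  rw [pow_add] at h; linear_combination h
theorem cg.mem {r : ℕ} {a b : ℚ_[p]} (h : cg p r a b) (hb : b ∈ Oi p) : a ∈ Oi p := by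
  obtain ⟨x, hx, h⟩ := h
  rw [show a = b + p^r*x by linear_combination h]
  exact add_mem hb (mul_mem (pow_mem (natCast_mem _ _) _) hx)
theorem cg.pow {r : ℕ} {a b : ℚ_[p]} (hb : b ∈ Oi p) (h : cg p r a b) (n : ℕ) : cg p r (a^n) (b^n) := by
  induction n with
  | zero => simpa using cg.refl _
  | succ n ih => rw [pow_succ, pow_succ]; exact ih.mul (pow_mem hb _) (h.mem hb) h
theorem cg_pmem {r : ℕ} {c : ℚ_[p]} (hc : c ∈ Oi p) : cg p r ((p:ℚ_[p])^r*c) 0 := ⟨c, hc, by ring⟩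

theorem un.mul {a b : ℚ_[p]} (ha : un p a) (hb : un p b) : un p (a*b) :=
  ⟨mul_ne_zero ha.1 hb.1, mul_mem ha.2.1 hb.2.1, by rw [mul_inv]; exact mul_mem ha.2.2 hb.2.2⟩
theorem un.inv {a : ℚ_[p]} (ha : un p a) : un p a⁻¹ :=
  ⟨inv_ne_zero ha.1, ha.2.2, by rw [inv_inv]; exact ha.2.1⟩
theorem un.div {a b : ℚ_[p]} (ha : un p a) (hb : un p b) : un p (a/b) := by
  rw [div_eq_mul_inv]; exact ha.mul hb.inv
theorem un.one : un p 1 := ⟨one_ne_zero, one_mem _, by simpa using one_mem _⟩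
theorem un.neg {a : ℚ_[p]} (ha : un p a) : un p (-a) :=
  ⟨neg_ne_zero.2 ha.1, neg_mem ha.2.1, by rw [inv_neg]; exact neg_mem ha.2.2⟩
theorem un.pow {a : ℚ_[p]} (ha : un p a) (n : ℕ) : un p (a^n) := 
  ⟨pow_ne_zero _ ha.1, pow_mem ha.2.1 _, by rw [← inv_pow]; exact pow_mem ha.2.2 _⟩
theorem un.prod {ι : Type*} {s : Finset ι} {f : ι → ℚ_[p]} (h : ∀ i ∈ s, un p (f i)) : un p (∏ i ∈ s, f i) := 
  Finset.prod_induction _ _ (fun _ _ => un.mul) un.one h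
theorem un_iff {a : ℚ_[p]} : un p a ↔ ‖a‖ = 1 := by
  constructor
  · rintro ⟨h0, h1, h2⟩
    rw [mem_Oi] at h1 h2
    rw [norm_inv] at h2
    have := norm_pos_iff.2 h0
    have h3 := (inv_le_one₀ this).1 h2
    linarith
  · intro h
    refine ⟨?_, ?_, ?_⟩
    · rintro rfl; simp at h
    · rw [mem_Oi, h]
    · rw [mem_Oi, norm_inv, h]; simp
theorem un_int {n : ℤ} (h : ¬ (p:ℤ) ∣ n) : un p (n:ℚ_[p]) := by
  rw [un_iff]
  have h1 := Padic.norm_int_le_one (p := p) n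
  rcases h1.lt_or_eq with h2 | h2
  · exact absurd (Padic.norm_intCast_lt_one_iff.1 h2) h
  · exact h2
theorem un_nat {n : ℕ} (h : ¬ p ∣ n) : un p (n:ℚ_[p]) := by
  have := un_int (p := p) (n := n) (by exact_mod_cast h)
  simpa using this
theorem un_nat' {n : ℕ} (h0 : 0 < n) (h : n < p) : un p (n:ℚ_[p]) :=
  un_nat fun hd => by have := Nat.le_of_dvd h0 hd; omega
theorem un_two (hp3 : 3 < p) : un p 2 := by simpa using un_nat' (p := p) (n := 2) (by norm_num) (by omega)
theorem un_three (hp3 : 3 < p) : un p 3 := by simpa using un_nat' (p := p) (n := 3) (by norm_num) (by omega)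
theorem un_fact {n : ℕ} (h : n < p) : un p (n.factorial:ℚ_[p]) := 
  un_nat fun hd => by rw [hp.out.dvd_factorial] at hd; omega
theorem un.cancel {r : ℕ} {a b c : ℚ_[p]} (hc : un p c) (h : cg p r (c*a) (c*b)) : cg p r a b := by
  have := h.mul_left hc.2.2
  rwa [inv_mul_cancel_left₀ hc.1, inv_mul_cancel_left₀ hc.1] at this
theorem un.cg {r : ℕ} (hr : 0 < r) {a b : ℚ_[p]} (hb : un p b) (h : cg p r a b) : un p a := by
  obtain ⟨c, hc, h⟩ := h
  rw [un_iff] at hb ⊢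
  have ha : a = b + p^r*c := by linear_combination h
  have h1 : ‖(p:ℚ_[p])^r*c‖ < 1 := by
    rw [norm_mul, norm_pow, Padic.norm_p]
    rw [mem_Oi] at hc
    have h2 : ((p:ℝ)⁻¹)^r < 1 := pow_lt_one₀ (by positivity) (inv_lt_one_of_one_lt₀ (by exact_mod_cast hp.out.one_lt)) (by omega)
    have h3 : 0 ≤ ((p:ℝ)⁻¹)^r := by positivity
    nlinarith [norm_nonneg c]
  rw [ha]
  rw [Padic.add_eq_max_of_ne (by rw [hb]; exact h1.ne'), hb]
  exact max_eq_left h1.le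
theorem un.inv_cg {r : ℕ} {a b : ℚ_[p]} (ha : un p a) (hb : un p b) (h : _root_.cg p r a b) : _root_.cg p r a⁻¹ b⁻¹ := by
  apply (ha.mul hb).cancel
  have h1 : a*b*a⁻¹ = b := by have := ha.1; field_simp
  have h2 : a*b*b⁻¹ = a := by have := hb.1; field_simp
  rw [h1, h2]; exact h.symm
theorem cg.div {r : ℕ} {a b c d : ℚ_[p]} (hb : b ∈ Oi p) (hc : un p c) (hd : un p d) (h : cg p r a b) (h' : cg p r c d) :
    cg p r (a/c) (b/d) := by
  rw [div_eq_mul_inv, div_eq_mul_inv]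
  exact h.mul hb hc.2.2 (un.inv_cg hc hd h')

theorem cg_int_iff {r : ℕ} {a b : ℤ} : cg p r (a:ℚ_[p]) (b:ℚ_[p]) ↔ (p:ℤ)^r ∣ a - b := by
  constructor
  · rintro ⟨c, hc, h⟩
    have := (Padic.norm_int_le_pow_iff_dvd (p := p) (a-b) r).1 (by
      push_cast; rw [h, norm_mul, norm_pow, Padic.norm_p, zpow_neg, zpow_natCast, inv_pow]
      rw [mem_Oi] at hc
      have h3 : 0 ≤ (((p:ℝ))^r)⁻¹ := by positivity
      nlinarith [norm_nonneg c])
    exact_mod_cast this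
  · rintro ⟨c, h⟩
    refine ⟨(c:ℤ), intCast_mem _ _, ?_⟩
    exact_mod_cast congrArg (fun z : ℤ => (z:ℚ_[p])) h

theorem ratCongr_of_cg {r : ℕ} {a b : ℚ} (h : cg p r (a:ℚ_[p]) (b:ℚ_[p])) : (p:ℤ)^r ∣ (a-b).num := by
  obtain ⟨c, hc, h⟩ := h
  rw [mem_Oi] at hc
  have e : (((a-b).num : ℤ) : ℚ_[p]) = p^r * (c * ((a-b).den : ℚ_[p])) := by
    have h1 : ((a - b : ℚ) : ℚ_[p]) * ((a-b).den : ℚ_[p]) = (((a-b).num : ℤ) : ℚ_[p]) := by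
      have := Rat.mul_den_eq_num (a-b)
      exact_mod_cast congrArg (fun z : ℚ => (z:ℚ_[p])) this
    rw [← h1]; push_cast; rw [h]; ring
  have : cg p r (((a-b).num : ℤ) : ℚ_[p]) ((0:ℤ):ℚ_[p]) := ⟨c * ((a-b).den : ℚ_[p]), mul_mem hc (natCast_mem _ _), by rw [e]; push_cast; ring⟩
  rw [cg_int_iff] at this
  simpa using this

/-- transfer from `ZMod p` -/
theorem cg_of_zmod {z : ℤ_[p]} (h : PadicInt.toZMod z = 0) : cg p 1 (z:ℚ_[p]) 0 := by
  have : z ∈ RingHom.ker (PadicInt.toZMod (p := p)) := h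
  rw [PadicInt.ker_toZMod, PadicInt.maximalIdeal_eq_span_p, Ideal.mem_span_singleton] at this
  obtain ⟨c, rfl⟩ := this
  exact ⟨c, c.2, by push_cast; ring⟩

end cong

section T0
variable {p : ℕ} [hp : Fact p.Prime]

/-- the terms `C(2k,k)^3/16^k` -/
def tK (K : Type*) [Field K] (k : ℕ) : K := ((2*k).choose k : K)^3 / 16^k

theorem cb_succ {K : Type*} [Field K] [CharZero K] (k : ℕ) :
    (((2*(k+1)).choose (k+1) : ℕ) : K) = ((2*k).choose k : K) * (2*(2*k+1)) / (k+1) := by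
  have := Nat.succ_mul_centralBinom_succ k
  rw [Nat.centralBinom, Nat.centralBinom] at this
  have h2 : ((k:K)+1) ≠ 0 := by exact_mod_cast Nat.succ_ne_zero k
  rw [eq_div_iff h2]
  have := congrArg (fun z : ℕ => (z:K)) this
  push_cast at this ⊢
  linear_combination this

theorem tK_succ {K : Type*} [Field K] [CharZero K] (k : ℕ) :
    tK K (k+1) = tK K k * (2*k+1)^3 / (2*(k+1)^3) := by
  have h2 : ((k:K)+1) ≠ 0 := by exact_mod_cast Nat.succ_ne_zero k
  rw [tK, tK, cb_succ, pow_succ]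
  field_simp; ring

theorem un_succ {k : ℕ} (hk : k+1 < p) : un p ((k:ℚ_[p])+1) := by
  have := un_nat' (p := p) (n := k+1) (by omega) hk
  simpa using this

theorem tK_mem (hp3 : 3 < p) (k : ℕ) : tK ℚ_[p] k ∈ Oi p := by
  rw [tK, div_eq_mul_inv]
  refine mul_mem (pow_mem (natCast_mem _ _) _) ?_
  have : (16:ℚ_[p]) = 2^4 := by norm_num
  rw [this]; exact (((un_two hp3).pow 4).pow k).2.2

theorem cK_transfer (hp3 : 3 < p) (k : ℕ) (hk : k < p) :
    ∃ z : ℤ_[p], (z:ℚ_[p]) = cK ℚ_[p] k ∧ PadicInt.toZMod z = cK (ZMod p) k := by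
  induction k with
  | zero => exact ⟨0, by simp [cK], by simp [cK]⟩
  | succ k ih =>
    obtain ⟨z, h1, h2⟩ := ih (by omega)
    have hu : un p (2*((k:ℚ_[p])+1)^3) := (un_two hp3).mul ((un_succ hk).pow 3)
    set u : ℤ_[p] := ⟨(2*((k:ℚ_[p])+1)^3)⁻¹, hu.2.2⟩ with hudef
    have c2 : ((2:ℤ_[p]):ℚ_[p]) = 2 := rfl
    have c3 : ((3:ℤ_[p]):ℚ_[p]) = 3 := rfl
    have cu : (u:ℚ_[p]) = (2*((k:ℚ_[p])+1)^3)⁻¹ := rfl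
    have e : u * (2*((k:ℤ_[p])+1)^3) = 1 := by
      apply PadicInt.ext
      push_cast
      rw [c2, cu]
      exact inv_mul_cancel₀ hu.1
    refine ⟨((2*k+1)^3 * z - (3*k+2)) * u, ?_, ?_⟩
    · push_cast; rw [h1, cK, div_eq_mul_inv, c2, c3, cu]
    · have e' := congrArg (PadicInt.toZMod (p := p)) e
      simp only [map_mul, map_pow, map_add, map_natCast, map_ofNat, map_one, map_sub] at e' ⊢
      rw [h2, cK, eq_div_iff (right_ne_zero_of_mul_eq_one e')]
      linear_combination ((2*(k:ZMod p)+1)^3 * cK (ZMod p) k - (3*k+2)) * e'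

theorem cK_mem (hp3 : 3 < p) {k : ℕ} (hk : k < p) : cK ℚ_[p] k ∈ Oi p := by
  obtain ⟨z, h1, _⟩ := cK_transfer hp3 k hk
  rw [← h1]; exact z.2

theorem sum_cK_cg (hp3 : 3 < p) (h0 : ((aS p 0 : ℤ) : ZMod p) ≠ 0) :
    cg p 1 (∑ k ∈ range p, cK ℚ_[p] k) 0 := by
  choose! z h1 h2 using fun k hk => cK_transfer (p := p) hp3 k hk
  have : ∑ k ∈ range p, cK ℚ_[p] k = ((∑ k ∈ range p, z k : ℤ_[p]) : ℚ_[p]) := by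
    rw [PadicInt.coe_sum]
    exact sum_congr rfl fun k hk => (h1 k (mem_range.1 hk)).symm
  rw [this]
  apply cg_of_zmod
  rw [map_sum, ← sum_cK hp3 h0]
  exact sum_congr rfl fun k hk => h2 k (mem_range.1 hk)

/-- inner sums, with an arbitrary polynomial weight -/
noncomputable def Tk (p : ℕ) [Fact p.Prime] (f : ℚ_[p] → ℚ_[p]) (k : ℕ) : ℚ_[p] :=
  ∑ n ∈ range p, (-1)^n * (f n * apP k (n:ℚ_[p])^2) / (k.factorial:ℚ_[p])^4

theorem sum_Tk (f : ℚ_[p] → ℚ_[p]) :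
    ∑ k ∈ range p, Tk p f k = ∑ n ∈ range p, (-1)^n * f n * (az n : ℚ_[p]) := by
  simp only [Tk]
  rw [sum_comm]
  apply sum_congr rfl
  intro n hn
  rw [← apA_eq_az (K := ℚ_[p]) p n (mem_range.1 hn) (fun k _ => by exact_mod_cast k.factorial_ne_zero), apA, mul_sum]
  apply sum_congr rfl
  intro k _
  ring

theorem apE_p (k : ℕ) : ∃ q : ℤ, apE k (p:ℚ_[p]) ^ 2 = (k.factorial:ℚ_[p])^4 * p^2 + p^3 * q := by
  obtain ⟨q, hq⟩ := apE_sq k (p:ℤ)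
  refine ⟨q, ?_⟩
  have := congrArg (fun z : ℤ => (z:ℚ_[p])) hq
  push_cast at this
  rw [← this]
  congr 1
  have e := apP_map (Int.castRingHom ℚ_[p]) k (p:ℤ)
  simp at e
  simp [apE, e]

theorem apE_z (k : ℕ) : apE k (0:ℚ_[p]) = 0 := by
  induction k with
  | zero => simp [apE]
  | succ k ih => rw [apE_succ, ih, mul_zero]

theorem T0_rec (hodd : Odd p) (k : ℕ) : ∃ q : ℤ, 
    2 * (k+1)^4 * Tk p (fun _ => 1) (k+1) - (2*k+1)^3*(k+1) * Tk p (fun _ => 1) k =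
     ((p:ℚ_[p])^2 - (k+1)*(3*k+2)) * (p^2 + p^3 * q / (k.factorial:ℚ_[p])^4) := by
  obtain ⟨q, hq⟩ := apE_p (p := p) k
  refine ⟨q, ?_⟩
  have hf : (k.factorial:ℚ_[p]) ≠ 0 := by exact_mod_cast k.factorial_ne_zero
  have hk : (k:ℚ_[p])+1 ≠ 0 := by exact_mod_cast k.succ_ne_zero
  have h := alt_tele_odd (fun x : ℚ_[p] => (x^2 - (k+1)*(3*k+2)) * apE k x ^ 2) 0 p hodd
  simp only [zero_add, apE_z, hq] at h
  have e : 2 * ((k:ℚ_[p])+1)^4 * Tk p (fun _ => 1) (k+1) - (2*k+1)^3*(k+1) * Tk p (fun _ => 1) k = 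
     (∑ n ∈ range p, (-1:ℚ_[p])^n * (((n:ℚ_[p])^2 - (k+1)*(3*k+2)) * apE k (n:ℚ_[p]) ^ 2 +
      (((n:ℚ_[p])+1)^2 - (k+1)*(3*k+2)) * apE k ((n:ℚ_[p])+1) ^ 2)) / (k.factorial:ℚ_[p])^4 := by
    rw [Tk, Tk, mul_sum, mul_sum, ← sum_sub_distrib, sum_div]
    apply sum_congr rfl
    intro n _
    rw [← apT_rec k (n:ℚ_[p]), Nat.factorial_succ]
    push_cast
    field_simp
  rw [e, h]
  field_simp
  ring

theorem T0k_cg (hp3 : 3 < p) (k : ℕ) (hk : k < p) :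
    cg p 3 (Tk p (fun _ => 1) k) (tK ℚ_[p] k + p^2 * cK ℚ_[p] k) := by
  have hodd : Odd p := hp.out.odd_of_ne_two (by omega)
  induction k with
  | zero =>
    apply cg.of_eq
    simp [Tk, tK, cK, neg_one_geom_sum, hodd]
  | succ k ih =>
    obtain ⟨c, hc, h⟩ := ih (by omega)
    obtain ⟨q, hq⟩ := T0_rec hodd k
    have hu := un_succ (p := p) hk
    have h2 := un_two hp3
    have hf := un_fact (p := p) (n := k) (by omega)
    apply ((h2.mul (hu.pow 4))).cancel
    refine ⟨(2*k+1)^3*(k+1)*c + p + p^2 * q * ((k.factorial:ℚ_[p])^4)⁻¹ - (k+1)*(3*k+2)*q * ((k.factorial:ℚ_[p])^4)⁻¹, ?_, ?_⟩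
    · have := (hf.pow 4).2.2
      have hk : (k:ℚ_[p]) ∈ Oi p := natCast_mem _ _
      have h1 := one_mem (Oi p)
      have hpp : (p:ℚ_[p]) ∈ Oi p := natCast_mem _ _
      have hqq : (q:ℚ_[p]) ∈ Oi p := intCast_mem _ _
      have h3 := (un_three hp3).2.1
      have h22 := h2.2.1
      apply_rules [add_mem, sub_mem, mul_mem, pow_mem]
    · have hcK : 2 * ((k:ℚ_[p])+1)^3 * cK ℚ_[p] (k+1) = (2*k+1)^3 * cK ℚ_[p] k - (3*k+2) := by
        rw [cK]; have := hu.1; field_simp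
      have htK : 2 * ((k:ℚ_[p])+1)^3 * tK ℚ_[p] (k+1) = (2*k+1)^3 * tK ℚ_[p] k := by
        rw [tK_succ]; have := hu.1; field_simp
      rw [div_eq_mul_inv] at hq
      linear_combination hq + (2*(k:ℚ_[p])+1)^3*(k+1)*h - (k+1)*htK - (k+1)*p^2*hcK

/-- the truncated sum -/
noncomputable def M0 (p : ℕ) [Fact p.Prime] : ℚ_[p] := ∑ k ∈ range p, tK ℚ_[p] k

theorem T0_cg (hp3 : 3 < p) : cg p 3 (aS p 0 : ℚ_[p]) (M0 p + p^2 * ∑ k ∈ range p, cK ℚ_[p] k) := by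
  have h := cg.sum (s := range p) (fun k hk => T0k_cg hp3 k (mem_range.1 hk))
  rw [sum_Tk, sum_add_distrib, ← mul_sum] at h
  refine (cg.of_eq ?_).trans h
  rw [aS]; push_cast
  exact sum_congr rfl fun n _ => by ring

theorem T0_cg2 (hp3 : 3 < p) : cg p 2 (aS p 0 : ℚ_[p]) (M0 p) := by
  refine ((T0_cg hp3).mono (by norm_num)).trans ?_
  refine ⟨∑ k ∈ range p, cK ℚ_[p] k, sum_mem fun k hk => cK_mem hp3 (mem_range.1 hk), by ring⟩

theorem T0_cg3 (hp3 : 3 < p) (h0 : ¬ cg p 1 (M0 p) 0) : cg p 3 (aS p 0 : ℚ_[p]) (M0 p) := by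
  refine (T0_cg hp3).trans ?_
  have h1 : ((aS p 0 : ℤ) : ZMod p) ≠ 0 := by
    intro h
    apply h0
    rw [ZMod.intCast_zmod_eq_zero_iff_dvd] at h
    refine ((T0_cg2 hp3).mono (by norm_num)).symm.trans ?_
    have := (cg_int_iff (p := p) (r := 1) (a := aS p 0) (b := 0)).2 (by simpa using h)
    simpa using this
  have h2 := (sum_cK_cg hp3 h1).pmul 2
  have := (cg.refl (M0 p)).add h2
  simpa using this

end T0

open Finset

section U0
variable {p : ℕ} [hp : Fact p.Prime]

/-- the character modulo 3 -/
def ch3 (n : ℤ) : ℤ := if n % 3 = 1 then 1 else if n % 3 = 2 then -1 else 0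

theorem ch3_add (n : ℤ) : ch3 (n+1) + ch3 n + ch3 (n-1) = 0 := by
  simp only [ch3]; split_ifs <;> omega

theorem ch3_two (n : ℤ) : ch3 (2*n) = - ch3 n := by
  simp only [ch3]; split_ifs <;> omega

/-- partial character sums of binomials -/
def cS (N m : ℕ) (c : ℤ) : ℤ := ∑ j ∈ range m, ch3 (c - j) * (N.choose j : ℤ)

theorem cS_succ (N m : ℕ) (c : ℤ) : cS (N+1) (m+1) c = cS N (m+1) c + cS N m (c-1) := by
  unfold cS
  rw [sum_range_succ', sum_range_succ' _ m]
  simp only [Nat.choose_succ_succ, Nat.choose_zero_right]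
  push_cast
  simp only [mul_add, sum_add_distrib]
  have : ∀ j : ℕ, c - ((j:ℤ)+1) = c - 1 - j := fun j => by ring
  simp only [this]
  ring

theorem cS_last (N m : ℕ) (c : ℤ) : cS N (m+1) c = cS N m c + ch3 (c-m) * (N.choose m : ℤ) := by
  unfold cS; rw [sum_range_succ]

theorem cS_full (n : ℕ) (c : ℤ) : cS n (n+1) c = (-1)^n * ch3 (c+n) := by
  induction n generalizing c with
  | zero => simp [cS]
  | succ n ih =>
    rw [cS_succ, cS_last, ih, ih]
    simp only [Nat.choose_succ_self]
    have := ch3_add (c+n)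
    rw [pow_succ]; push_cast
    rw [show c + ((n:ℤ)+1) = c+n+1 by ring, show c - 1 + (n:ℤ) = c+n-1 by ring]
    linear_combination (-1)^n * this

theorem sum_cb (n : ℕ) : ∑ k ∈ range n, ((2*k).choose k : ℤ) = cS (2*n) n n := by
  induction n with
  | zero => simp [cS]
  | succ n ih =>
    rw [sum_range_succ, ih]
    have h1 : cS (2*(n+1)) (n+1) ((n+1:ℕ):ℤ) = cS (2*n+1) (n+1) (n+1) + cS (2*n+1) n n := by
      rw [show 2*(n+1) = (2*n+1)+1 by ring, cS_succ]; push_cast; simp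
    rw [h1, cS_succ, cS_last]
    cases n with
    | zero => simp [cS, ch3]
    | succ m =>
      rw [show (((m+1:ℕ):ℤ)+1-1) = ((m+1:ℕ):ℤ) by ring, cS_succ (2*(m+1)) m]
      have h2 : cS (2*(m+1)) (m+1) (((m+1:ℕ):ℤ)-1) = cS (2*(m+1)) m (((m+1:ℕ):ℤ)-1) := by
        rw [cS_last]; push_cast; simp [ch3]
      rw [← h2]
      have h3 : cS (2*(m+1)) (m+1) (((m+1:ℕ):ℤ)+1) + cS (2*(m+1)) (m+1) (((m+1:ℕ):ℤ)) + cS (2*(m+1)) (m+1) (((m+1:ℕ):ℤ)-1) = 0 := by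
        unfold cS
        rw [← sum_add_distrib, ← sum_add_distrib]
        apply sum_eq_zero
        intro j _
        have := ch3_add (((m+1:ℕ):ℤ)-j)
        rw [show ((m+1:ℕ):ℤ)-j+1 = ((m+1:ℕ):ℤ)+1-j by ring, show ((m+1:ℕ):ℤ)-j-1 = ((m+1:ℕ):ℤ)-1-j by ring] at this
        linear_combination (((2*(m+1)).choose j : ℕ):ℤ) * this
      have h4 : ch3 (((m+1:ℕ):ℤ)+1-((m+1:ℕ):ℤ)) = 1 := by simp [ch3]
      rw [h4]
      linear_combination -h3

theorem choose_two_p {j : ℕ} (h0 : 0 < j) (hj : j < p) : (p:ℤ)^2 ∣ ((2*p).choose j : ℤ) - 2 * (p.choose j : ℤ) := by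
  obtain ⟨i, rfl⟩ : ∃ i, j = i+1 := ⟨j-1, by omega⟩
  have h := Nat.add_choose_eq p p (i+1)
  rw [Finset.Nat.sum_antidiagonal_eq_sum_range_succ (fun a b => p.choose a * p.choose b), sum_range_succ, sum_range_succ'] at h
  rw [two_mul, h]
  simp only [Nat.sub_self, Nat.choose_zero_right, Nat.sub_zero]
  push_cast
  rw [show ∀ a b : ℤ, a + 1 * b + b * 1 - 2 * b = a by intros; ring]
  apply dvd_sum
  intro k hk
  rw [mem_range] at hk
  rw [pow_two]
  apply mul_dvd_mul
  · exact_mod_cast hp.out.dvd_choose_self (by omega) (by omega)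
  · exact_mod_cast hp.out.dvd_choose_self (by omega) (by omega)

theorem sum_cb_cg (hp3 : 3 < p) : (p:ℤ)^2 ∣ ∑ k ∈ range p, ((2*k).choose k : ℤ) - ch3 p := by
  have hodd : Odd p := hp.out.odd_of_ne_two (by omega)
  rw [sum_cb]
  have h1 := cS_full p (p:ℤ)
  rw [hodd.neg_one_pow, ← two_mul, ch3_two, cS_last] at h1
  have h2 : ch3 ((p:ℤ)-p) = 0 := by simp [ch3]
  rw [h2] at h1
  have h3 : cS (2*p) p p - ch3 p = ∑ j ∈ range p, ch3 ((p:ℤ)-j) * (((2*p).choose j : ℤ) - 2 * (p.choose j : ℤ)) + ch3 p := by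
    have : ∑ j ∈ range p, ch3 ((p:ℤ)-j) * (((2*p).choose j : ℤ) - 2 * (p.choose j : ℤ)) = cS (2*p) p p - 2 * cS p p p := by
      unfold cS; rw [mul_sum, ← sum_sub_distrib]
      exact sum_congr rfl fun j _ => by ring
    rw [this]; linear_combination 2 * h1
  rw [h3]
  obtain ⟨q, hq⟩ : ∃ q, p = q+1 := ⟨p-1, by omega⟩
  have h4 : ∑ j ∈ range p, ch3 ((p:ℤ)-j) * (((2*p).choose j : ℤ) - 2 * (p.choose j : ℤ)) + ch3 p
     = ∑ j ∈ range q, ch3 ((p:ℤ)-(j+1:ℕ)) * (((2*p).choose (j+1) : ℤ) - 2 * (p.choose (j+1) : ℤ)) := by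
    conv_lhs => rw [show range p = range (q+1) by rw [hq]]
    rw [sum_range_succ']; simp
  rw [h4]
  apply dvd_sum
  intro j hj
  rw [mem_range] at hj
  exact Dvd.dvd.mul_left (choose_two_p (by omega) (by omega)) _

theorem alt_odd_sum (n : ℕ) : ∑ k ∈ range n, (-1:ℚ_[p])^k * (2*k+1) = -(-1)^n*n := by
  induction n with
  | zero => simp
  | succ n ih => rw [sum_range_succ, ih, pow_succ]; push_cast; ring

theorem U0k_cg (hp3 : 3 < p) (k : ℕ) (hk : k < p) :
    cg p 3 (Tk p (fun x => 2*x+1) k) (p * ((2*k).choose k : ℚ_[p])) := by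
  have hodd : Odd p := hp.out.odd_of_ne_two (by omega)
  induction k with
  | zero =>
    apply cg.of_eq
    have := alt_odd_sum (p := p) p
    rw [hodd.neg_one_pow] at this
    simp [Tk, this]
  | succ k ih =>
    obtain ⟨c, hc, h⟩ := ih (by omega)
    obtain ⟨q, hq⟩ := apE_p (p := p) k
    have hu := un_succ (p := p) hk
    have hf := un_fact (p := p) (n := k) (by omega)
    have hf0 := hf.1
    have hk0 := hu.1
    have ht := alt_tele_odd (fun x : ℚ_[p] => (x^3 - 3*(k+1)^2*x) * apE k x ^ 2) 0 p hodd
    simp only [zero_add, apE_z, hq] at ht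
    have e : ((k:ℚ_[p])+1)^4 * Tk p (fun x => 2*x+1) (k+1) - 2*(2*k+1)*(k+1)^3 * Tk p (fun x => 2*x+1) k = 
     (∑ n ∈ range p, (-1:ℚ_[p])^n * (((n:ℚ_[p])^3 - 3*(k+1)^2*n) * apE k (n:ℚ_[p]) ^ 2 +
      (((n:ℚ_[p])+1)^3 - 3*(k+1)^2*(n+1)) * apE k ((n:ℚ_[p])+1) ^ 2)) / (k.factorial:ℚ_[p])^4 := by
      rw [Tk, Tk, mul_sum, mul_sum, ← sum_sub_distrib, sum_div]
      apply sum_congr rfl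
      intro n _
      rw [← apU_rec k (n:ℚ_[p]), Nat.factorial_succ]
      push_cast
      field_simp
    rw [ht] at e
    apply (hu.pow 4).cancel
    refine ⟨2*(2*k+1)*(k+1)^3*c + (p^2-3*(k+1)^2) * (1 + p * q * ((k.factorial:ℚ_[p])^4)⁻¹), ?_, ?_⟩
    · have := (hf.pow 4).2.2
      have hk : (k:ℚ_[p]) ∈ Oi p := natCast_mem _ _
      have h1 := one_mem (Oi p)
      have hpp : (p:ℚ_[p]) ∈ Oi p := natCast_mem _ _
      have hqq : (q:ℚ_[p]) ∈ Oi p := intCast_mem _ _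
      have h3 := (un_three hp3).2.1
      have h22 := (un_two hp3).2.1
      apply_rules [add_mem, sub_mem, mul_mem, pow_mem]
    · rw [cb_succ]
      have e2 : Tk p (fun x => 2*x+1) k = p * ((2*k).choose k : ℚ_[p]) + p^3*c := by linear_combination h
      have e3 : ((k:ℚ_[p])+1)^4 * Tk p (fun x => 2*x+1) (k+1) = 2*(2*k+1)*(k+1)^3 * (p * ((2*k).choose k : ℚ_[p]) + p^3*c) + 
         (0 + ((p:ℚ_[p])^3 - 3*(k+1)^2*p) * ((k.factorial:ℚ_[p])^4 * p^2 + p^3 * q)) / (k.factorial:ℚ_[p])^4 := by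
        rw [← e2]; linear_combination e
      rw [e3]
      field_simp
      ring

theorem U0_cg (hp3 : 3 < p) : cg p 3 (2 * aS p 1 + aS p 0 : ℚ_[p]) (p * (ch3 p : ℚ_[p])) := by
  have h := cg.sum (s := range p) (fun k hk => U0k_cg hp3 k (mem_range.1 hk))
  rw [sum_Tk, ← mul_sum] at h
  have e : (2 * aS p 1 + aS p 0 : ℚ_[p]) = ∑ n ∈ range p, (-1)^n * (2*(n:ℚ_[p])+1) * (az n : ℚ_[p]) := by
    simp only [aS]; push_cast; rw [mul_sum, ← sum_add_distrib]
    exact sum_congr rfl fun n _ => by ring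
  rw [e]
  refine h.trans ?_
  have h2 := (cg_int_iff (p := p)).2 (sum_cb_cg (p := p) hp3)
  have := h2.pmul 1
  simpa using this

theorem U1_cg : (p:ℤ)^3 ∣ 18 * (2 * aS p 3 + 3 * aS p 2 + aS p 1) + 6 * (2 * aS p 1 + aS p 0) := by
  have h := apery_step0 (p-1)
  rw [Nat.sub_add_cancel hp.out.one_le] at h
  have e : (((p-1:ℕ):ℤ)+1) = p := by
    have := hp.out.one_le; push_cast [this]; ring
  have e2 : 18 * (2 * aS p 3 + 3 * aS p 2 + aS p 1) + 6 * (2 * aS p 1 + aS p 0) = 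
    ∑ m ∈ range p, (-1:ℤ)^m*((2*m+1)*(18*(m*(m+1))+6))*az m := by
    simp only [aS, mul_sum, ← sum_add_distrib]
    exact sum_congr rfl fun n _ => by ring
  rw [e2, h, e]
  exact ⟨(-1)^(p-1) * (az p + az (p-1)), by ring⟩

theorem T1_cg (hp3 : 3 < p) : cg p 2 (2 * (aS p 2 + aS p 1) : ℚ_[p]) (- ∑ k ∈ range p, (2*k^2+2*k+1) * tK ℚ_[p] k) := by
  have hodd : Odd p := hp.out.odd_of_ne_two (by omega)
  have h : ∀ k ∈ range p, cg p 2 (Tk p (fun x => 2*(x*(x+1))) k) (- ((2*k^2+2*k+1) * tK ℚ_[p] k)) := by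
    intro k hk
    rw [mem_range] at hk
    have h1 : cg p 2 (Tk p (fun x => 2*(x*(x+1))) k) (- ((2*k^2+2*k+1) * Tk p (fun _ => 1) k)) := by
      obtain ⟨q, hq⟩ := apE_p (p := p) k
      have hf := un_fact (p := p) (n := k) (by omega)
      have hf0 := hf.1
      have ht := alt_tele_odd (fun x : ℚ_[p] => apE k x ^ 2) 0 p hodd
      simp only [zero_add, apE_z, hq] at ht
      refine ⟨1 + p * q * ((k.factorial:ℚ_[p])^4)⁻¹, ?_, ?_⟩
      · have := (hf.pow 4).2.2
        have h1 := one_mem (Oi p)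
        have hpp : (p:ℚ_[p]) ∈ Oi p := natCast_mem _ _
        have hqq : (q:ℚ_[p]) ∈ Oi p := intCast_mem _ _
        apply_rules [add_mem, sub_mem, mul_mem, pow_mem]
      · rw [sub_neg_eq_add, Tk, Tk, mul_sum, ← sum_add_distrib]
        have : (p:ℚ_[p])^2 * (1 + p * q * ((k.factorial:ℚ_[p])^4)⁻¹) = (0^2 + ((k.factorial:ℚ_[p])^4 * p^2 + p^3 * q)) / (k.factorial:ℚ_[p])^4 := by
          field_simp; ring
        rw [this, ← ht, sum_div]
        apply sum_congr rfl
        intro n _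
        rw [← apN_rec k (n:ℚ_[p])]
        ring
    refine h1.trans ?_
    apply cg.neg
    apply cg.mul_left
    · have : (2*(k:ℚ_[p])^2+2*k+1) = ((2*k^2+2*k+1 : ℕ) : ℚ_[p]) := by push_cast; ring
      rw [this]; exact natCast_mem _ _
    · refine ((T0k_cg hp3 k hk).mono (by norm_num)).trans ?_
      exact ⟨cK ℚ_[p] k, cK_mem hp3 hk, by ring⟩
  have h := cg.sum h
  rw [sum_Tk, sum_neg_distrib] at h
  refine (cg.of_eq ?_).trans h
  simp only [aS]; push_cast
  rw [← sum_add_distrib, mul_sum]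
  exact sum_congr rfl fun n _ => by ring

end U0

open Finset

section WZ

/-- first WZ family -/
def fF (K : Type*) [Field K] (M : K) (k : ℕ) : K :=
  ∏ i ∈ range k, (2*(i:K)+1)*((2*i+1)^2-M^2)/(2*(i+1)*((i+1)^2-M^2))

theorem fF_succ {K : Type*} [Field K] (M : K) (k : ℕ) : fF K M (k+1) = fF K M k *
    ((2*(k:K)+1)*((2*k+1)^2-M^2)/(2*(k+1)*((k+1)^2-M^2))) := by rw [fF, prod_range_succ, ← fF]

theorem fF_vanish (n : ℕ) : fF ℚ (2*n+1) (n+1) = 0 := by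
  rw [fF_succ]; simp

theorem fF_ratio (n k : ℕ) (hk : k ≤ n) :
    fF ℚ (2*n+1) k * ((2*n+2+2*k)*(2*n+1-k)*(2*n+2-k)*(2*n+3)) =
    fF ℚ (2*n+3) k * ((2*n+2-2*k)*(2*n+1)*(2*n+2+k)*(2*n+3+k)) := by
  induction k with
  | zero => simp [fF]
  | succ k ih =>
    have h := ih (by omega)
    obtain ⟨d, rfl⟩ : ∃ d, n = k+1+d := ⟨n-(k+1), by omega⟩
    rw [fF_succ, fF_succ]
    push_cast at h ⊢
    have n1 : ((k:ℚ)+1)^2 - (2*(k+1+d)+1)^2 = -((k+2*d+2)*(3*k+2*d+4)) := by ring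
    have n2 : ((k:ℚ)+1)^2 - (2*(k+1+d)+3)^2 = -((k+2*d+4)*(3*k+2*d+6)) := by ring
    have e1 : (2*((k:ℚ)+1+d)+2+2*k)*(2*(k+1+d)+1-k)*(2*(k+1+d)+2-k)*(2*(k+1+d)+3) = (4*k+2*d+4)*(k+2*d+3)*(k+2*d+4)*(2*k+2*d+5) := by ring
    rw [e1] at h
    have h' := eq_div_of_mul_eq (by positivity) h
    rw [h', n1, n2]
    set Fk := fF ℚ (2*((k:ℚ)+1+d)+3) k
    field_simp
    ring

/-- certificate function -/
def gF (n : ℕ) (P : ℚ → ℚ) (k : ℕ) : ℚ :=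
  fF ℚ (2*n+3) k * (k*(2*n+3+k)*P k/((2*n+2+2*k)*(2*n+2-k)))

theorem fF_sum_step (n : ℕ) (q P : ℚ → ℚ) (r : ℚ)
    (h1 : ∀ k : ℕ, k ≤ n → r*q k*(2*n+2-k)*(2*n+1-k)*(2*n+3)*(2*n+2+2*k) - q k*((2*n+2-2*k)*(2*n+1)*(2*n+2+k)*(2*n+3+k)) =
       (2*k+1)*(n+1-k)*P (k+1)*(2*n+3)*(2*n+2+2*k) - k*(2*n+3+k)*P k*(2*n+1-k)*(2*n+3))
    (h2 : 4*(n+1)*r*q (n+1) + (3*n+4)*P (n+1) = 0) :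
    r * ∑ k ∈ range (n+2), q k * fF ℚ (2*n+3) k = ∑ k ∈ range (n+1), q k * fF ℚ (2*n+1) k := by
  have key : ∀ k ∈ range (n+1), r*(q k * fF ℚ (2*n+3) k) - q k * fF ℚ (2*n+1) k = gF n P (k+1) - gF n P k := by
    intro k hk
    have hk : k ≤ n := by rw [mem_range] at hk; omega
    have hr := fF_ratio n k hk
    have h1' := h1 k hk
    obtain ⟨d, rfl⟩ : ∃ d, n = k+d := ⟨n-k, by omega⟩
    unfold gF
    rw [fF_succ]
    push_cast at hr h1' ⊢
    have e2 : (2*((k:ℚ)+d)+2+2*k) ≠ 0 := by positivity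
    have e3 : (2*((k:ℚ)+d)+1-k) ≠ 0 := by
      rw [show (2*((k:ℚ)+d)+1-k) = k+2*d+1 by ring]; positivity
    have e4 : (2*((k:ℚ)+d)+2-k) ≠ 0 := by
      rw [show (2*((k:ℚ)+d)+2-k) = k+2*d+2 by ring]; positivity
    have e4' : (2*((k:ℚ)+d)+2-(k+1)) ≠ 0 := by
      rw [show (2*((k:ℚ)+d)+2-(k+1)) = k+2*d+1 by ring]; positivity
    have e5 : (2*((k:ℚ)+d)+3) ≠ 0 := by positivity
    have e6 : (2*((k:ℚ)+d)+2+2*(k+1)) ≠ 0 := by positivity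
    have n2 : ((k:ℚ)+1)^2 - (2*(k+d)+3)^2 = -((2*(k+d)+2-k)*(2*(k+d)+3+(k+1))) := by ring
    have e7 : (2*((k:ℚ)+d)+3+(k+1)) ≠ 0 := by positivity
    have e8 : ((k:ℚ)+1) ≠ 0 := by positivity
    rw [n2]
    have hr' := eq_div_of_mul_eq (mul_ne_zero (mul_ne_zero (mul_ne_zero e2 e3) e4) e5) hr
    rw [hr']
    set Fk := fF ℚ (2*((k:ℚ)+d)+3) k
    have s1 : (2*(k:ℚ)+1)*((2*k+1)^2-(2*(k+d)+3)^2)/(2*(k+1)*(-((2*(k+d)+2-k)*(2*(k+d)+3+(k+1))))) * (((k:ℚ)+1)*(2*(k+d)+3+(k+1))*P (k+1)/((2*(k+d)+2+2*(k+1))*(2*(k+d)+2-(k+1)))) =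
      (2*k+1)*(d+1)*P (k+1)/((2*(k+d)+2-k)*(2*(k+d)+1-k)) := by
      rw [div_mul_div_comm, div_eq_div_iff (by simp [e4,e7,e8,e6,e4']) (mul_ne_zero e4 e3)]
      ring
    rw [mul_assoc Fk, s1]
    have e9 : (k:ℚ)+2*d+1 ≠ 0 := by positivity
    have e10 : (k:ℚ)+2*d+2 ≠ 0 := by positivity
    have : r*q k - q k*((2*(k+d)+2-2*k)*(2*(k+d)+1)*(2*(k+d)+2+k)*(2*(k+d)+3+k))/((2*((k:ℚ)+d)+2+2*k)*(2*(k+d)+1-k)*(2*(k+d)+2-k)*(2*(k+d)+3)) = 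
      (2*k+1)*(d+1)*P (k+1)/((2*(k+d)+2-k)*(2*(k+d)+1-k)) - k*(2*(k+d)+3+k)*P k/((2*(k+d)+2+2*k)*(2*(k+d)+2-k)) := by
      rw [show (2*((k:ℚ)+d)+2-k) = k+2*d+2 by ring, show (2*((k:ℚ)+d)+1-k) = k+2*d+1 by ring] at *
      field_simp
      linear_combination h1'
    rw [mul_div_assoc] at this ⊢
    linear_combination Fk * this
  have hs := sum_congr rfl key
  rw [sum_sub_distrib, sum_range_sub, ← mul_sum] at hs
  have g0 : gF n P 0 = 0 := by simp [gF]
  rw [g0] at hs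
  rw [sum_range_succ _ (n+1), mul_add]
  have g1 : gF n P (n+1) = - (r * (q (n+1) * fF ℚ (2*n+3) (n+1))) := by
    unfold gF; push_cast
    have : (2*(n:ℚ)+2-(n+1)) = n+1 := by ring
    rw [this]
    have e : (n:ℚ)+1 ≠ 0 := by positivity
    have e' : (2*(n:ℚ)+2+2*(n+1)) ≠ 0 := by positivity
    field_simp
    linear_combination fF ℚ (2*n+3) (n+1) * h2
  push_cast
  linear_combination hs + g1

theorem fF_sum_W (n : ℕ) : ∑ k ∈ range (n+1), fF ℚ (2*n+1) k =
    (2*n+1) * ∏ j ∈ range n, (3*(j:ℚ)+2)/(3*j+4) := by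
  induction n with
  | zero => simp [fF]
  | succ n ih =>
    have h := fF_sum_step n (fun _ => 1) (fun _ => -4*(2*n+1)*(2*n+2)/((2*n+3)*(6*n+4))) ((2*n+1)*(6*n+8)/((2*n+3)*(6*n+4)))
      (by intro k hk; field_simp; ring) (by field_simp; ring)
    simp only [one_mul] at h
    rw [ih] at h
    rw [prod_range_succ]
    push_cast
    rw [show 2*((n:ℚ)+1)+1 = 2*n+3 by ring]
    have e : ∑ k ∈ range (n+2), fF ℚ (2*n+3) k = ((2*(n:ℚ)+1)*(6*n+8)/((2*n+3)*(6*n+4)))⁻¹ * ((2*n+1) * ∏ j ∈ range n, (3*(j:ℚ)+2)/(3*j+4)) := by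
      rw [← h, inv_mul_cancel_left₀]; positivity
    rw [e]
    field_simp
    ring

theorem fF_sum_V (n : ℕ) : ∑ k ∈ range (n+1), (3*(k:ℚ)+1)*(3*k+2) * fF ℚ (2*n+1) k =
    2*((2*n+1) * ∏ j ∈ range n, (3*(j:ℚ)+4)/(3*j+2)) := by
  induction n with
  | zero => simp [fF]
  | succ n ih =>
    have h := fF_sum_step n (fun k => (3*k+1)*(3*k+2)) (fun k => 4*(2*n+1)*(2*n+2)/((2*n+3)*(6*n+8))*(1-3*k)*(2+3*k)) ((2*n+1)*(6*n+4)/((2*n+3)*(6*n+8)))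
      (by intro k hk; field_simp; ring) (by field_simp; ring)
    rw [ih] at h
    rw [prod_range_succ]
    push_cast
    rw [show 2*((n:ℚ)+1)+1 = 2*n+3 by ring]
    have e : ∑ k ∈ range (n+2), (3*(k:ℚ)+1)*(3*k+2) * fF ℚ (2*n+3) k = ((2*(n:ℚ)+1)*(6*n+4)/((2*n+3)*(6*n+8)))⁻¹ * (2*((2*n+1) * ∏ j ∈ range n, (3*(j:ℚ)+4)/(3*j+2))) := by
      rw [← h, inv_mul_cancel_left₀]; positivity
    rw [e]
    field_simp
    ring

end WZ

open Finset

section WZ2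

/-- second family -/
def f2 (K : Type*) [Field K] (n b : K) (k : ℕ) : K :=
  ∏ j ∈ range k, ((j:K)-n)*(b+j)*((2*j+1)/2-n-b)*4/((2*b+j)*(1-2*n-2*b+j)*(j+1))

theorem f2_succ {K : Type*} [Field K] (n b : K) (k : ℕ) : f2 K n b (k+1) = f2 K n b k *
    (((k:K)-n)*(b+k)*((2*k+1)/2-n-b)*4/((2*b+k)*(1-2*n-2*b+k)*(k+1))) := by
  rw [f2, prod_range_succ, ← f2]

theorem f2_vanish (n : ℕ) (b : ℚ) : f2 ℚ n b (n+1) = 0 := by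
  rw [f2_succ]; simp

/-- genericity of the parameter -/
def gen4 (b : ℚ) : Prop := ∃ o : ℤ, 4*b = 2*o+1

theorem gen4.ne {b : ℚ} (h : gen4 b) (u v : ℤ) (huv : 2 ∣ v) (hu : ¬ 2 ∣ u) (x : ℚ) (hx : 4*x = 4*b*u + v) : x ≠ 0 := by
  obtain ⟨o, h⟩ := h
  rintro rfl
  rw [h] at hx
  have : (2*o+1)*u + v = 0 := by exact_mod_cast (by linarith : (2*(o:ℚ)+1)*u + v = 0)
  have h2 : (2:ℤ) ∣ u := by
    have : u = 2*(-o*u) - v := by linear_combination this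
    rw [this]
    exact dvd_sub (dvd_mul_right _ _) huv
  exact hu h2

theorem gen4.ne2 {b : ℚ} (h : gen4 b) (u v : ℤ) (hu : ¬ 2 ∣ u) (x : ℚ) (hx : 2*x = 4*b*u + 2*v) : x ≠ 0 :=
  h.ne u (2*v) (dvd_mul_right _ _) hu (2*x/4) (by rw [hx]; push_cast; ring) |> fun h' hx0 => h' (by rw [hx0]; ring)

theorem gen4.ne4 {b : ℚ} (h : gen4 b) (u v : ℤ) (hu : ¬ 2 ∣ u) (x : ℚ) (hx : 4*x = 4*b*u + 2*v) : x ≠ 0 :=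
  h.ne u (2*v) (dvd_mul_right _ _) hu x (by rw [hx]; push_cast; ring)

theorem f2_ratio (n : ℕ) (b : ℚ) (hb : gen4 b) (k : ℕ) :
    f2 ℚ n b k = f2 ℚ n (b+1) k * ((n+b+1/2-k)*(2*b+k)*(2*b+k+1)*(2*(n+b))/((b+k)*(2*b+1)*(2*(n+b)+1-k)*(2*(n+b)-k))) := by
  have a1 : ∀ k : ℕ, 2*b+k ≠ 0 := fun k => hb.ne2 1 k (by decide) _ (by push_cast; ring)
  have a2 : ∀ k : ℕ, 2*((n:ℚ)+b)-k ≠ 0 := fun k => hb.ne2 1 (2*n-k) (by decide) _ (by push_cast; ring)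
  have a3 : ∀ k : ℕ, b+k ≠ 0 := fun k => hb.ne4 1 (2*k) (by decide) _ (by push_cast; ring)
  have a4 : (n:ℚ)+b ≠ 0 := hb.ne4 1 (2*n) (by decide) _ (by push_cast; ring)
  have a5 := a1 1
  induction k with
  | zero =>
    have := a1 0
    have := a3 0
    have h6 : 2*((n:ℚ)+b)+1 ≠ 0 := hb.ne2 1 (2*n+1) (by decide) _ (by push_cast; ring)
    push_cast at *
    simp only [f2, range_zero, prod_empty]
    simp only [add_zero, sub_zero] at *
    rw [one_mul, eq_div_iff (by simp_all)]
    ring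
  | succ k ih =>
    rw [f2_succ, f2_succ, ih]
    have b1 := a1 k
    have b2 := a1 (k+1)
    have b3 := a1 (k+2)
    have b4 := a3 k
    have b5 := a3 (k+1)
    have b6 := a2 k
    have b7 := a2 (k+1)
    have b8 : 2*((n:ℚ)+b)+1-k ≠ 0 := hb.ne2 1 (2*n+1-k) (by decide) _ (by push_cast; ring)
    have b9 : (k:ℚ)+1 ≠ 0 := by positivity
    push_cast at *
    set F := f2 ℚ n (b+1) k
    have c1 : 1-2*(n:ℚ)-2*b+k = -(2*((n:ℚ)+b)-(k+1)) := by ring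
    have c2 : 1-2*(n:ℚ)-2*(b+1)+k = -(2*((n:ℚ)+b)+1-k) := by ring
    have c3 : 2*(b+1)+(k:ℚ) = 2*b+(k+2) := by ring
    have c4 : 2*((n:ℚ)+b)+1-(k+1) = 2*((n:ℚ)+b)-k := by ring
    have c5 : 2*b+(k:ℚ)+1 = 2*b+(k+1) := by ring
    have c6 : 2*b+((k:ℚ)+1)+1 = 2*b+(k+2) := by ring
    rw [c1, c2, c3, c4, c5, c6]
    simp only [mul_assoc F]
    congr 1
    generalize hA : 2*b+(k:ℚ) = A at *
    generalize hB : 2*b+((k:ℚ)+1) = B at *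
    generalize hC : 2*b+((k:ℚ)+2) = C at *
    generalize hD : 2*((n:ℚ)+b)-k = D at *
    generalize hE : 2*((n:ℚ)+b)-(k+1) = E at *
    generalize hG : 2*((n:ℚ)+b)+1-k = G at *
    generalize hH : 2*b+1 = H at *
    generalize hI : b+(k:ℚ) = I at *
    generalize hJ : b+((k:ℚ)+1) = J at *
    rw [div_mul_div_comm, div_mul_div_comm, div_eq_div_iff (by simp_all) (by simp_all)]
    have : b+1+(k:ℚ) = J := by rw [← hJ]; ring
    rw [this]
    have : (2*(k:ℚ)+1)/2-n-(b+1) = -(n+b+1/2-k) := by ring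
    rw [this]
    have : (2*(k:ℚ)+1)/2-n-b = -(n+b+1/2-(k+1)) := by ring
    rw [this]
    ring

/-- the sum -/
def s2 (n : ℕ) (b : ℚ) : ℚ := ∑ k ∈ range (n+1), f2 ℚ n b k

theorem s2_step (n : ℕ) (b : ℚ) (hb : gen4 b) :
    s2 n (b+1) * ((6*b+3+2*n)*(n+b)) = s2 n b * ((2*b+1)*(3*b+2*n)) := by
  have a1 : ∀ k : ℕ, 2*b+k ≠ 0 := fun k => hb.ne2 1 k (by decide) _ (by push_cast; ring)
  have a2 : ∀ k : ℕ, 2*((n:ℚ)+b)-k ≠ 0 := fun k => hb.ne2 1 (2*n-k) (by decide) _ (by push_cast; ring)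
  have a3 : ∀ k : ℕ, b+k ≠ 0 := fun k => hb.ne4 1 (2*k) (by decide) _ (by push_cast; ring)
  have a5 := a1 1
  set g : ℕ → ℚ := fun k => f2 ℚ n (b+1) k * (k*(2*b+1+k)/((b+k)*(2*(n+b)+1-k)) * (-(n+b)*(2*n+4*b+1))) with hg
  have key : ∀ k ∈ range (n+1), f2 ℚ n (b+1) k * ((6*b+3+2*n)*(n+b)) - f2 ℚ n b k * ((2*b+1)*(3*b+2*n)) = g (k+1) - g k := by
    intro k _
    simp only [hg]
    rw [f2_succ, f2_ratio n b hb k]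
    have b1 := a1 k
    have b2 := a1 (k+1)
    have b3 := a1 (k+2)
    have b4 := a3 k
    have b5 := a3 (k+1)
    have b6 := a2 k
    have b7 := a2 (k+1)
    have b8 : 2*((n:ℚ)+b)+1-k ≠ 0 := hb.ne2 1 (2*n+1-k) (by decide) _ (by push_cast; ring)
    have b9 : (k:ℚ)+1 ≠ 0 := by positivity
    push_cast at *
    set F := f2 ℚ n (b+1) k
    have c2 : 1-2*(n:ℚ)-2*(b+1)+k = -(2*((n:ℚ)+b)+1-k) := by ring
    have c3 : 2*(b+1)+(k:ℚ) = 2*b+(k+2) := by ring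
    have c4 : 2*((n:ℚ)+b)+1-(k+1) = 2*((n:ℚ)+b)-k := by ring
    have c5 : 2*b+(k:ℚ)+1 = 2*b+(k+1) := by ring
    have c6 : 2*b+1+((k:ℚ)+1) = 2*b+(k+2) := by ring
    have c7 : b+1+(k:ℚ) = b+(k+1) := by ring
    have c8 : 2*b+1+(k:ℚ) = 2*b+(k+1) := by ring
    rw [c2, c3, c4, c5, c6, c7, c8]
    have m : ((n+b+1/2-k)*(2*b+k)*(2*b+(k+1))*(2*(n+b))/((b+k)*(2*b+1)*(2*(n+b)+1-k)*(2*(n+b)-k))) * ((2*b+1)*(3*b+2*n)) = 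
      ((n+b+1/2-k)*(2*b+k)*(2*b+(k+1))*(2*(n+b))/((b+k)*(2*(n+b)+1-k)*(2*(n+b)-k))) * (3*b+2*n) := by
      rw [div_mul_eq_mul_div, div_mul_eq_mul_div, div_eq_div_iff (by simp_all) (by simp_all)]
      ring
    have m2 : (((k:ℚ)-n)*(b+(k+1))*((2*k+1)/2-n-(b+1))*4/((2*b+(k+2))*-(2*(n+b)+1-k)*(k+1))) * ((k+1)*(2*b+(k+2))/((b+(k+1))*(2*(n+b)-k))) = 
      (k-n)*(n+b+1/2-k)*4/((2*(n+b)+1-k)*(2*(n+b)-k)) := by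
      rw [div_mul_div_comm, div_eq_div_iff (mul_ne_zero (mul_ne_zero (mul_ne_zero b3 (neg_ne_zero.2 b8)) b9) (mul_ne_zero b5 b6)) (mul_ne_zero b8 b6)]
      ring
    have m3 : ((6*b+3+2*n)*(n+b)) - ((n+b+1/2-k)*(2*b+k)*(2*b+(k+1))*(2*(n+b))/((b+k)*(2*(n+b)+1-k)*(2*(n+b)-k))) * (3*b+2*n) = 
       (k-n)*(n+b+1/2-k)*4/((2*(n+b)+1-k)*(2*(n+b)-k)) * (-(n+b)*(2*n+4*b+1)) - (k*(2*b+(k+1))/((b+k)*(2*(n+b)+1-k)) * (-(n+b)*(2*n+4*b+1))) := by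
      have w1 : ∀ a x y z : ℚ, y ≠ 0 → z ≠ 0 → x ≠ 0 → a/(y*z) = a*x/(x*y*z) := fun a x y z _ _ _ => by field_simp
      have w2 : ∀ a x y z : ℚ, y ≠ 0 → z ≠ 0 → x ≠ 0 → a/(x*y) = a*z/(x*y*z) := fun a x y z _ _ _ => by field_simp
      rw [w1 _ (b+k) _ _ b8 b6 b4, w2 _ _ _ (2*(n+b)-k) b8 b6 b4]
      have hne : (b+(k:ℚ))*(2*(n+b)+1-k)*(2*(n+b)-k) ≠ 0 := by simp_all
      generalize hQ : (b+(k:ℚ))*(2*(n+b)+1-k)*(2*(n+b)-k) = Q at *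
      rw [div_mul_eq_mul_div, div_mul_eq_mul_div, div_mul_eq_mul_div, ← sub_div, eq_div_iff hne, sub_mul, div_mul_cancel₀ _ hne, ← hQ]
      ring
    linear_combination F * m3 - F * m - F * (-(n+b)*(2*n+4*b+1)) * m2
  have hs := sum_congr rfl key
  rw [sum_sub_distrib, sum_range_sub, ← sum_mul, ← sum_mul] at hs
  have g0 : g 0 = 0 := by simp [hg]
  have g1 : g (n+1) = 0 := by simp only [hg]; rw [f2_vanish]; simp
  rw [g0, g1] at hs
  unfold s2
  linear_combination hs

end WZ2

open Finset

section WZ3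

theorem s2_tele (m N : ℕ) : s2 (3*m) ((1-6*m)/4+N) * ∏ i ∈ range N, ((4*(i:ℚ)+3-2*m)*(4*i+6*m+1)) =
    s2 (3*m) ((1-6*m)/4) * ∏ i ∈ range N, ((4*(i:ℚ)+3-6*m)*(4*i+2*m+1)) := by
  induction N with
  | zero => simp
  | succ N ih =>
    have h := s2_step (3*m) ((1-6*m)/4+N) ⟨-3*m+2*N, by push_cast; ring⟩
    rw [prod_range_succ, prod_range_succ]
    push_cast at h ⊢
    rw [← add_assoc]
    linear_combination (4*(N:ℚ)+3-6*m)*(4*N+2*m+1) * ih + 8/3 * (∏ i ∈ range N, ((4*(i:ℚ)+3-2*m)*(4*i+6*m+1))) * h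

theorem prod_shift (f : ℕ → ℚ) (m N : ℕ) : (∏ i ∈ range N, f (m+i)) * ∏ i ∈ range m, f i = 
    (∏ i ∈ range N, f i) * ∏ i ∈ range m, f (N+i) := by
  rw [mul_comm, ← prod_range_add, ← prod_range_add, add_comm]

theorem s2_final (m : ℕ) : s2 (3*m) ((1-6*m)/4+(6*m+1:ℕ)) * ∏ i ∈ range m, ((4*(i:ℚ)+3-6*m)^2-16*(6*m+1)^2) =
    s2 (3*m) ((1-6*m)/4) * ∏ i ∈ range m, (4*(i:ℚ)+3-6*m)^2 := by
  have h := s2_tele m (6*m+1)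
  set N := 6*m+1 with hN
  have hNq : (N:ℚ) = 6*m+1 := by rw [hN]; push_cast; ring
  rw [prod_mul_distrib, prod_mul_distrib] at h
  have hA := prod_shift (fun i => 4*(i:ℚ)+3-6*m) m N
  have hB := prod_shift (fun i => 4*(i:ℚ)+2*m+1) m N
  have eA : ∀ i : ℕ, 4*((m+i:ℕ):ℚ)+3-6*m = 4*i+3-2*m := fun i => by push_cast; ring
  have eB : ∀ i : ℕ, 4*((m+i:ℕ):ℚ)+2*m+1 = 4*i+6*m+1 := fun i => by push_cast; ring
  simp only [eA, eB] at hA hB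
  have rB := prod_range_reflect (fun i => 4*(i:ℚ)+2*m+1) m
  have rB' := prod_range_reflect (fun i => 4*((N+i:ℕ):ℚ)+2*m+1) m
  have e1 : ∏ j ∈ range m, (4*((m-1-j:ℕ):ℚ)+2*m+1) = ∏ j ∈ range m, -(4*(j:ℚ)+3-6*m) := by
    apply prod_congr rfl
    intro j hj
    rw [mem_range] at hj
    have : ((m-1-j:ℕ):ℚ) = m-1-j := by
      rw [Nat.cast_sub (by omega), Nat.cast_sub (by omega)]; simp
    rw [this]; ring
  have e2 : ∏ j ∈ range m, (4*((N+(m-1-j):ℕ):ℚ)+2*m+1) = ∏ j ∈ range m, (4*N-(4*(j:ℚ)+3-6*m)) := by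
    apply prod_congr rfl
    intro j hj
    rw [mem_range] at hj
    have : ((m-1-j:ℕ):ℚ) = m-1-j := by
      rw [Nat.cast_sub (by omega), Nat.cast_sub (by omega)]; simp
    push_cast; rw [this]; ring
  have z1 : ∏ i ∈ range N, (4*(i:ℚ)+3-6*m) ≠ 0 := by
    rw [prod_ne_zero_iff]; intro i _ h0
    have : 4*(i:ℤ)+3-6*m = 0 := by exact_mod_cast h0
    omega
  have z2 : ∏ i ∈ range N, (4*(i:ℚ)+2*m+1) ≠ 0 := by
    rw [prod_ne_zero_iff]; intro i _; positivity
  rw [e1] at rB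
  rw [e2] at rB'
  rw [← rB, ← rB'] at hB
  apply mul_left_cancel₀ (mul_ne_zero z1 z2)
  have hm : ((-1:ℚ))^m = ∏ _i ∈ range m, (-1:ℚ) := by simp
  have f1 : ∏ i ∈ range m, ((4*(i:ℚ)+3-6*m)^2-16*(6*m+1)^2) = (-1)^m * ((∏ i ∈ range m, (4*((N+i:ℕ):ℚ)+3-6*m)) * ∏ j ∈ range m, (4*N-(4*(j:ℚ)+3-6*m))) := by
    rw [← prod_mul_distrib]
    rw [hm, ← prod_mul_distrib]
    apply prod_congr rfl; intro i _; push_cast; rw [hNq]; ring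
  have f2' : ∏ i ∈ range m, (4*(i:ℚ)+3-6*m)^2 = (-1)^m * ((∏ i ∈ range m, (4*(i:ℚ)+3-6*m)) * ∏ j ∈ range m, -(4*(j:ℚ)+3-6*m)) := by
    rw [← prod_mul_distrib]
    rw [hm, ← prod_mul_distrib]
    apply prod_congr rfl; intro i _; ring
  rw [f1, f2']
  linear_combination (-1)^m * (∏ i ∈ range m, (4*(i:ℚ)+3-6*m)) * (∏ j ∈ range m, -(4*(j:ℚ)+3-6*m)) * h
    - s2 (3*m) ((1-6*m)/4+N) * (-1)^m * (∏ i ∈ range m, (4*((N+i:ℕ):ℚ)+3-6*m)) * (∏ i ∈ range N, (4*(i:ℚ)+3-6*m)) * hB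
    - s2 (3*m) ((1-6*m)/4+N) * (-1)^m * (∏ i ∈ range N, (4*(i:ℚ)+6*m+1)) * (∏ j ∈ range m, -(4*(j:ℚ)+3-6*m)) * hA
end WZ3

section padicWZ
variable {p : ℕ} [hp : Fact p.Prime]

theorem pmem : (p:ℚ_[p]) ∈ Oi p := natCast_mem _ _

theorem one_add_un {a : ℚ_[p]} (ha : a ∈ Oi p) : un p (1 + p*a) := 
  un.cg (r := 1) (by norm_num) un.one ⟨a, ha, by ring⟩

theorem one_sub_un {r : ℕ} (hr : 0 < r) {a : ℚ_[p]} (ha : a ∈ Oi p) : un p (1 - p^r*a) := 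
  un.cg (r := r) hr un.one ⟨-a, neg_mem ha, by ring⟩

theorem prod_one {ι : Type*} (s : Finset ι) (u c : ι → ℚ_[p]) (r : ℕ) (t : ℕ) (hrt : r ≤ 2*t) (hc : ∀ i ∈ s, c i ∈ Oi p)
    (h : ∀ i ∈ s, cg p r (u i) (1 + p^t * c i)) : cg p r (∏ i ∈ s, u i) (1 + p^t * ∑ i ∈ s, c i) := by
  classical
  induction s using Finset.induction_on with
  | empty => simpa using cg.refl _
  | insert a s ha ih =>
    rw [prod_insert ha, sum_insert ha]
    have ih' := ih (fun i hi => hc i (mem_insert_of_mem hi)) (fun i hi => h i (mem_insert_of_mem hi))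
    have hs : ∑ i ∈ s, c i ∈ Oi p := sum_mem fun i hi => hc i (mem_insert_of_mem hi)
    have ha' := hc a (mem_insert_self _ _)
    have h1 : 1 + (p:ℚ_[p])^t * c a ∈ Oi p := add_mem (one_mem _) (mul_mem (pow_mem pmem _) ha')
    have h2 : 1 + (p:ℚ_[p])^t * ∑ i ∈ s, c i ∈ Oi p := add_mem (one_mem _) (mul_mem (pow_mem pmem _) hs)
    refine ((h a (mem_insert_self _ _)).mul h1 (ih'.mem h2) ih').trans ?_
    apply cg.mono hrt
    refine ⟨c a * ∑ i ∈ s, c i, mul_mem ha' hs, ?_⟩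
    ring

theorem fac_cg {a b a' b' : ℚ_[p]} (ha : a' ∈ Oi p) (hb : b' ∈ Oi p) (h1 : cg p 1 a a') (h2 : cg p 1 b b') :
    cg p 3 ((1-p^2*a)/(1-p^2*b)) (1+p^2*(b'-a')) := by
  have ha' := h1.mem ha
  have hb' := h2.mem hb
  have hu : un p (1-p^2*b) := one_sub_un (by norm_num) hb'
  apply hu.cancel
  rw [mul_div_cancel₀ _ hu.1]
  have h3 : cg p 3 (1 + p^2*(b - a)) (1+p^2*(b'-a')) := (cg.refl _).add ((h2.sub h1).pmul 2)
  refine cg.trans ?_ (h3.mul_left hu.2.1)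
  exact ⟨p*b*(b-a), mul_mem (mul_mem pmem hb') (sub_mem hb' ha'), by ring⟩

/-- harmonic-type sums -/
noncomputable def H2 (p : ℕ) [Fact p.Prime] (k : ℕ) : ℚ_[p] := ∑ i ∈ range k, (((i:ℚ_[p])+1)^2)⁻¹
/-- odd harmonic-type sums -/
noncomputable def OO (p : ℕ) [Fact p.Prime] (k : ℕ) : ℚ_[p] := ∑ i ∈ range k, ((2*(i:ℚ_[p])+1)^2)⁻¹

theorem un_odd {i n : ℕ} (hn : p = 2*n+1) (hi : i < n) : un p (2*(i:ℚ_[p])+1) := by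
  have := un_nat' (p := p) (n := 2*i+1) (by omega) (by omega)
  push_cast at this; exact this

theorem H2_mem {k : ℕ} (hk : k < p) : H2 p k ∈ Oi p := 
  sum_mem fun i hi => ((un_succ (p := p) (k := i) (by rw [mem_range] at hi; omega)).pow 2).2.2
theorem OO_mem {k n : ℕ} (hn : p = 2*n+1) (hk : k ≤ n) : OO p k ∈ Oi p := 
  sum_mem fun i hi => ((un_odd (p := p) (i := i) hn (by rw [mem_range] at hi; omega)).pow 2).2.2

theorem tK_prod (k : ℕ) : tK ℚ_[p] k = ∏ i ∈ range k, (2*(i:ℚ_[p])+1)^3/(2*(i+1)^3) := by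
  induction k with
  | zero => simp [tK]
  | succ k ih => rw [tK_succ, prod_range_succ, ← ih, mul_div_assoc]

theorem fF_cg {n : ℕ} (hn : p = 2*n+1) (hp3 : 3 < p) {k : ℕ} (hk : k ≤ n) :
    cg p 3 (fF ℚ_[p] p k) (tK ℚ_[p] k * (1 + p^2*(H2 p k - OO p k))) := by
  have e : fF ℚ_[p] p k = tK ℚ_[p] k * ∏ i ∈ range k, (1-(p:ℚ_[p])^2*((2*(i:ℚ_[p])+1)^2)⁻¹)/(1-(p:ℚ_[p])^2*(((i:ℚ_[p])+1)^2)⁻¹) := by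
    rw [tK_prod, ← prod_mul_distrib, fF]
    apply prod_congr rfl
    intro i hi
    rw [mem_range] at hi
    have h1 := un_odd (p := p) (i := i) hn (by omega)
    have h2 := un_succ (p := p) (k := i) (by omega)
    have h3 := one_sub_un (p := p) (r := 2) (by norm_num) (h2.pow 2).2.2
    have e3 : (((i:ℚ_[p])+1)^2-p^2) = (i+1)^2 * (1-p^2*(((i:ℚ_[p])+1)^2)⁻¹) := by
      rw [mul_sub, mul_left_comm, mul_inv_cancel₀ (h2.pow 2).1]; ring
    have e4 : ((2*(i:ℚ_[p])+1)^2-p^2) = (2*i+1)^2 * (1-p^2*((2*(i:ℚ_[p])+1)^2)⁻¹) := by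
      rw [mul_sub, mul_left_comm, mul_inv_cancel₀ (h1.pow 2).1]; ring
    rw [e3, e4]
    have n1 := h1.1
    have n2 := h2.1
    have n3 := h3.1
    have n4 := (un_two hp3).1
    generalize (1-(p:ℚ_[p])^2*((2*(i:ℚ_[p])+1)^2)⁻¹) = A at *
    generalize (1-(p:ℚ_[p])^2*(((i:ℚ_[p])+1)^2)⁻¹) = B at *
    field_simp
  rw [e]
  apply cg.mul_left (tK_mem hp3 k)
  rw [H2, OO, ← sum_sub_distrib]
  apply prod_one _ _ _ 3 2 (by norm_num)
  · intro i hi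
    rw [mem_range] at hi
    exact sub_mem ((un_succ (p := p) (k := i) (by omega)).pow 2).2.2 ((un_odd (p := p) (i := i) hn (by omega)).pow 2).2.2
  · intro i hi
    rw [mem_range] at hi
    exact fac_cg ((un_odd (p := p) (i := i) hn (by omega)).pow 2).2.2 ((un_succ (p := p) (k := i) (by omega)).pow 2).2.2 (cg.refl _) (cg.refl _)

theorem tK_high {n : ℕ} (hn : p = 2*n+1) (hp3 : 3 < p) {k : ℕ} (hk : n < k) (hkp : k < p) : cg p 3 (tK ℚ_[p] k) 0 := by
  have hd : p ∣ (2*k).choose k := by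
    have := hp.out.dvd_choose_add (a := k) (b := k) hkp hkp (by omega)
    rwa [← two_mul] at this
  obtain ⟨c, hc⟩ := hd
  rw [tK, hc]
  have h16 : (16:ℚ_[p]) = 2^4 := by norm_num
  refine ⟨(c:ℚ_[p])^3 * (16^k)⁻¹, mul_mem (pow_mem (natCast_mem _ _) _) ?_, by push_cast; ring⟩
  rw [h16]; exact (((un_two hp3).pow 4).pow k).2.2

theorem tsum_cg {n : ℕ} (hn : p = 2*n+1) (hp3 : 3 < p) (q : ℕ → ℚ_[p]) (hq : ∀ k, q k ∈ Oi p) : 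
    cg p 3 (∑ k ∈ range p, q k * tK ℚ_[p] k) (∑ k ∈ range (n+1), q k * tK ℚ_[p] k) := by
  have : range p = range ((n+1)+n) := by congr 1; omega
  rw [this, sum_range_add]
  have h : cg p 3 (∑ i ∈ range n, q (n+1+i) * tK ℚ_[p] (n+1+i)) (∑ i ∈ range n, 0) := by
    apply cg.sum
    intro i hi
    rw [mem_range] at hi
    have := (tK_high hn hp3 (k := n+1+i) (by omega) (by omega)).mul_left (hq (n+1+i))
    simpa using this
  have := (cg.refl (∑ k ∈ range (n+1), q k * tK ℚ_[p] k)).add h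
  simpa using this

theorem fF_cast (n k : ℕ) : ((fF ℚ (2*n+1) k : ℚ) : ℚ_[p]) = fF ℚ_[p] (2*n+1) k := by
  unfold fF; push_cast; rfl

/-- the main product -/
noncomputable def WW (p n : ℕ) [Fact p.Prime] : ℚ_[p] := (2*n+1) * ∏ j ∈ range n, (3*(j:ℚ_[p])+2)/(3*j+4)
/-- the second product -/
noncomputable def VV (p n : ℕ) [Fact p.Prime] : ℚ_[p] := (2*n+1) * ∏ j ∈ range n, (3*(j:ℚ_[p])+4)/(3*j+2)

/-- the correction -/
noncomputable def XX (p n : ℕ) [Fact p.Prime] : ℚ_[p] := ∑ k ∈ range (n+1), tK ℚ_[p] k * (H2 p k - OO p k)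

theorem W_cg {n : ℕ} (hn : p = 2*n+1) (hp3 : 3 < p) : cg p 3 (WW p n) (M0 p + p^2 * XX p n) := by
  have h := congrArg (fun z : ℚ => (z : ℚ_[p])) (fF_sum_W n)
  push_cast at h
  simp only [fF_cast] at h
  rw [WW, ← h]
  have hnp : (2*(n:ℚ_[p])+1) = p := by exact_mod_cast hn.symm
  rw [hnp]
  have h1 := cg.sum (s := range (n+1)) fun k hk => fF_cg hn hp3 (k := k) (by rw [mem_range] at hk; omega)
  refine h1.trans ?_
  have h2 := tsum_cg hn hp3 (fun _ => 1) (fun _ => one_mem _)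
  simp only [one_mul] at h2
  refine (cg.of_eq ?_).trans (h2.symm.add (cg.refl ((p:ℚ_[p])^2 * XX p n)))
  rw [XX, mul_sum, ← sum_add_distrib]
  exact sum_congr rfl fun k _ => by ring

theorem XX_mem {n : ℕ} (hn : p = 2*n+1) (hp3 : 3 < p) : XX p n ∈ Oi p := by
  apply sum_mem
  intro k hk
  rw [mem_range] at hk
  exact mul_mem (tK_mem hp3 k) (sub_mem (H2_mem (by omega)) (OO_mem hn (by omega)))

theorem V_cg {n : ℕ} (hn : p = 2*n+1) (hp3 : 3 < p) : cg p 2 (2 * VV p n) (∑ k ∈ range p, (3*(k:ℚ_[p])+1)*(3*k+2) * tK ℚ_[p] k) := by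
  have h := congrArg (fun z : ℚ => (z : ℚ_[p])) (fF_sum_V n)
  push_cast at h
  simp only [fF_cast] at h
  rw [VV, ← h]
  have hnp : (2*(n:ℚ_[p])+1) = p := by exact_mod_cast hn.symm
  rw [hnp]
  have hq : ∀ k : ℕ, (3*(k:ℚ_[p])+1)*(3*k+2) ∈ Oi p := fun k => by
    have : (3*(k:ℚ_[p])+1)*(3*k+2) = (((3*k+1)*(3*k+2) : ℕ) : ℚ_[p]) := by push_cast; ring
    rw [this]; exact natCast_mem _ _
  refine cg.trans ?_ ((tsum_cg hn hp3 (fun k => (3*(k:ℚ_[p])+1)*(3*k+2)) hq).mono (by norm_num)).symm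
  apply cg.sum
  intro k hk
  rw [mem_range] at hk
  apply cg.mul_left (hq k)
  refine ((fF_cg hn hp3 (k := k) (by omega)).mono (by norm_num)).trans ?_
  exact ⟨tK ℚ_[p] k * (H2 p k - OO p k), mul_mem (tK_mem hp3 k) (sub_mem (H2_mem (by omega)) (OO_mem hn (by omega))), by ring⟩

end padicWZ

open Finset

section padicM
variable {p : ℕ} [hp : Fact p.Prime]

theorem cg_p {r : ℕ} {a c : ℚ_[p]} (hc : c ∈ Oi p) : cg p r (a + p^r * c) a := ⟨c, hc, by ring⟩
theorem cg_p1 (a : ℚ_[p]) : cg p 1 (a - p) a := ⟨-1, neg_mem (one_mem _), by ring⟩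

theorem f2_cast (n : ℕ) (b : ℚ) (k : ℕ) : ((f2 ℚ n b k : ℚ) : ℚ_[p]) = f2 ℚ_[p] n b k := by
  unfold f2; push_cast; rfl

theorem un4 {m j : ℕ} (hm : p = 6*m+1) (hp3 : 3 < p) (hj : j < 3*m) : un p (4*(j:ℚ_[p])+2-p) := by
  refine un.cg (r := 1) (by norm_num) ?_ (cg_p1 _)
  have := (un_two hp3).mul (un_odd (p := p) (n := 3*m) (i := j) (by omega) hj)
  convert this using 1; ring

theorem un2 {m j : ℕ} (hm : p = 6*m+1) (hp3 : 3 < p) (hj : j < 3*m) : un p (2*(j:ℚ_[p])+2-p) := by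
  refine un.cg (r := 1) (by norm_num) ?_ (cg_p1 _)
  have := (un_two hp3).mul (un_succ (p := p) (k := j) (by omega))
  convert this using 1; ring

theorem f2_b0 {m : ℕ} (hm : p = 6*m+1) (hp3 : 3 < p) {k : ℕ} (hk : k ≤ 3*m) : 
    f2 ℚ_[p] ((p-1)/2) ((2-p)/4) k = ∏ j ∈ range k, (2*(j:ℚ_[p])+1-p)*(4*j+2-p)^2/(2*(2*j+2-p)^2*(j+1)) := by
  unfold f2
  apply prod_congr rfl
  intro j hj
  rw [mem_range] at hj
  have h2 := (un2 hm hp3 (j := j) (by omega)).1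
  have h3 := (un_succ (p := p) (k := j) (by omega)).1
  have e1 : (2*((2-(p:ℚ_[p]))/4)+j) = (2*j+2-p)/2 := by ring
  have e2 : (1-2*(((p:ℚ_[p])-1)/2)-2*((2-(p:ℚ_[p]))/4)+j) = (2*j+2-p)/2 := by ring
  have e3 : (2-(p:ℚ_[p]))/4+j = (4*j+2-p)/4 := by ring
  have e4 : (2*(j:ℚ_[p])+1)/2-(p-1)/2-(2-p)/4 = (4*j+2-p)/4 := by ring
  have e5 : (j:ℚ_[p])-(p-1)/2 = (2*j+1-p)/2 := by ring
  rw [e1, e2, e3, e4, e5]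
  field_simp
  ring

theorem f2_b0_cg {m : ℕ} (hm : p = 6*m+1) (hp3 : 3 < p) {k : ℕ} (hk : k ≤ 3*m) : 
    cg p 1 (f2 ℚ_[p] ((p-1)/2) ((2-p)/4) k) (tK ℚ_[p] k) := by
  rw [f2_b0 hm hp3 hk, tK_prod]
  induction k with
  | zero => simpa using cg.refl _
  | succ k ih =>
    rw [prod_range_succ, prod_range_succ]
    have h1 := un_odd (p := p) (n := 3*m) (i := k) (by omega) (by omega)
    have h3 := un_succ (p := p) (k := k) (by omega)
    have ht : (2*(k:ℚ_[p])+1)^3/(2*(k+1)^3) ∈ Oi p := ((h1.pow 3).div ((un_two hp3).mul (h3.pow 3))).2.1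
    have hc : cg p 1 ((2*(k:ℚ_[p])+1-p)*(4*k+2-p)^2/(2*(2*k+2-p)^2*(k+1))) ((2*(k:ℚ_[p])+1)^3/(2*(k+1)^3)) := by
      have e : (2*(k:ℚ_[p])+1)^3/(2*(k+1)^3) = (2*(k:ℚ_[p])+1)*(4*k+2)^2/(2*(2*k+2)^2*(k+1)) := by
        have := h3.1
        rw [show 4*(k:ℚ_[p])+2 = 2*(2*k+1) by ring, show 2*(k:ℚ_[p])+2 = 2*(k+1) by ring]
        field_simp
      rw [e]
      have k1 := cg_p1 (p := p) (2*(k:ℚ_[p])+1)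
      have k2 := cg_p1 (p := p) (4*(k:ℚ_[p])+2)
      have k3 := cg_p1 (p := p) (2*(k:ℚ_[p])+2)
      have m2 : 4*(k:ℚ_[p])+2 ∈ Oi p := by
        rw [show 4*(k:ℚ_[p])+2 = 2*(2*k+1) by ring]; exact ((un_two hp3).mul h1).2.1
      have m3 : un p (2*(k:ℚ_[p])+2) := by
        rw [show 2*(k:ℚ_[p])+2 = 2*(k+1) by ring]; exact ((un_two hp3).mul h3)
      apply cg.div
      · exact mul_mem h1.2.1 (pow_mem m2 _)
      · exact ((un_two hp3).mul ((un2 hm hp3 (by omega)).pow 2)).mul h3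
      · exact ((un_two hp3).mul (m3.pow 2)).mul h3
      · exact k1.mul h1.2.1 ((k2.pow m2 2).mem (pow_mem m2 _)) (k2.pow m2 2)
      · exact ((k3.pow m3.2.1 2).mul_left (un_two hp3).2.1).mul_right h3.2.1
    refine (ih (by omega)).mul ?_ (hc.mem ht) hc
    rw [← tK_prod]; exact tK_mem hp3 k

theorem un_four (hp3 : 3 < p) : un p 4 := by
  have := (un_two hp3).pow 2
  norm_num at this; exact this

theorem un_16 (hp3 : 3 < p) : un p 16 := by
  have := (un_two hp3).pow 4
  norm_num at this; exact this

theorem f2_bp {m : ℕ} (hm : p = 6*m+1) (hp3 : 3 < p) {k : ℕ} (hk : k ≤ 3*m) : 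
    cg p 3 (f2 ℚ_[p] ((p-1)/2) ((2-p)/4+p) k) (f2 ℚ_[p] ((p-1)/2) ((2-p)/4) k*(1+p^2*(4*(H2 p k - OO p k)))) := by
  have m0 := (f2_b0_cg hm hp3 hk).mem (tK_mem hp3 k)
  have e : f2 ℚ_[p] ((p-1)/2) ((2-p)/4+p) k = f2 ℚ_[p] ((p-1)/2) ((2-p)/4) k * ∏ j ∈ range k, 
      (1-(p:ℚ_[p])^2*(16*((4*(j:ℚ_[p])+2-p)^2)⁻¹))/(1-(p:ℚ_[p])^2*(16*((2*(j:ℚ_[p])+2-p)^2)⁻¹)) := by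
    rw [f2_b0 hm hp3 hk, ← prod_mul_distrib, f2]
    apply prod_congr rfl
    intro j hj
    rw [mem_range] at hj
    have h2 := (un2 hm hp3 (j := j) (by omega))
    have h4 := (un4 hm hp3 (j := j) (by omega))
    have h3 := (un_succ (p := p) (k := j) (by omega))
    have h5 := (one_sub_un (p := p) (r := 2) (by norm_num) ((un_16 hp3).mul (h2.pow 2).inv).2.1)
    have e1 : (2*((2-(p:ℚ_[p]))/4+p)+j)*(1-2*(((p:ℚ_[p])-1)/2)-2*((2-(p:ℚ_[p]))/4+p)+j) = ((2*j+2-p)^2 * (1-(p:ℚ_[p])^2*(16*((2*(j:ℚ_[p])+2-p)^2)⁻¹)))/4 := by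
      rw [mul_sub, mul_left_comm, mul_left_comm _ (16:ℚ_[p]), mul_inv_cancel₀ (h2.pow 2).1]; ring
    have e2 : ((j:ℚ_[p])-(p-1)/2)*((2-(p:ℚ_[p]))/4+p+j)*((2*(j:ℚ_[p])+1)/2-(p-1)/2-((2-p)/4+p))*4 = 
      (2*j+1-p)*(((4*j+2-p)^2 * (1-(p:ℚ_[p])^2*(16*((4*(j:ℚ_[p])+2-p)^2)⁻¹))))/8 := by
      rw [mul_sub ((4*(j:ℚ_[p])+2-p)^2), mul_left_comm ((4*(j:ℚ_[p])+2-p)^2), mul_left_comm _ (16:ℚ_[p]), mul_inv_cancel₀ (h4.pow 2).1]; ring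
    rw [e1, e2]
    have n2 := h2.1
    have n3 := h3.1
    have n5 := h5.1
    generalize (1-(p:ℚ_[p])^2*(16*((4*(j:ℚ_[p])+2-p)^2)⁻¹)) = A at *
    generalize (1-(p:ℚ_[p])^2*(16*((2*(j:ℚ_[p])+2-p)^2)⁻¹)) = B at *
    field_simp
    ring
  rw [e]
  apply cg.mul_left m0
  rw [H2, OO, ← sum_sub_distrib, mul_sum]
  apply prod_one _ _ _ 3 2 (by norm_num)
  · intro i hi
    rw [mem_range] at hi
    exact mul_mem (un_four hp3).2.1 (sub_mem ((un_succ (p := p) (k := i) (by omega)).pow 2).2.2 ((un_odd (p := p) (i := i) (n := 3*m) (by omega) (by omega)).pow 2).2.2)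
  · intro i hi
    rw [mem_range] at hi
    have h1 := (un_odd (p := p) (i := i) (n := 3*m) (by omega) (by omega))
    have h2 := un_succ (p := p) (k := i) (by omega)
    have u4 := un_four (p := p) hp3
    rw [mul_sub]
    apply fac_cg
    · exact mul_mem u4.2.1 (h1.pow 2).2.2
    · exact mul_mem u4.2.1 (h2.pow 2).2.2
    · have e : 4*((2*(i:ℚ_[p])+1)^2)⁻¹ = 16*((4*(i:ℚ_[p])+2)^2)⁻¹ := by
        rw [show 4*(i:ℚ_[p])+2 = 2*(2*i+1) by ring, mul_pow, mul_inv]; norm_num; ring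
      rw [e]
      have u : un p (4*(i:ℚ_[p])+2) := by
        rw [show 4*(i:ℚ_[p])+2 = 2*(2*i+1) by ring]; exact (un_two hp3).mul h1
      exact (un.inv_cg ((un4 hm hp3 (by omega)).pow 2) (u.pow 2) ((cg_p1 _).pow u.2.1 2)).mul_left (un_16 hp3).2.1
    · have e : 4*(((i:ℚ_[p])+1)^2)⁻¹ = 16*((2*(i:ℚ_[p])+2)^2)⁻¹ := by
        rw [show 2*(i:ℚ_[p])+2 = 2*(i+1) by ring, mul_pow, mul_inv]; norm_num; ring
      rw [e]
      have u : un p (2*(i:ℚ_[p])+2) := by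
        rw [show 2*(i:ℚ_[p])+2 = 2*(i+1) by ring]; exact (un_two hp3).mul h2
      exact (un.inv_cg ((un2 hm hp3 (by omega)).pow 2) (u.pow 2) ((cg_p1 _).pow u.2.1 2)).mul_left (un_16 hp3).2.1

theorem M0_cg {m : ℕ} (hm : p = 6*m+1) (hp3 : 3 < p) : cg p 3 (4 * WW p (3*m)) (M0 p * (4 + p^2 * H2 p m)) := by
  have hn : p = 2*(3*m)+1 := by omega
  have hpm : (p:ℚ_[p]) = 6*m+1 := by exact_mod_cast hm
  have h := congrArg (fun z : ℚ => (z : ℚ_[p])) (s2_final m)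
  simp only [s2] at h
  push_cast at h
  have fc : ∀ b k, ((f2 ℚ (3*m) b k : ℚ) : ℚ_[p]) = f2 ℚ_[p] ((p-1)/2) b k := by
    intro b k
    have := f2_cast (p := p) (3*m) b k
    push_cast at this
    rw [this]; congr 1; rw [hpm]; ring
  simp only [fc] at h
  push_cast at h
  have eb : (1-6*(m:ℚ_[p]))/4 = (2-p)/4 := by rw [hpm]; ring
  rw [← hpm, eb] at h
  set S0 := ∑ k ∈ range (3*m+1), f2 ℚ_[p] ((p-1)/2) ((2-p)/4) k with hS0
  set Sp := ∑ k ∈ range (3*m+1), f2 ℚ_[p] ((p-1)/2) ((2-p)/4+p) k with hSp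
  have hM : cg p 3 (M0 p) (∑ k ∈ range (3*m+1), tK ℚ_[p] k) := by
    have := tsum_cg hn hp3 (fun _ => 1) (fun _ => one_mem _)
    simpa [M0] using this
  have hM0 : M0 p ∈ Oi p := sum_mem fun k _ => tK_mem hp3 k
  have c0 : cg p 1 S0 (M0 p) := 
    (cg.sum (s := range (3*m+1)) fun k hk => f2_b0_cg hm hp3 (k := k) (by rw [mem_range] at hk; omega)).trans (hM.mono (by norm_num)).symm
  have cp : cg p 3 Sp (S0 + p^2*(4*XX p (3*m))) := by
    have h1 := cg.sum (s := range (3*m+1)) fun k hk => f2_bp hm hp3 (k := k) (by rw [mem_range] at hk; omega)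
    refine h1.trans ?_
    have h2 : cg p 1 (∑ k ∈ range (3*m+1), f2 ℚ_[p] ((p-1)/2) ((2-p)/4) k * (4*(H2 p k - OO p k))) (4*XX p (3*m)) := by
      rw [XX, mul_sum]
      apply cg.sum
      intro k hk
      rw [mem_range] at hk
      refine ((f2_b0_cg hm hp3 (k := k) (by omega)).mul_right ?_).trans (cg.of_eq (by ring))
      exact mul_mem (un_four hp3).2.1 (sub_mem (H2_mem (by omega)) (OO_mem hn (by omega)))
    refine cg.trans (cg.of_eq ?_) ((cg.refl S0).add (h2.pmul 2))
    rw [hS0, mul_sum, ← sum_add_distrib]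
    exact sum_congr rfl fun k _ => by ring
  have xu : ∀ i ∈ range m, un p (4*((i:ℚ_[p])+1)-p) := by
    intro i hi
    rw [mem_range] at hi
    exact un.cg (r := 1) (by norm_num) ((un_four hp3).mul (un_succ (by omega))) (cg_p1 _)
  have ex : ∀ i : ℕ, 4*(i:ℚ_[p])+3-6*m = 4*(i+1)-p := fun i => by rw [hpm]; ring
  simp only [ex] at h
  have e3 : ∏ i ∈ range m, ((4*((i:ℚ_[p])+1)-p)^2-16*(p:ℚ_[p])^2) = (∏ i ∈ range m, (4*((i:ℚ_[p])+1)-p)^2) * ∏ i ∈ range m, (1 - (p:ℚ_[p])^2 * (16*((4*((i:ℚ_[p])+1)-p)^2)⁻¹)) := by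
    rw [← prod_mul_distrib]
    apply prod_congr rfl
    intro i hi
    have := ((xu i hi).pow 2).1
    rw [mul_sub, mul_left_comm, mul_left_comm _ (16:ℚ_[p]), mul_inv_cancel₀ this]; ring
  rw [e3] at h
  have xp : un p (∏ i ∈ range m, (4*((i:ℚ_[p])+1)-p)^2) := un.prod fun i hi => (xu i hi).pow 2
  set Q := ∏ i ∈ range m, (1 - (p:ℚ_[p])^2 * (16*((4*((i:ℚ_[p])+1)-p)^2)⁻¹)) with hQ
  have h' : Sp * Q = S0 := by
    apply mul_left_cancel₀ xp.1
    linear_combination h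
  have cQ : cg p 3 Q (1 + p^2 * (-H2 p m)) := by
    rw [H2, ← sum_neg_distrib]
    apply prod_one _ _ _ 3 2 (by norm_num)
    · intro i hi
      rw [mem_range] at hi
      exact neg_mem ((un_succ (p := p) (k := i) (by omega)).pow 2).2.2
    · intro i hi
      have xui := xu i hi
      rw [mem_range] at hi
      have u1 := un_succ (p := p) (k := i) (by omega)
      have e : (((i:ℚ_[p])+1)^2)⁻¹ = 16*((4*((i:ℚ_[p])+1))^2)⁻¹ := by
        rw [mul_pow, mul_inv]; norm_num; ring
      have u : un p (4*((i:ℚ_[p])+1)) := (un_four hp3).mul u1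
      have : cg p 1 (16*((4*((i:ℚ_[p])+1)-p)^2)⁻¹) (((i:ℚ_[p])+1)^2)⁻¹ := by
        rw [e]
        exact (un.inv_cg (xui.pow 2) (u.pow 2) ((cg_p1 _).pow u.2.1 2)).mul_left (un_16 hp3).2.1
      rw [mul_neg, ← sub_eq_add_neg]
      exact (cg.refl 1).sub (this.pmul 2)
  have mX := XX_mem hn hp3
  have mH : H2 p m ∈ Oi p := H2_mem (by omega)
  have mS0 := c0.mem hM0
  have mSp : Sp ∈ Oi p := cp.mem (add_mem mS0 (mul_mem (pow_mem pmem _) (mul_mem (un_four hp3).2.1 mX)))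
  have c1 : cg p 3 S0 (Sp * (1 + p^2 * (-H2 p m))) := by
    rw [← h']; exact cQ.mul_left mSp
  have c2 : cg p 1 Sp (M0 p) := by
    refine (cp.mono (by norm_num)).trans (cg.trans ?_ c0)
    exact ⟨p*(4*XX p (3*m)), mul_mem pmem (mul_mem (un_four hp3).2.1 mX), by ring⟩
  have c3 : cg p 3 (p^2*(4*XX p (3*m))) (p^2*(H2 p m * M0 p)) := by
    refine (cg.of_eq ?_).trans ((cp.symm.sub c1).trans ((cg.of_eq ?_).trans ((c2.mul_left mH).pmul 2)))
    · ring
    · ring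
  have := ((W_cg hn hp3).mul_left (un_four hp3).2.1)
  refine (this.trans (cg.of_eq ?_)).trans (((cg.refl (4*M0 p)).add c3).trans (cg.of_eq ?_))
  · ring
  · ring


theorem WW_zero {m : ℕ} (hm : p = 6*m+5) (hp3 : 3 < p) : cg p 2 (WW p (3*m+2)) 0 := by
  have hpm : (p:ℚ_[p]) = 6*m+5 := by exact_mod_cast hm
  have hj : 2*m+1 ∈ range (3*m+2) := by rw [mem_range]; omega
  rw [WW, ← mul_prod_erase _ _ hj]
  have mem1 : ∀ j ∈ range (3*m+2), ((3*(j:ℚ_[p])+4))⁻¹ ∈ Oi p := by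
    intro j hj
    rw [mem_range] at hj
    have : un p ((3*j+4:ℕ):ℚ_[p]) := by
      apply un_nat
      rintro ⟨c, hc⟩
      have h1 : c < 2 := by
        by_contra hcon
        push Not at hcon
        have : p * 2 ≤ p * c := Nat.mul_le_mul_left _ hcon
        omega
      interval_cases c <;> omega
    push_cast at this
    exact this.2.2
  have mem2 : ∀ j : ℕ, (3*(j:ℚ_[p])+2) ∈ Oi p := by
    intro j
    have : ((3*j+2:ℕ):ℚ_[p]) ∈ Oi p := natCast_mem _ _
    push_cast at this; exact this
  refine ⟨(3*((2*m+1:ℕ):ℚ_[p])+4)⁻¹ * ∏ j ∈ (range (3*m+2)).erase (2*m+1), (3*(j:ℚ_[p])+2)/(3*j+4), mul_mem (mem1 _ hj) (prod_mem fun j hj => mul_mem (mem2 j) (mem1 j (mem_of_mem_erase hj))), ?_⟩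
  push_cast
  rw [hpm]; ring

theorem M0_zero {m : ℕ} (hm : p = 6*m+5) (hp3 : 3 < p) : cg p 2 (M0 p) 0 := by
  have hn : p = 2*(3*m+2)+1 := by omega
  have h1 := (W_cg hn hp3).mono (show 2 ≤ 3 by norm_num)
  have h2 := WW_zero hm hp3
  have h3 := cg_pmem (r := 2) (XX_mem hn hp3)
  refine (cg.of_eq ?_).trans ((h1.symm.trans h2).sub h3 |>.trans (cg.of_eq ?_))
  · ring
  · ring

end padicM

open Finset

section padicV
variable {p : ℕ} [hp : Fact p.Prime]

/-- first-order expansion -/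
def ap (p : ℕ) [Fact p.Prime] (a x : ℚ_[p]) : Prop := x ∈ Oi p ∧ cg p 2 a (1 + p*x)

theorem ap.un {a x : ℚ_[p]} (h : ap p a x) : un p a := un.cg (by norm_num) (one_add_un h.1) h.2

theorem ap.mul {a x b y : ℚ_[p]} (h : ap p a x) (h' : ap p b y) : ap p (a*b) (x+y) := by
  refine ⟨add_mem h.1 h'.1, (h.2.mul (one_add_un h.1).2.1 h'.un.2.1 h'.2).trans ?_⟩
  exact ⟨x*y, mul_mem h.1 h'.1, by ring⟩

theorem ap.inv {a x : ℚ_[p]} (h : ap p a x) : ap p a⁻¹ (-x) := by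
  refine ⟨neg_mem h.1, h.un.cancel ?_⟩
  rw [mul_inv_cancel₀ h.un.1]
  refine cg.symm ((h.2.mul_right (c := 1+(p:ℚ_[p])*-x) (one_add_un (neg_mem h.1)).2.1).trans ?_)
  exact ⟨-x*x, mul_mem (neg_mem h.1) h.1, by ring⟩

theorem ap.div {a x b y : ℚ_[p]} (h : ap p a x) (h' : ap p b y) : ap p (a/b) (x-y) := by
  rw [div_eq_mul_inv, sub_eq_add_neg]; exact h.mul h'.inv

theorem ap.congr {a x y : ℚ_[p]} (h : ap p a x) (h' : cg p 1 y x) : ap p a y := 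
  ⟨h'.mem h.1, h.2.trans ((cg.refl 1).add (by simpa using (h'.symm.pmul 1)))⟩

/-- harmonic numbers -/
noncomputable def HH (p : ℕ) [Fact p.Prime] (k : ℕ) : ℚ_[p] := ∑ i ∈ range k, ((i:ℚ_[p])+1)⁻¹

theorem HH_mem {k : ℕ} (hk : k < p) : HH p k ∈ Oi p := 
  sum_mem fun i hi => ((un_succ (p := p) (k := i) (by rw [mem_range] at hi; omega))).2.2

/-- unit part of shifted factorials -/
noncomputable def EE (p : ℕ) [Fact p.Prime] (c : ℚ_[p]) (k : ℕ) : ℚ_[p] := ∏ i ∈ range k, (1 + p * (c * ((i:ℚ_[p])+1)⁻¹))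

theorem EE_ap {c : ℚ_[p]} (hc : c ∈ Oi p) {k : ℕ} (hk : k < p) : ap p (EE p c k) (c * HH p k) := by
  refine ⟨mul_mem hc (HH_mem hk), ?_⟩
  rw [HH, mul_sum]
  have := prod_one (p := p) (range k) (fun i => (1 + p * (c * ((i:ℚ_[p])+1)⁻¹))) (fun i => c * ((i:ℚ_[p])+1)⁻¹) 2 1 (by norm_num) ?_ ?_
  · simpa [EE] using this
  · intro i hi
    exact mul_mem hc ((un_succ (p := p) (k := i) (by rw [mem_range] at hi; omega))).2.2
  · intro i _
    simpa using cg.refl _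

/-- shifted factorials -/
noncomputable def Dg (p : ℕ) [Fact p.Prime] (d x : ℚ_[p]) (k : ℕ) : ℚ_[p] := ∏ i ∈ range k, (d * ((i:ℚ_[p])+1) + x)

theorem Dg_eq {d : ℚ_[p]} (hd : d ≠ 0) (c : ℚ_[p]) (k : ℕ) : Dg p d (c*p) k = d^k * k.factorial * EE p (c/d) k := by
  induction k with
  | zero => simp [Dg, EE]
  | succ k ih =>
    rw [Dg, EE, prod_range_succ, prod_range_succ, ← EE, ← Dg, ih, Nat.factorial_succ]
    have : ((k:ℚ_[p])+1) ≠ 0 := by exact_mod_cast Nat.succ_ne_zero k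
    push_cast
    field_simp
    ring

theorem Dg_split (d x : ℚ_[p]) (a b : ℕ) : Dg p d x a * ∏ i ∈ range b, (d*(a+i+1)+x) = Dg p d x (a+b) := by
  rw [Dg, Dg, prod_range_add]; push_cast; rfl

theorem cast_refl (N i : ℕ) (h : i < N) : ((N-1-i:ℕ):ℚ_[p]) = N-1-i := by
  rw [Nat.cast_sub (by omega), Nat.cast_sub (by omega)]; simp

theorem prod_negc (f : ℕ → ℚ_[p]) (k : ℕ) : ∏ i ∈ range k, (-f i) = (-1)^k * ∏ i ∈ range k, f i := by
  rw [prod_neg, card_range]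

theorem prod_neg_even (f : ℕ → ℚ_[p]) {k : ℕ} (hk : (-1:ℚ_[p])^k = 1) : ∏ i ∈ range k, f i = ∏ i ∈ range k, (-f i) := by
  rw [prod_negc, hk, one_mul]

theorem VV_eq {m : ℕ} (hm : p = 6*m+5) (hp3 : 3 < p) : - VV p (3*m+2) * (Dg p 3 (-1*p) (2*m+2) * Dg p 3 (-2*p) m * Dg p 3 (-1*p) (2*m+1) * Dg p 3 (1*p) m) =
    Dg p 3 (-1*p) (3*m+2) * Dg p 3 (-2*p) (3*m+2) := by
  have hpm : (p:ℚ_[p]) = 6*m+5 := by exact_mod_cast hm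
  have n1 := Dg_split (p := p) 3 (-1*p) (2*m+2) m
  rw [show 2*m+2+m = 3*m+2 by ring] at n1
  have n2 := Dg_split (p := p) 3 (-2*p) m (2*m+2)
  rw [show m+(2*m+2) = 3*m+2 by ring] at n2
  rw [← n1, ← n2, VV, prod_div_distrib]
  have e1 : ∏ j ∈ range (3*m+2), (3*(j:ℚ_[p])+4) = (∏ i ∈ range m, (3*((2*m+2:ℕ)+i+1)+(-1*(p:ℚ_[p])))) * ∏ i ∈ range (2*m+2), (3*((m:ℚ_[p])+i+1)+(-2*p)) := by
    rw [show 3*m+2 = m+(2*m+2) by ring, prod_range_add]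
    congr 1
    · apply prod_congr rfl; intro j _; rw [hpm]; push_cast; ring
    · rw [← prod_range_reflect]
      rw [prod_neg_even _ (show (-1:ℚ_[p])^(2*m+2) = 1 by rw [show 2*m+2 = 2*(m+1) by ring, pow_mul]; simp)]
      apply prod_congr rfl; intro j hj; rw [mem_range] at hj
      rw [Nat.cast_add, cast_refl _ _ hj, hpm]; push_cast; ring
  have e2 : ∏ j ∈ range (3*m+2), (3*(j:ℚ_[p])+2) = - (p * (Dg p 3 (-1*p) (2*m+1) * Dg p 3 (1*p) m)) := by
    rw [show 3*m+2 = (2*m+1+1)+m by ring, prod_range_add, prod_range_succ]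
    have d1 : ∏ j ∈ range (2*m+1), (3*(j:ℚ_[p])+2) = - Dg p 3 (-1*p) (2*m+1) := by
      rw [← prod_range_reflect]
      have : (-1:ℚ_[p]) = (-1)^(2*m+1) := by rw [pow_succ, pow_mul]; simp
      rw [neg_eq_neg_one_mul, Dg]
      nth_rw 1 [this]
      rw [← prod_negc]
      apply prod_congr rfl; intro j hj; rw [mem_range] at hj
      rw [cast_refl _ _ hj, hpm]; push_cast; ring
    have d2 : ∏ j ∈ range m, (3*((2*m+1+1+j:ℕ):ℚ_[p])+2) = Dg p 3 (1*p) m := by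
      rw [Dg]
      apply prod_congr rfl; intro j hj
      rw [hpm]; push_cast; ring
    rw [d1, d2]
    push_cast; rw [hpm]; ring
  rw [e1, e2]
  have h0 : ∏ j ∈ range (3*m+2), (3*(j:ℚ_[p])+2) ≠ 0 := by
    rw [prod_ne_zero_iff]; intro j _; exact_mod_cast Nat.succ_ne_zero (3*j+1)
  rw [e2] at h0
  have h1 : Dg p 3 (-1*p) (2*m+1) ≠ 0 := by intro h; apply h0; rw [h]; ring
  have h2 : Dg p 3 (1*p) m ≠ 0 := by intro h; apply h0; rw [h]; ring
  have h3 := p_ne (p := p)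
  have h4 : (2*((3*m+2:ℕ):ℚ_[p])+1) = p := by rw [hpm]; push_cast; ring
  rw [h4]
  generalize Dg p 3 (-1*p) (2*m+1) = D1 at *
  generalize Dg p 3 (1*p) m = D2 at *
  field_simp

theorem cg_negp (a : ℚ_[p]) : cg p 1 a (a - p) := (cg_p1 a).symm

theorem HH_half {n : ℕ} (hn : p = 2*n+1) (hp3 : 3 < p) : ap p (2^(p-1)) (-(1/2) * HH p n) := by
  have hpn : (p:ℚ_[p]) = 2*n+1 := by exact_mod_cast hn
  have u2 := un_two (p := p) hp3
  have f1 : ∏ i ∈ range (2*n), ((i:ℚ_[p])+1) = (-1)^n * (Dg p 2 (0*p) n * Dg p 2 (-1*p) n) := by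
    have : ∀ k : ℕ, ∏ i ∈ range (2*k), ((i:ℚ_[p])+1) = ∏ i ∈ range k, ((2*(i:ℚ_[p])+1)*(2*i+2)) := by
      intro k
      induction k with
      | zero => simp
      | succ k ih => 
        rw [show 2*(k+1) = 2*k+1+1 by ring, prod_range_succ, prod_range_succ, prod_range_succ, ih]
        push_cast; ring
    rw [this, prod_mul_distrib, mul_comm, mul_left_comm]
    congr 1
    · rw [Dg]; apply prod_congr rfl; intro i _; ring
    · rw [← prod_range_reflect, Dg, ← prod_negc]
      apply prod_congr rfl; intro j hj; rw [mem_range] at hj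
      rw [cast_refl _ _ hj, hpn]; push_cast; ring
  have f2 : ∏ i ∈ range (2*n), ((i:ℚ_[p])+1) = (-1)^n * (Dg p 1 (0*p) n * Dg p 1 (-1*p) n) := by
    rw [two_mul, prod_range_add, mul_left_comm]
    congr 1
    · rw [Dg]; apply prod_congr rfl; intro i _; ring
    · rw [← prod_range_reflect, Dg, ← prod_negc]
      apply prod_congr rfl; intro j hj; rw [mem_range] at hj
      rw [Nat.cast_add, cast_refl _ _ hj, hpn]; push_cast; ring
  rw [f1] at f2
  have f3 := mul_left_cancel₀ (pow_ne_zero n (neg_ne_zero.2 one_ne_zero)) f2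
  rw [Dg_eq u2.1, Dg_eq u2.1, Dg_eq one_ne_zero, Dg_eq one_ne_zero] at f3
  have ez : ∀ k, EE p 0 k = 1 := by intro k; simp [EE]
  simp only [zero_div, ez, one_pow, one_mul, mul_one, div_one] at f3
  have hf : (n.factorial:ℚ_[p]) ≠ 0 := by exact_mod_cast n.factorial_ne_zero
  have hE1 := EE_ap (p := p) (c := -1/2) (by rw [neg_div, one_div]; exact neg_mem u2.2.2) (k := n) (by omega)
  have hE2 := EE_ap (p := p) (c := -1) (neg_mem (one_mem _)) (k := n) (by omega)
  have f4 : (2:ℚ_[p])^(p-1) = EE p (-1) n / EE p (-1/2) n := by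
    rw [eq_div_iff hE1.un.1, show p-1 = n+n by omega, pow_add]
    apply mul_left_cancel₀ (mul_ne_zero hf hf)
    linear_combination f3
  rw [f4]
  have := hE2.div hE1
  convert this using 1; ring

theorem HH_third {m : ℕ} (hm : p = 6*m+5) (hp3 : 3 < p) : ap p (3^(p-1)) (-(2/3) * HH p (2*m+1)) := by
  have u2 := un_two (p := p) hp3
  have u3 := un_three (p := p) hp3
  obtain ⟨N, hN⟩ : ∃ N, N = 2*m+1 := ⟨_, rfl⟩
  rw [← hN]
  have hpN : p = 3*N+2 := by omega
  have hpn : (p:ℚ_[p]) = 3*N+2 := by exact_mod_cast hpN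
  have hodd : (-1:ℚ_[p])^N = -1 := by rw [hN, pow_succ, pow_mul]; simp
  -- the middle block
  have mu : ∀ i ∈ range (N+1), un p ((N:ℚ_[p])+i+1) := by
    intro i hi; rw [mem_range] at hi
    have := un_nat' (p := p) (n := N+i+1) (by omega) (by omega)
    push_cast at this; exact this
  set L := ∏ i ∈ range (N+1), ((N:ℚ_[p])+i+1) with hL
  have hL0 : L ≠ 0 := (un.prod mu).1
  set E := ∏ i ∈ range (N+1), (1 + (p:ℚ_[p])^1*(-(2/3)*((N:ℚ_[p])+i+1)⁻¹)) with hE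
  have f1 : ∏ i ∈ range (3*N+1), ((i:ℚ_[p])+1) = Dg p 3 (0*p) N * (3^(N+1) * L * E) * Dg p 3 (-1*p) N * (-1) := by
    have : ∀ k : ℕ, ∏ i ∈ range (3*k+1), ((i:ℚ_[p])+1) = (∏ i ∈ range k, (3*(i:ℚ_[p])+3)) * (∏ i ∈ range (k+1), (3*(i:ℚ_[p])+1)) * (∏ i ∈ range k, (3*(i:ℚ_[p])+2)) := by
      intro k
      induction k with
      | zero => simp
      | succ k ih => 
        rw [show 3*(k+1)+1 = 3*k+1+1+1+1 by ring, prod_range_succ, prod_range_succ, prod_range_succ, ih, 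
          prod_range_succ (fun i : ℕ => 3*(i:ℚ_[p])+3), prod_range_succ _ (k+1), prod_range_succ (fun i : ℕ => 3*(i:ℚ_[p])+2)]
        push_cast; ring
    rw [this]
    have g1 : (∏ i ∈ range N, (3*(i:ℚ_[p])+3)) = Dg p 3 (0*p) N := by
      rw [Dg]; apply prod_congr rfl; intro i _; ring
    have g2 : (∏ i ∈ range N, (3*(i:ℚ_[p])+2)) = -Dg p 3 (-1*p) N := by
      rw [neg_eq_neg_one_mul, Dg]
      nth_rw 1 [← hodd]
      rw [← prod_range_reflect, ← prod_negc]
      apply prod_congr rfl; intro j hj; rw [mem_range] at hj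
      rw [cast_refl _ _ hj, hpn]; push_cast; ring
    have g3 : (∏ i ∈ range (N+1), (3*(i:ℚ_[p])+1)) = 3^(N+1) * L * E := by
      have h3 : (3:ℚ_[p])^(N+1) = ∏ i ∈ range (N+1), 3 := by simp
      have hs : (-1:ℚ_[p])^(N+1) = 1 := by rw [pow_succ, hodd]; ring
      rw [h3, hL, hE, ← prod_mul_distrib, ← prod_mul_distrib, ← prod_range_reflect]
      rw [prod_neg_even _ hs]
      apply prod_congr rfl; intro j hj
      have h1 := (mu j hj).1
      rw [mem_range] at hj
      rw [cast_refl _ _ hj]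
      field_simp
      rw [hpn]; push_cast; ring
    rw [g1, g2, g3]; ring
  have f2 : ∏ i ∈ range (3*N+1), ((i:ℚ_[p])+1) = Dg p 1 (0*p) N * L * Dg p 1 (-1*p) N * (-1) := by
    rw [show 3*N+1 = N+(N+1)+N by ring, prod_range_add, prod_range_add]
    have g1 : ∏ i ∈ range N, ((i:ℚ_[p])+1) = Dg p 1 (0*p) N := by
      rw [Dg]; apply prod_congr rfl; intro i _; ring
    have g2 : ∏ x ∈ range N, (((N+(N+1)+x:ℕ):ℚ_[p])+1) = -Dg p 1 (-1*p) N := by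
      rw [neg_eq_neg_one_mul, Dg]
      nth_rw 1 [← hodd]
      rw [← prod_range_reflect, ← prod_negc]
      apply prod_congr rfl; intro j hj; rw [mem_range] at hj
      rw [Nat.cast_add, cast_refl _ _ hj, hpn]; push_cast; ring
    rw [g1, g2, hL]; push_cast; ring
  rw [f1] at f2
  rw [Dg_eq u3.1, Dg_eq u3.1, Dg_eq one_ne_zero, Dg_eq one_ne_zero] at f2
  have ez : ∀ k, EE p 0 k = 1 := by intro k; simp [EE]
  simp only [zero_div, ez, one_pow, one_mul, mul_one, div_one] at f2
  have hf : (N.factorial:ℚ_[p]) ≠ 0 := by exact_mod_cast N.factorial_ne_zero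
  have hE1 := EE_ap (p := p) (c := -1/3) (by rw [neg_div, one_div]; exact neg_mem u3.2.2) (k := N) (by omega)
  have hE2 := EE_ap (p := p) (c := -1) (neg_mem (one_mem _)) (k := N) (by omega)
  have m23 : -(2/3:ℚ_[p]) ∈ Oi p := neg_mem (mul_mem u2.2.1 u3.2.2)
  have hE3 : ap p E 0 := by
    have hK : cg p 1 (∑ i ∈ range (N+1), ((N:ℚ_[p])+i+1)⁻¹) 0 := by
      apply u2.cancel
      rw [two_mul, mul_zero]
      nth_rw 2 [← sum_range_reflect]
      rw [← sum_add_distrib]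
      have : (0:ℚ_[p]) = ∑ i ∈ range (N+1), 0 := by simp
      rw [this]
      apply cg.sum
      intro i hi
      have h1 := mu i hi
      have h2 := mu (N-i) (by rw [mem_range] at *; omega)
      rw [mem_range] at hi
      rw [Nat.cast_sub (by omega)] at h2
      rw [cast_refl _ _ hi]
      refine ⟨((N:ℚ_[p])+i+1)⁻¹ * ((N:ℚ_[p])+(N-i)+1)⁻¹, mul_mem h1.2.2 h2.2.2, ?_⟩
      have z1 := h1.1
      have z2 := h2.1
      push_cast
      rw [show (N:ℚ_[p])+(N+1-1-i)+1 = N+(N-i)+1 by ring]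
      field_simp
      rw [hpn]; ring
    have h0 : cg p 2 E (1 + p^1 * ∑ i ∈ range (N+1), (-(2/3)*((N:ℚ_[p])+i+1)⁻¹)) := 
      prod_one _ _ _ 2 1 (by norm_num) (fun i hi => mul_mem m23 (mu i hi).2.2) (fun i _ => cg.refl _)
    rw [← mul_sum] at h0
    have : ap p E (-(2/3) * ∑ i ∈ range (N+1), ((N:ℚ_[p])+i+1)⁻¹) := 
      ⟨mul_mem m23 (sum_mem fun i hi => (mu i hi).2.2), by simpa using h0⟩
    refine this.congr ?_
    have := (hK.mul_left m23).symm
    simpa using this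
  have f4 : (3:ℚ_[p])^(p-1) = EE p (-1) N / (E * EE p (-1/3) N) := by
    rw [eq_div_iff (hE3.mul hE1).un.1, show p-1 = N+(N+1)+N by omega, pow_add, pow_add]
    apply mul_left_cancel₀ (mul_ne_zero (mul_ne_zero hf hf) hL0)
    linear_combination -f2
  rw [f4]
  have := hE2.div (hE3.mul hE1)
  convert this using 1; ring

end padicV

open Finset

section padicV2
variable {p : ℕ} [hp : Fact p.Prime]

theorem cast_refl1 (N i : ℕ) (h : i < N) : ((N-1-i:ℕ):ℚ_[p])+1 = N-i := by
  rw [cast_refl N i h]; ring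

theorem HH_succ (k : ℕ) : HH p (k+1) = HH p k + ((k:ℚ_[p])+1)⁻¹ := by rw [HH, sum_range_succ, ← HH]

theorem HH_split {m : ℕ} (hm : p = 6*m+5) (hp3 : 3 < p) : cg p 1 (HH p m) (HH p (2*m+1) + HH p (3*m+2)) := by
  have u2 := un_two (p := p) hp3
  have hpn : (p:ℚ_[p]) = 6*m+5 := by exact_mod_cast hm
  have e1 : HH p (2*m+1) = 1/2 * HH p m + ∑ t ∈ range (m+1), (2*(t:ℚ_[p])+1)⁻¹ := by
    have : ∀ k, HH p (2*k+1) = 1/2 * HH p k + ∑ t ∈ range (k+1), (2*(t:ℚ_[p])+1)⁻¹ := by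
      intro k
      induction k with
      | zero => simp [HH]
      | succ k ih =>
        rw [show 2*(k+1)+1 = 2*k+1+1+1 by ring, HH_succ, HH_succ, ih, HH_succ, sum_range_succ _ (k+1)]
        push_cast
        rw [show 2*(k:ℚ_[p])+1+1 = 2*(k+1) by ring, mul_inv, show 2*((k:ℚ_[p])+1)+1 = 2*(k+1)+1 by ring]
        ring
    exact this m
  have e2 : HH p (3*m+2) = HH p (2*m+1) + ∑ t ∈ range (m+1), ((3*m+2:ℚ_[p])-t)⁻¹ := by
    rw [show 3*m+2 = 2*m+1+(m+1) by ring, HH, sum_range_add, ← HH]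
    congr 1
    rw [← sum_range_reflect]
    apply sum_congr rfl
    intro j hj; rw [mem_range] at hj
    rw [Nat.cast_add, cast_refl _ _ hj]; push_cast; congr 1; ring
  have e3 : cg p 1 (∑ t ∈ range (m+1), (2*(t:ℚ_[p])+1)⁻¹) (∑ t ∈ range (m+1), -(1/2)*((3*m+2:ℚ_[p])-t)⁻¹) := by
    apply cg.sum
    intro t ht; rw [mem_range] at ht
    have h1 := un_odd (p := p) (n := 3*m+2) (i := t) (by omega) (by omega)
    have h2 := un_nat' (p := p) (n := 3*m+2-t) (by omega) (by omega)
    rw [Nat.cast_sub (by omega)] at h2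
    push_cast at h2
    refine ⟨(2*(t:ℚ_[p])+1)⁻¹*((3*m+2:ℚ_[p])-t)⁻¹*2⁻¹, mul_mem (mul_mem h1.2.2 h2.2.2) u2.2.2, ?_⟩
    have z1 := h1.1
    have z2 := h2.1
    field_simp
    rw [hpn]; ring
  rw [← mul_sum] at e3
  obtain ⟨c, hc, h⟩ := e3
  refine ⟨-2*c, mul_mem (neg_mem u2.2.1) hc, ?_⟩
  linear_combination -2*h - 2*e1 - e2

theorem VV_cg {m : ℕ} (hm : p = 6*m+5) (hp3 : 3 < p) : cg p 2 (-VV p (3*m+2)) (R3 p : ℚ) := by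
  have u2 := un_two (p := p) hp3
  have u3 := un_three (p := p) hp3
  have hpn : (p:ℚ_[p]) = 6*m+5 := by exact_mod_cast hm
  have h := VV_eq hm hp3
  simp only [Dg_eq u3.1] at h
  have c1 : (-1/3:ℚ_[p]) ∈ Oi p := by rw [neg_div, one_div]; exact neg_mem u3.2.2
  have c2 : (-2/3:ℚ_[p]) ∈ Oi p := by rw [neg_div]; exact neg_mem (u2.div u3).2.1
  have c3 : (1/3:ℚ_[p]) ∈ Oi p := by rw [one_div]; exact u3.2.2
  have a1 := EE_ap c1 (k := 3*m+2) (by omega)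
  have a2 := EE_ap c2 (k := 3*m+2) (by omega)
  have a3 := EE_ap c1 (k := 2*m+2) (by omega)
  have a4 := EE_ap c2 (k := m) (by omega)
  have a5 := EE_ap c1 (k := 2*m+1) (by omega)
  have a6 := EE_ap c3 (k := m) (by omega)
  have aa := (a1.mul a2).div (((a3.mul a4).mul a5).mul a6)
  have hC : ((3*m+2).choose m : ℚ_[p]) = (3*m+2).factorial / (m.factorial * (2*m+2).factorial) := by
    have := Nat.cast_choose ℚ_[p] (show m ≤ 3*m+2 by omega)
    rw [this, show 3*m+2-m = 2*m+2 by omega]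
  have f0 : ((m.factorial:ℕ):ℚ_[p]) ≠ 0 := by exact_mod_cast m.factorial_ne_zero
  have f1 : (((2*m+1).factorial:ℕ):ℚ_[p]) ≠ 0 := by exact_mod_cast (2*m+1).factorial_ne_zero
  have f2 : (((2*m+2).factorial:ℕ):ℚ_[p]) = (2*m+2) * (2*m+1).factorial := by
    rw [Nat.factorial_succ]; push_cast; ring
  have f3 : (2*(m:ℚ_[p])+2) ≠ 0 := by exact_mod_cast Nat.succ_ne_zero (2*m+1)
  have hV : -VV p (3*m+2) = ((3*m+2).choose m : ℚ_[p])^2 * ((1+p) * (EE p (-1/3) (3*m+2) * EE p (-2/3) (3*m+2) / (EE p (-1/3) (2*m+2) * EE p (-2/3) m * EE p (-1/3) (2*m+1) * EE p (1/3) m))) := by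
    have g3 := a3.un.1
    have g4 := a4.un.1
    have g5 := a5.un.1
    have g6 := a6.un.1
    rw [hC, f2]
    rw [f2] at h
    generalize EE p (-1/3) (3*m+2) = E1 at *
    generalize EE p (-2/3) (3*m+2) = E2 at *
    generalize EE p (-1/3) (2*m+2) = E3 at *
    generalize EE p (-2/3) m = E4 at *
    generalize EE p (-1/3) (2*m+1) = E5 at *
    generalize EE p (1/3) m = E6 at *
    generalize ((m.factorial:ℕ):ℚ_[p]) = F0 at *
    generalize (((2*m+1).factorial:ℕ):ℚ_[p]) = F1 at *
    generalize (((3*m+2).factorial:ℕ):ℚ_[p]) = F3 at *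
    have hz : (3:ℚ_[p])^(6*m+3) ≠ 0 := pow_ne_zero _ u3.1
    have h' : -VV p (3*m+2) * ((2*m+2)*F1^2*F0^2*(E3*E4*E5*E6)) = 3*F3^2*(E1*E2) := by
      apply mul_left_cancel₀ hz
      linear_combination h
    have hd : ((2*m+2)*F1^2*F0^2*(E3*E4*E5*E6)) ≠ 0 := by
      exact mul_ne_zero (mul_ne_zero (mul_ne_zero f3 (pow_ne_zero _ f1)) (pow_ne_zero _ f0)) (mul_ne_zero (mul_ne_zero (mul_ne_zero g3 g4) g5) g6)
    apply mul_right_cancel₀ hd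
    rw [h']
    rw [hpn]
    field_simp
    ring
  rw [hV, R3]
  have hd6 : p/6 = m := by omega
  have hd2 : (p-1)/2 = 3*m+2 := by omega
  rw [hd6, hd2]
  push_cast
  rw [mul_comm]
  apply cg.mul_right (pow_mem (natCast_mem _ _) _)
  have b1 : ap p (1+(p:ℚ_[p])) 1 := ⟨one_mem _, cg.of_eq (by ring)⟩
  have bb := b1.mul aa
  have q2 := (HH_half (p := p) (n := 3*m+2) (by omega) hp3).2
  have q3 := (HH_third hm hp3).2
  have s := HH_split hm hp3
  have hs : HH p (2*m+2) = HH p (2*m+1) + 3/(p+1) := by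
    rw [HH, sum_range_succ, ← HH]
    congr 1
    push_cast
    have : (p:ℚ_[p])+1 ≠ 0 := by exact_mod_cast Nat.succ_ne_zero p
    rw [show 2*(m:ℚ_[p])+1+1 = 2*m+2 by ring]
    have e : (p:ℚ_[p])+1 = 3*(2*m+2) := by rw [hpn]; ring
    rw [e]; field_simp
  have up : un p ((p:ℚ_[p])+1) := un.cg (r := 1) (by norm_num) un.one ⟨1, one_mem _, by ring⟩
  have hs2 : cg p 1 (1/((p:ℚ_[p])+1)) 1 := by
    refine ⟨-((p:ℚ_[p])+1)⁻¹, neg_mem up.2.2, ?_⟩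
    have := up.1
    field_simp
    ring
  have key : cg p 1 (2 + (-(2/3) * HH p (3*m+2) + HH p (2*m+1))) (1 + (-1/3*HH p (3*m+2) + -2/3 * HH p (3*m+2) - (-1/3*HH p (2*m+2) + -2/3*HH p m + -1/3*HH p (2*m+1) + 1/3*HH p m))) := by
    rw [hs]
    obtain ⟨c, hc, h1⟩ := s
    obtain ⟨d, hd, h2⟩ := hs2
    refine ⟨-d - 1/3*c, sub_mem (neg_mem hd) (mul_mem c3 hc), ?_⟩
    linear_combination -h2 - 1/3*h1
  have := (bb.congr key).2
  refine this.trans ?_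
  have k1 := (q2.mul_left (c := 4/3) (by exact ((un_four hp3).div u3).2.1)).sub (q3.mul_left (c := 3/2) (u3.div u2).2.1)
  refine cg.symm (cg.trans (cg.of_eq ?_) (((cg.refl (1 + 2*(p:ℚ_[p]) - 4/3 + 3/2)).add k1).trans (cg.of_eq ?_)))
  · ring
  · ring

theorem nmem (n : ℕ) [n.AtLeastTwo] : (OfNat.ofNat n : ℚ_[p]) ∈ Oi p := by
  rw [← Nat.cast_ofNat]; exact natCast_mem _ _

theorem un_nine (hp3 : 3 < p) : un p 9 := by
  have := (un_three hp3).pow 2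
  norm_num at this; exact this

theorem ch3_two' {m : ℕ} (hm : p = 6*m+5) : ch3 p = -1 := by
  unfold ch3; rw [hm]; push_cast
  have : (6*(m:ℤ)+5) % 3 = 2 := by omega
  simp [this]

theorem case_two {m : ℕ} (hm : p = 6*m+5) (hp3 : 3 < p) : 
    cg p 2 (aS p 2 : ℚ_[p]) ((2/9*R3 p + (p:ℚ)/2 : ℚ)) ∧ cg p 2 (aS p 3 : ℚ_[p]) ((-(1/3)*R3 p - (p:ℚ)/3 : ℚ)) := by
  have u2 := un_two (p := p) hp3
  have u3 := un_three (p := p) hp3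
  have u9 := un_nine (p := p) hp3
  have T0 := (T0_cg2 hp3).trans (M0_zero hm hp3)
  have T1 := T1_cg (p := p) hp3
  have hV := V_cg (p := p) (n := 3*m+2) (by omega) hp3
  have hR := VV_cg hm hp3
  have hM := M0_zero hm hp3
  have U0 := (U0_cg (p := p) hp3).mono (show 2 ≤ 3 by norm_num)
  rw [ch3_two' hm] at U0
  have U1 : cg p 2 (18*(2*aS p 3+3*aS p 2+aS p 1)+6*(2*aS p 1+aS p 0) : ℚ_[p]) 0 := by
    have := cg_int_iff (p := p) (r := 3) (a := 18*(2*aS p 3+3*aS p 2+aS p 1)+6*(2*aS p 1+aS p 0)) (b := 0)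
    have := (this.2 (by simpa using U1_cg (p := p))).mono (show 2 ≤ 3 by norm_num)
    push_cast at this; exact this
  push_cast at U0 ⊢
  have e : -∑ k ∈ range p, (2*(k:ℚ_[p])^2+2*k+1)*tK ℚ_[p] k = -(2/9) * (∑ k ∈ range p, (3*(k:ℚ_[p])+1)*(3*k+2) * tK ℚ_[p] k) - 5/9 * M0 p := by
    rw [M0, mul_sum, mul_sum, ← sum_neg_distrib, ← sum_sub_distrib]
    exact sum_congr rfl fun k _ => by ring
  rw [e] at T1
  have m1 : -(2/9:ℚ_[p]) ∈ Oi p := neg_mem (u2.div u9).2.1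
  have m2 : (5/9:ℚ_[p]) ∈ Oi p := mul_mem (nmem 5) u9.2.2
  have m3 : (4/9:ℚ_[p]) ∈ Oi p := ((un_four hp3).div u9).2.1
  have T1' : cg p 2 (2*((aS p 2:ℚ_[p])+aS p 1)) (4/9 * (R3 p:ℚ)) := by
    refine T1.trans ?_
    refine ((hV.symm.mul_left m1).sub (hM.mul_left m2)).trans ?_
    refine (cg.of_eq ?_).trans (hR.mul_left m3)
    ring
  have S2 : cg p 2 (aS p 2 : ℚ_[p]) (2/9*((R3 p:ℚ):ℚ_[p]) + (p:ℚ_[p])/2) := by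
    apply u2.cancel
    refine (cg.of_eq ?_).trans (((T1'.sub U0).add T0).trans (cg.of_eq ?_))
    · ring
    · ring
  refine ⟨S2, ?_⟩
  -- 36 S3 = -54 S2 - 18 S1 - 6 U0, S1 = (U0 - T0)/2
  have u36 : un p 36 := by
    have := (u2.pow 2).mul u9
    norm_num at this; exact this
  apply u36.cancel
  have n54 : (54:ℚ_[p]) ∈ Oi p := nmem 54
  have n15 : (15:ℚ_[p]) ∈ Oi p := nmem 15
  have n9 : (9:ℚ_[p]) ∈ Oi p := u9.2.1
  refine (cg.of_eq ?_).trans ((((U1.sub (S2.mul_left n54)).sub (U0.mul_left n15)).add (T0.mul_left n9)).trans (cg.of_eq ?_))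
  · ring
  · ring

end padicV2

open Finset

section padicW
variable {p : ℕ} [hp : Fact p.Prime]

/-- second-order expansion -/
def s3 (p : ℕ) [Fact p.Prime] (a x y z : ℚ_[p]) : Prop := x ∈ Oi p ∧ y ∈ Oi p ∧ z ∈ Oi p ∧ cg p 3 a (x + p*y + p^2*z)

theorem s3.memr {a x y z : ℚ_[p]} (h : s3 p a x y z) : x + p*y + p^2*z ∈ Oi p := 
  add_mem (add_mem h.1 (mul_mem pmem h.2.1)) (mul_mem (pow_mem pmem _) h.2.2.1)
theorem s3.mem {a x y z : ℚ_[p]} (h : s3 p a x y z) : a ∈ Oi p := h.2.2.2.mem h.memr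

theorem s3.mul {a x y z a' x' y' z' : ℚ_[p]} (h : s3 p a x y z) (h' : s3 p a' x' y' z') :
    s3 p (a*a') (x*x') (x*y'+y*x') (x*z'+y*y'+z*x') := by
  have m1 := h.1
  have m2 := h.2.1
  have m3 := h.2.2.1
  have n1 := h'.1
  have n2 := h'.2.1
  have n3 := h'.2.2.1
  refine ⟨mul_mem m1 n1, add_mem (mul_mem m1 n2) (mul_mem m2 n1), add_mem (add_mem (mul_mem m1 n3) (mul_mem m2 n2)) (mul_mem m3 n1), ?_⟩
  refine (h.2.2.2.mul h.memr h'.mem h'.2.2.2).trans ?_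
  exact ⟨y*z' + z*y' + p*(z*z'), add_mem (add_mem (mul_mem m2 n3) (mul_mem m3 n2)) (mul_mem pmem (mul_mem m3 n3)), by ring⟩

theorem s3.add {a x y z a' x' y' z' : ℚ_[p]} (h : s3 p a x y z) (h' : s3 p a' x' y' z') :
    s3 p (a+a') (x+x') (y+y') (z+z') := 
  ⟨add_mem h.1 h'.1, add_mem h.2.1 h'.2.1, add_mem h.2.2.1 h'.2.2.1, (h.2.2.2.add h'.2.2.2).trans (cg.of_eq (by ring))⟩

theorem s3.smul {a x y z c : ℚ_[p]} (hc : c ∈ Oi p) (h : s3 p a x y z) : s3 p (c*a) (c*x) (c*y) (c*z) :=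
  ⟨mul_mem hc h.1, mul_mem hc h.2.1, mul_mem hc h.2.2.1, (h.2.2.2.mul_left hc).trans (cg.of_eq (by ring))⟩

theorem s3.un {a y z : ℚ_[p]} (h : s3 p a 1 y z) : un p a := 
  un.cg (r := 1) (by norm_num) un.one ((h.2.2.2.mono (by norm_num)).trans ⟨y+p*z, add_mem h.2.1 (mul_mem pmem h.2.2.1), by ring⟩)

theorem s3.inv {a y z : ℚ_[p]} (h : s3 p a 1 y z) : s3 p a⁻¹ 1 (-y) (y^2-z) := by
  have m2 := h.2.1
  have m3 := h.2.2.1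
  have m4 : y^2-z ∈ Oi p := sub_mem (pow_mem m2 _) m3
  refine ⟨one_mem _, neg_mem m2, m4, h.un.cancel ?_⟩
  rw [mul_inv_cancel₀ h.un.1]
  have hm : 1 + (p:ℚ_[p])*-y + p^2*(y^2-z) ∈ Oi p := add_mem (add_mem (one_mem _) (mul_mem pmem (neg_mem m2))) (mul_mem (pow_mem pmem _) m4)
  refine cg.symm ((h.2.2.2.mul_right hm).trans ?_)
  refine ⟨y*(y^2-z) - z*y + p*(z*(y^2-z)), add_mem (sub_mem (mul_mem m2 m4) (mul_mem m3 m2)) (mul_mem pmem (mul_mem m3 m4)), by ring⟩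

theorem s3.eq {a a' x y z x' y' z' : ℚ_[p]} (h : s3 p a x y z) (e : a' = a) (e1 : x' = x) (e2 : y' = y) (e3 : z' = z) : s3 p a' x' y' z' := by
  subst e e1 e2 e3; exact h

theorem EE_s3 (hp3 : 3 < p) {c : ℚ_[p]} (hc : c ∈ Oi p) {k : ℕ} (hk : k < p) : 
    s3 p (EE p c k) 1 (c * HH p k) (c^2*(HH p k^2 - H2 p k)/2) := by
  induction k with
  | zero =>
    simp only [EE, HH, H2, range_zero, prod_empty, sum_empty]
    refine ⟨one_mem _, by simpa using zero_mem _, by simpa using zero_mem _, cg.of_eq (by ring)⟩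
  | succ k ih =>
    have hu := (un_succ (p := p) (k := k) hk)
    have h2 : s3 p (1 + p * (c * ((k:ℚ_[p])+1)⁻¹)) 1 (c*((k:ℚ_[p])+1)⁻¹) 0 := 
      ⟨one_mem _, mul_mem hc hu.2.2, zero_mem _, cg.of_eq (by ring)⟩
    refine ((ih (by omega)).mul h2).eq ?_ (by ring) ?_ ?_
    · rw [EE, prod_range_succ, ← EE]
    · rw [HH_succ]; ring
    · rw [HH_succ, H2, sum_range_succ, ← H2, ← inv_pow]; ring

theorem WW_eq {m : ℕ} (hm : p = 6*m+1) : WW p (3*m) * (Dg p 3 (-1*p) (2*m) * Dg p 3 (-2*p) m * Dg p 3 (-1*p) (2*m) * Dg p 3 (1*p) m) =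
    Dg p 3 (-1*p) (3*m) * Dg p 3 (-2*p) (3*m) := by
  have hpm : (p:ℚ_[p]) = 6*m+1 := by exact_mod_cast hm
  have n1 := Dg_split (p := p) 3 (-1*p) (2*m) m
  rw [show 2*m+m = 3*m by ring] at n1
  have n2 := Dg_split (p := p) 3 (-2*p) m (2*m)
  rw [show m+(2*m) = 3*m by ring] at n2
  rw [← n1, ← n2, WW, prod_div_distrib]
  have sg : (-1:ℚ_[p])^(2*m) = 1 := by rw [pow_mul]; simp
  have e1 : ∏ j ∈ range (3*m), (3*(j:ℚ_[p])+2) = (∏ i ∈ range m, (3*((2*m:ℕ)+i+1)+(-1*(p:ℚ_[p])))) * ∏ i ∈ range (2*m), (3*((m:ℚ_[p])+i+1)+(-2*p)) := by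
    rw [show 3*m = m+2*m by ring, prod_range_add]
    congr 1
    · apply prod_congr rfl; intro j _; rw [hpm]; push_cast; ring
    · rw [← prod_range_reflect, prod_neg_even _ sg]
      apply prod_congr rfl; intro j hj; rw [mem_range] at hj
      rw [Nat.cast_add, cast_refl _ _ hj, hpm]; push_cast; ring
  have e2 : ∏ j ∈ range (3*m), (3*(j:ℚ_[p])+4) = (p * (Dg p 3 (-1*p) (2*m) * Dg p 3 (1*p) m)) := by
    have : ∏ j ∈ range (3*m), (3*(j:ℚ_[p])+4) = ∏ j ∈ range (3*m+1), (3*(j:ℚ_[p])+1) := by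
      rw [prod_range_succ']; push_cast; rw [mul_zero, zero_add, mul_one]
      apply prod_congr rfl; intro j _; ring
    rw [this, show 3*m+1 = (2*m+1)+m by ring, prod_range_add, prod_range_succ]
    have d1 : ∏ j ∈ range (2*m), (3*(j:ℚ_[p])+1) = Dg p 3 (-1*p) (2*m) := by
      rw [← prod_range_reflect, prod_neg_even _ sg, Dg]
      apply prod_congr rfl; intro j hj; rw [mem_range] at hj
      rw [cast_refl _ _ hj, hpm]; push_cast; ring
    have d2 : ∏ j ∈ range m, (3*((2*m+1+j:ℕ):ℚ_[p])+1) = Dg p 3 (1*p) m := by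
      rw [Dg]
      apply prod_congr rfl; intro j hj
      rw [hpm]; push_cast; ring
    rw [d1, d2]
    push_cast; rw [hpm]; ring
  rw [e1, e2]
  have h0 : ∏ j ∈ range (3*m), (3*(j:ℚ_[p])+4) ≠ 0 := by
    rw [prod_ne_zero_iff]; intro j _; exact_mod_cast Nat.succ_ne_zero (3*j+3)
  rw [e2] at h0
  have h1 : Dg p 3 (-1*p) (2*m) ≠ 0 := by intro h; apply h0; rw [h]; ring
  have h2 : Dg p 3 (1*p) m ≠ 0 := by intro h; apply h0; rw [h]; ring
  have h3 := p_ne (p := p)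
  have h4 : (2*((3*m:ℕ):ℚ_[p])+1) = p := by rw [hpm]; push_cast; ring
  rw [h4]
  generalize Dg p 3 (-1*p) (2*m) = D1 at *
  generalize Dg p 3 (1*p) m = D2 at *
  field_simp

theorem choose_3m (m : ℕ) : ((3*m).choose m : ℚ_[p]) = (3*m).factorial / (m.factorial * (2*m).factorial) := by
  have := Nat.cast_choose ℚ_[p] (show m ≤ 3*m by omega)
  rw [this, show 3*m-m = 2*m by omega]

theorem WW_s3 {m : ℕ} (hm : p = 6*m+1) (hp3 : 3 < p) : ∃ w, WW p (3*m) = ((3*m).choose m : ℚ_[p])^2 * w ∧ 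
    s3 p w 1 (-HH p (3*m) + 2/3*HH p (2*m) + 1/3 * HH p m)
      ((-HH p (3*m) + 2/3*HH p (2*m) + 1/3 * HH p m)^2/2 - (5*H2 p (3*m) - 2*H2 p (2*m) - 5*H2 p m)/18) := by
  have u2 := un_two (p := p) hp3
  have u3 := un_three (p := p) hp3
  have h := WW_eq hm
  simp only [Dg_eq u3.1] at h
  have c1 : (-1/3:ℚ_[p]) ∈ Oi p := by rw [neg_div, one_div]; exact neg_mem u3.2.2
  have c2 : (-2/3:ℚ_[p]) ∈ Oi p := by rw [neg_div]; exact neg_mem (u2.div u3).2.1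
  have c3 : (1/3:ℚ_[p]) ∈ Oi p := by rw [one_div]; exact u3.2.2
  have a1 := EE_s3 hp3 c1 (k := 3*m) (by omega)
  have a2 := EE_s3 hp3 c2 (k := 3*m) (by omega)
  have a3 := EE_s3 hp3 c1 (k := 2*m) (by omega)
  have a4 := EE_s3 hp3 c2 (k := m) (by omega)
  have a6 := EE_s3 hp3 c3 (k := m) (by omega)
  have aa := ((((a1.mul a2).mul a3.inv).mul a4.inv).mul a3.inv).mul a6.inv
  refine ⟨_, ?_, aa.eq rfl (by ring) (by ring) (by ring)⟩
  have f0 : ((m.factorial:ℕ):ℚ_[p]) ≠ 0 := by exact_mod_cast m.factorial_ne_zero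
  have f1 : (((2*m).factorial:ℕ):ℚ_[p]) ≠ 0 := by exact_mod_cast (2*m).factorial_ne_zero
  have g3 := a3.un.1
  have g4 := a4.un.1
  have g6 := a6.un.1
  rw [choose_3m]
  clear aa
  generalize EE p (-1/3) (3*m) = E1 at *
  generalize EE p (-2/3) (3*m) = E2 at *
  generalize EE p (-1/3) (2*m) = E3 at *
  generalize EE p (-2/3) m = E4 at *
  generalize EE p (1/3) m = E6 at *
  generalize ((m.factorial:ℕ):ℚ_[p]) = F0 at *
  generalize (((2*m).factorial:ℕ):ℚ_[p]) = F1 at *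
  generalize (((3*m).factorial:ℕ):ℚ_[p]) = F3 at *
  have hz : (3:ℚ_[p])^(6*m) ≠ 0 := pow_ne_zero _ u3.1
  have h' : WW p (3*m) * (F1^2*F0^2*(E3*E4*E3*E6)) = F3^2*(E1*E2) := by
    apply mul_left_cancel₀ hz
    linear_combination h
  have hd : F1^2*F0^2*(E3*E4*E3*E6) ≠ 0 := 
    mul_ne_zero (mul_ne_zero (pow_ne_zero _ f1) (pow_ne_zero _ f0)) (mul_ne_zero (mul_ne_zero (mul_ne_zero g3 g4) g3) g6)
  apply mul_right_cancel₀ hd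
  rw [h']
  field_simp

theorem fact_shift (s k : ℕ) : (((s*p+k).factorial:ℕ):ℚ_[p]) = ((s*p).factorial:ℕ) * (k.factorial:ℕ) * EE p s k := by
  induction k with
  | zero => simp [EE]
  | succ k ih =>
    rw [← add_assoc, Nat.factorial_succ, Nat.factorial_succ, EE, prod_range_succ, ← EE]
    push_cast
    rw [ih]
    have : ((k:ℚ_[p])+1) ≠ 0 := by exact_mod_cast Nat.succ_ne_zero k
    field_simp
    ring

end padicW

open Finset

section padicH
variable {p : ℕ} [hp : Fact p.Prime]

theorem H2_add (a b : ℕ) : H2 p (a+b) = H2 p a + ∑ i ∈ range b, (((a:ℚ_[p])+i+1)^2)⁻¹ := by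
  rw [H2, sum_range_add, ← H2]; congr 1
  apply sum_congr rfl; intro i _; push_cast; ring

theorem H2_even (k : ℕ) : H2 p (2*k) = 1/4 * H2 p k + OO p k := by
  induction k with
  | zero => simp [H2, OO]
  | succ k ih =>
    rw [show 2*(k+1) = 2*k+1+1 by ring]
    simp only [H2, OO, sum_range_succ] at ih ⊢
    rw [ih]
    push_cast
    have : ((2*(k:ℚ_[p])+1+1)^2)⁻¹ = 1/4*(((k:ℚ_[p])+1)^2)⁻¹ := by
      rw [show 2*(k:ℚ_[p])+1+1 = 2*(k+1) by ring, mul_pow, mul_inv]; norm_num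
    rw [this]; ring

theorem inv_sq_cg {a b : ℚ_[p]} (ha : un p a) (hb : un p b) (h : cg p 1 a (-b)) : cg p 1 ((a^2)⁻¹) ((b^2)⁻¹) := by
  refine un.inv_cg (ha.pow 2) (hb.pow 2) ?_
  refine (h.pow hb.neg.2.1 2).trans (cg.of_eq (by ring))

theorem H2_tail {n : ℕ} {k : ℕ} (hk : k ≤ n) : ∑ i ∈ range k, (((n:ℚ_[p])-i)^2)⁻¹ = H2 p n - H2 p (n-k) := by
  have h := H2_add (p := p) (n-k) k
  rw [Nat.sub_add_cancel hk] at h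
  rw [h, add_sub_cancel_left, ← sum_range_reflect]
  apply sum_congr rfl; intro i hi; rw [mem_range] at hi
  rw [cast_refl _ _ hi, Nat.cast_sub hk]; congr 2; ring

theorem un_sub {n i : ℕ} (h : i < n) (hn : n < p) : un p ((n:ℚ_[p]) - i) := by
  have := un_nat' (p := p) (n := n-i) (by omega) (by omega)
  rwa [Nat.cast_sub h.le] at this

theorem OO_cg {n k : ℕ} (hn : p = 2*n+1) (hp3 : 3 < p) (hk : k ≤ n) : cg p 1 (OO p k) (1/4*(H2 p n - H2 p (n-k))) := by
  rw [← H2_tail hk, OO, mul_sum]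
  apply cg.sum; intro i hi; rw [mem_range] at hi
  have h1 := un_odd (p := p) hn (show i < n by omega)
  have h2 := un_sub (p := p) (show i < n by omega) (by omega)
  refine (inv_sq_cg h1 ((un_two hp3).mul h2) ⟨1, one_mem _, ?_⟩).trans (cg.of_eq ?_)
  · have : (p:ℚ_[p]) = 2*n+1 := by exact_mod_cast hn
    rw [this]; ring
  · rw [mul_pow, mul_inv]; norm_num

theorem H2_full {n : ℕ} (hn : p = 2*n+1) : cg p 1 (H2 p (2*n)) (2*H2 p n) := by
  rw [two_mul n, H2_add, two_mul]
  refine (cg.refl _).add ?_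
  have := H2_tail (p := p) (le_refl n)
  rw [Nat.sub_self] at this
  have h0 : H2 p 0 = 0 := by simp [H2]
  rw [h0, sub_zero] at this
  rw [← this]
  apply cg.sum; intro i hi; rw [mem_range] at hi
  refine inv_sq_cg ?_ (un_sub hi (by omega)) ⟨1, one_mem _, ?_⟩
  · have := un_nat' (p := p) (n := n+i+1) (by omega) (by omega)
    push_cast at this; exact this
  · have : (p:ℚ_[p]) = 2*n+1 := by exact_mod_cast hn
    rw [this]; ring

theorem q4 (hp3 : 3 < p) : (1/4:ℚ_[p]) ∈ Oi p := by
  have := ((un_two (p := p) hp3).mul (un_two hp3)).2.2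
  norm_num at this ⊢; exact this

theorem H2_half {n : ℕ} (hn : p = 2*n+1) (hp3 : 3 < p) : cg p 1 (H2 p n) 0 := by
  have h1 := H2_full (p := p) hn
  have h2 := OO_cg (p := p) hn hp3 (le_refl n)
  have h3 := H2_even (p := p) n
  have h0 : H2 p 0 = 0 := by simp [H2]
  rw [Nat.sub_self, h0, sub_zero] at h2
  have h4 := h1.symm.trans ((cg.of_eq h3).trans ((cg.refl (1/4*H2 p n)).add h2))
  have h5 := ((h4.sub (cg.refl (1/2*H2 p n))).mul_left (nmem 2))
  exact (un_three hp3).cancel ((cg.of_eq (by ring)).trans (h5.trans (cg.of_eq (by ring))))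

theorem H2_m {m : ℕ} (hm : p = 6*m+1) (hp3 : 3 < p) : cg p 1 (H2 p m) (5*H2 p (2*m)) := by
  have hn : p = 2*(3*m)+1 := by omega
  have h1 := H2_half (p := p) hn hp3
  have h2 := OO_cg (p := p) hn hp3 (show m ≤ 3*m by omega)
  have h3 := H2_even (p := p) m
  rw [show 3*m-m = 2*m by omega] at h2
  have h4 := (cg.of_eq h3).trans ((cg.refl (1/4*H2 p m)).add (h2.trans (((h1.sub (cg.refl (H2 p (2*m)))).mul_left (q4 hp3)))))
  have h5 := (h4.mul_left (nmem 4)).add (cg.refl (H2 p (2*m)))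
  exact (cg.of_eq (by ring)).trans (h5.symm.trans (cg.of_eq (by ring)))

theorem HH_full {n : ℕ} (hn : p = 2*n+1) (hp3 : 3 < p) : cg p 2 (HH p (2*n)) 0 := by
  have e : HH p (2*n) = ∑ i ∈ range (2*n), ((p:ℚ_[p]) - (i+1))⁻¹ := by
    rw [HH, ← sum_range_reflect]
    apply sum_congr rfl; intro i hi; rw [mem_range] at hi
    have : (p:ℚ_[p]) = 2*n+1 := by exact_mod_cast hn
    rw [cast_refl _ _ hi, this]; push_cast; congr 1; ring
  have u : ∀ i ∈ range (2*n), un p ((i:ℚ_[p])+1) ∧ un p ((p:ℚ_[p]) - (i+1)) := by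
    intro i hi; rw [mem_range] at hi
    refine ⟨un_succ (by omega), ?_⟩
    have := un_nat' (p := p) (n := p-(i+1)) (by omega) (by omega)
    rw [Nat.cast_sub (by omega)] at this; push_cast at this; exact this
  have e2 : 2 * HH p (2*n) = p^1 * ∑ i ∈ range (2*n), (((i:ℚ_[p])+1)*((p:ℚ_[p]) - (i+1)))⁻¹ := by
    rw [two_mul]; nth_rw 2 [e]; rw [HH, ← sum_add_distrib, mul_sum]
    apply sum_congr rfl; intro i hi
    have a := (u i hi).1.1
    have b := (u i hi).2.1
    field_simp; ring
  have h : cg p 1 (∑ i ∈ range (2*n), (((i:ℚ_[p])+1)*((p:ℚ_[p]) - (i+1)))⁻¹) (-(2*0)) := by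
    refine cg.trans ?_ ((H2_full hn).trans ((H2_half hn hp3).mul_left (nmem 2))).neg
    rw [H2, ← sum_neg_distrib]
    apply cg.sum; intro i hi
    have a := (u i hi).1
    have b := (u i hi).2
    rw [← inv_neg]
    refine un.inv_cg (a.mul b) (a.pow 2).neg ⟨(i:ℚ_[p])+1, a.2.1, by ring⟩
  refine (un_two hp3).cancel ?_
  rw [e2]
  refine (h.pmul 1).trans (cg.of_eq (by ring))

theorem C2p {n : ℕ} (hn : p = 2*n+1) (hp3 : 3 < p) : cg p 3 (((2*p).choose p : ℕ) : ℚ_[p]) 2 := by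
  have h := EE_s3 (p := p) hp3 (one_mem _) (k := 2*n) (by omega)
  have e : (((2*p).choose p : ℕ) : ℚ_[p]) = 2 * EE p 1 (2*n) := by
    have h1 := fact_shift (p := p) 1 (2*n)
    rw [Nat.cast_choose ℚ_[p] (show p ≤ 2*p by omega), show 2*p-p = p by omega]
    have h2 : (2*p).factorial = (2*p) * (1*p+2*n).factorial := by
      rw [show 2*p = (1*p+2*n)+1 by omega, Nat.factorial_succ]
    have h3 : p.factorial = p * (2*n).factorial := by
      nth_rw 1 [hn]; rw [Nat.factorial_succ, ← hn]
    rw [h2, Nat.cast_mul, h1, one_mul]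
    have : ((p.factorial:ℕ):ℚ_[p]) = p * ((2*n).factorial:ℕ) := by exact_mod_cast h3
    rw [this]
    have f0 : (((2*n).factorial:ℕ):ℚ_[p]) ≠ 0 := by exact_mod_cast (2*n).factorial_ne_zero
    have := p_ne (p := p)
    push_cast
    field_simp
  have hH := HH_full hn hp3
  have hh2 := (H2_full hn).trans ((H2_half hn hp3).mul_left (nmem 2))
  rw [e]
  have q2 : (1/2:ℚ_[p]) ∈ Oi p := by rw [one_div]; exact (un_two hp3).2.2
  have k1 := hH.pmul 1
  have k2 := (((hH.mono (by norm_num)).pow (r := 1) (zero_mem _) 2).sub hh2).mul_left q2 |>.pmul 2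
  have k3 := h.2.2.2.trans (((cg.refl 1).add (((cg.of_eq (by ring)).trans k1))).add ((cg.of_eq (by ring)).trans k2))
  exact (k3.mul_left (nmem 2)).trans (cg.of_eq (by ring))

end padicH

open Finset

section padicB
variable {p : ℕ} [hp : Fact p.Prime]

theorem fact_pred {N s k : ℕ} (h : N + 1 = s*p+k) : ((N.factorial:ℕ):ℚ_[p]) = ((s*p).factorial:ℕ) * (k.factorial:ℕ) * EE p s k / (N+1) := by
  rw [← fact_shift, ← h, Nat.factorial_succ]
  have : ((N:ℚ_[p])+1) ≠ 0 := by exact_mod_cast Nat.succ_ne_zero N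
  push_cast; field_simp

theorem fact_pred2 {N s k : ℕ} (h : N + 2 = s*p+k) : ((N.factorial:ℕ):ℚ_[p]) = ((s*p).factorial:ℕ) * (k.factorial:ℕ) * EE p s k / ((N+1)*(N+2)) := by
  have h1 := fact_pred (p := p) (N := N+1) (s := s) (k := k) (by omega)
  rw [Nat.factorial_succ] at h1
  have : ((N:ℚ_[p])+1) ≠ 0 := by exact_mod_cast Nat.succ_ne_zero N
  have h3 : ((N:ℚ_[p])+2) ≠ 0 := by exact_mod_cast Nat.succ_ne_zero (N+1)
  push_cast at h1
  rw [show (N:ℚ_[p])+1+1 = N+2 by ring] at h1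
  field_simp at h1 ⊢
  linear_combination h1

theorem s3_lin {a c : ℚ_[p]} (ha : a ∈ Oi p) (hc : c ∈ Oi p) : s3 p (a + c * p) a c 0 := 
  ⟨ha, hc, zero_mem _, cg.of_eq (by ring)⟩

theorem lin_ne {a c : ℤ} (ha : ¬ (p:ℤ) ∣ a) : (a:ℚ_[p]) + c * p ≠ 0 := by
  intro h
  have : a + c * p = 0 := by exact_mod_cast h
  exact ha ⟨-c, by linear_combination this⟩

theorem binoms {m : ℕ} (hm : p = 6*m+1) (hp3 : 3 < p) :
    ((9*m).choose (2*m) : ℚ_[p]) = (3*m).choose m * (EE p 1 (3*m) * (EE p 1 m)⁻¹ * (1/3 * (1+(-7)*(p:ℚ_[p])) * (1+(-3)*(p:ℚ_[p]))⁻¹)) ∧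
    ((9*m).choose m : ℚ_[p]) = (3*m).choose m * (EE p 1 (3*m) * (EE p 1 (2*m))⁻¹ * (2/3 * (1+(-4)*(p:ℚ_[p])) * (1+(-3)*(p:ℚ_[p]))⁻¹)) ∧
    ((15*m).choose (2*m) : ℚ_[p]) = (3*m).choose m * (EE p 2 (3*m) * (EE p 2 m)⁻¹ * (1/27 * (1+(-13)*(p:ℚ_[p])) * (7+(-13)*(p:ℚ_[p])) * ((1+(-5)*(p:ℚ_[p]))⁻¹ * (1+(-5/3)*(p:ℚ_[p]))⁻¹))) ∧
    ((15*m).choose m : ℚ_[p]) = (3*m).choose m * (EE p 2 (3*m) * (EE p 2 (2*m))⁻¹ * (4/27 * (1+(-7)*(p:ℚ_[p])) * (4+(-7)*(p:ℚ_[p])) * ((1+(-5)*(p:ℚ_[p]))⁻¹ * (1+(-5/3)*(p:ℚ_[p]))⁻¹))) ∧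
    ((15*m).choose (7*m) : ℚ_[p]) = (3*m).choose m * (EE p 2 (3*m) * ((EE p 1 m)⁻¹ * (EE p 1 (2*m))⁻¹) * (((2*p).choose p : ℕ) * (1/27 * (1+(-7)*(p:ℚ_[p])) * (2+(-8)*(p:ℚ_[p]))) * ((1+(-5)*(p:ℚ_[p]))⁻¹ * (1+(-5/3)*(p:ℚ_[p]))⁻¹))) := by
  have hpm : (p:ℚ_[p]) = 6*m+1 := by exact_mod_cast hm
  have f9 := fact_pred (p := p) (N := 9*m) (s := 1) (k := 3*m) (by omega)
  have f7 := fact_pred (p := p) (N := 7*m) (s := 1) (k := m) (by omega)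
  have f8 := fact_pred (p := p) (N := 8*m) (s := 1) (k := 2*m) (by omega)
  have f15 := fact_pred2 (p := p) (N := 15*m) (s := 2) (k := 3*m) (by omega)
  have f13 := fact_pred2 (p := p) (N := 13*m) (s := 2) (k := m) (by omega)
  have f14 := fact_pred2 (p := p) (N := 14*m) (s := 2) (k := 2*m) (by omega)
  have w1 := (EE_s3 (p := p) hp3 (one_mem _) (k := m) (by omega)).un.1
  have w2 := (EE_s3 (p := p) hp3 (one_mem _) (k := 2*m) (by omega)).un.1
  have w4 := (EE_s3 (p := p) hp3 (nmem 2) (k := m) (by omega)).un.1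
  have w5 := (EE_s3 (p := p) hp3 (nmem 2) (k := 2*m) (by omega)).un.1
  have g1 : ((m.factorial:ℕ):ℚ_[p]) ≠ 0 := by exact_mod_cast m.factorial_ne_zero
  have g2 : (((2*m).factorial:ℕ):ℚ_[p]) ≠ 0 := by exact_mod_cast (2*m).factorial_ne_zero
  have gp : ((p.factorial:ℕ):ℚ_[p]) ≠ 0 := by exact_mod_cast p.factorial_ne_zero
  have g2p : (((2*p).factorial:ℕ):ℚ_[p]) ≠ 0 := by exact_mod_cast (2*p).factorial_ne_zero
  have hc := Nat.cast_choose ℚ_[p] (show p ≤ 2*p by omega)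
  rw [show 2*p-p = p by omega] at hc
  have np : ∀ a b : ℕ, ((a:ℚ_[p])*m+(b+1:ℕ)) ≠ 0 := fun a b => by exact_mod_cast Nat.succ_ne_zero (a*m+b)
  have n3 := np 9 0
  have n7 := np 7 0
  have n8 := np 8 0
  have n51 := np 15 0
  have n52 := np 15 1
  have n131 := np 13 0
  have n132 := np 13 1
  have n141 := np 14 0
  have n142 := np 14 1
  norm_num at n3 n7 n8 n51 n52 n131 n132 n141 n142
  have k1 : (1+(-3)*(p:ℚ_[p])) = -2*(9*m+1) := by rw [hpm]; ring
  have k2 : (1+(-5)*(p:ℚ_[p])) = -2*(15*m+2) := by rw [hpm]; ring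
  have k3 : (1+(-5/3)*(p:ℚ_[p])) = -2/3*(15*m+1) := by rw [hpm]; ring
  have k4 : (1+(-7)*(p:ℚ_[p])) = -6*(7*m+1) := by rw [hpm]; ring
  have k5 : (1+(-4)*(p:ℚ_[p])) = -3*(8*m+1) := by rw [hpm]; ring
  have k6 : (1+(-13)*(p:ℚ_[p])) = -6*(13*m+2) := by rw [hpm]; ring
  have k7 : (7+(-13)*(p:ℚ_[p])) = -6*(13*m+1) := by rw [hpm]; ring
  have k8 : (4+(-7)*(p:ℚ_[p])) = -3*(14*m+1) := by rw [hpm]; ring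
  have k10 : (2+(-8)*(p:ℚ_[p])) = -6*(8*m+1) := by rw [hpm]; ring
  have n42' : (1+(-7)*(p:ℚ_[p])) = -3*(14*m+2) := by rw [hpm]; ring
  push_cast at f9 f7 f8 f15 f13 f14
  rw [one_mul] at f9 f7 f8
  rw [k1, k2, k3, k5, k6, k7, k8, k10, choose_3m, hc]
  refine ⟨?_, ?_, ?_, ?_, ?_⟩
  · rw [Nat.cast_choose ℚ_[p] (show 2*m ≤ 9*m by omega), show 9*m-2*m = 7*m by omega, f9, f7, k4]
    field_simp
    ring
  · rw [Nat.cast_choose ℚ_[p] (show m ≤ 9*m by omega), show 9*m-m = 8*m by omega, f9, f8]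
    field_simp
  · rw [Nat.cast_choose ℚ_[p] (show 2*m ≤ 15*m by omega), show 15*m-2*m = 13*m by omega, f15, f13]
    field_simp
    ring
  · rw [Nat.cast_choose ℚ_[p] (show m ≤ 15*m by omega), show 15*m-m = 14*m by omega, f15, f14, n42']
    field_simp
    ring
  · rw [Nat.cast_choose ℚ_[p] (show 7*m ≤ 15*m by omega), show 15*m-7*m = 8*m by omega, f15, f7, f8, k4]
    field_simp
    ring

theorem un_8 (hp3 : 3 < p) : un p (8:ℚ_[p]) := by
  have := (un_two (p := p) hp3).pow 3
  norm_num at this; exact this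

theorem Q_s3 {m : ℕ} (hm : p = 6*m+1) (hp3 : 3 < p) : ∃ q, 
    ((p:ℚ_[p])-1) * (15 * ((3*m).choose m : ℚ_[p]) - 10 * (((9*m).choose (2*m) : ℚ_[p]) + (9*m).choose m) + 3 * (((15*m).choose (2*m) : ℚ_[p]) + (15*m).choose (7*m) + (15*m).choose m)) = 8 * (((3*m).choose m : ℚ_[p]) * q) ∧
    s3 p q (-1) (-(1/2*(-HH p (3*m) + 2/3*HH p (2*m) + 1/3 * HH p m)))
     (-(1/8*(-HH p (3*m) + 2/3*HH p (2*m) + 1/3 * HH p m)^2 + (-H2 p (3*m) + H2 p m/9 + 4*H2 p (2*m)/9)/8)) := by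
  have u2 := un_two (p := p) hp3
  have u3 := un_three (p := p) hp3
  have o1 : (1:ℚ_[p]) ∈ Oi p := one_mem _
  have n_2 : (2:ℚ_[p]) ∈ Oi p := nmem 2
  have n_3 : (3:ℚ_[p]) ∈ Oi p := nmem 3
  have n_4 : (4:ℚ_[p]) ∈ Oi p := nmem 4
  have n_5 : (5:ℚ_[p]) ∈ Oi p := nmem 5
  have n_7 : (7:ℚ_[p]) ∈ Oi p := nmem 7
  have n_8 : (8:ℚ_[p]) ∈ Oi p := nmem 8
  have n_10 : (10:ℚ_[p]) ∈ Oi p := nmem 10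
  have n_13 : (13:ℚ_[p]) ∈ Oi p := nmem 13
  have n_15 : (15:ℚ_[p]) ∈ Oi p := nmem 15
  have i8 : (1/8:ℚ_[p]) ∈ Oi p := by rw [one_div]; exact (un_8 hp3).2.2
  have i3 : (1/3:ℚ_[p]) ∈ Oi p := by rw [one_div]; exact u3.2.2
  have i27 : (1/27:ℚ_[p]) ∈ Oi p := by have := pow_mem i3 3; norm_num at this ⊢; exact this
  have i23 : (2/3:ℚ_[p]) ∈ Oi p := by have := mul_mem n_2 i3; convert this using 1; ring
  have i427 : (4/27:ℚ_[p]) ∈ Oi p := by have := mul_mem n_4 i27; convert this using 1; ring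
  have a1 := (EE_s3 (p := p) hp3 o1 (k := m) (by omega)).inv
  have b1 := (EE_s3 (p := p) hp3 o1 (k := 2*m) (by omega)).inv
  have c1 := (EE_s3 (p := p) hp3 o1 (k := 3*m) (by omega))
  have a2 := (EE_s3 (p := p) hp3 n_2 (k := m) (by omega)).inv
  have b2 := (EE_s3 (p := p) hp3 n_2 (k := 2*m) (by omega)).inv
  have c2 := (EE_s3 (p := p) hp3 n_2 (k := 3*m) (by omega))
  have l3 := (s3_lin (p := p) o1 (neg_mem n_3)).inv
  have l5 := (s3_lin (p := p) o1 (neg_mem n_5)).inv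
  have l53 := (s3_lin (p := p) (c := -5/3) o1 (by have := mul_mem (neg_mem n_5) i3; convert this using 1; ring)).inv
  have l7 := (s3_lin (p := p) o1 (neg_mem n_7))
  have l4 := (s3_lin (p := p) o1 (neg_mem n_4))
  have l13 := (s3_lin (p := p) o1 (neg_mem n_13))
  have l713 := (s3_lin (p := p) n_7 (neg_mem n_13))
  have l47 := (s3_lin (p := p) n_4 (neg_mem n_7))
  have l28 := (s3_lin (p := p) n_2 (neg_mem n_8))
  have ld := l5.mul l53
  have lc : s3 p (((2*p).choose p : ℕ) : ℚ_[p]) 2 0 0 := ⟨n_2, zero_mem _, zero_mem _, (C2p (p := p) (n := 3*m) (by omega) hp3).trans (cg.of_eq (by ring))⟩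
  have lp : s3 p ((p:ℚ_[p])-1) (-1) 1 0 := ⟨neg_mem o1, o1, zero_mem _, cg.of_eq (by ring)⟩
  obtain ⟨e1, e2, e3, e4, e5⟩ := binoms hm hp3
  have t1 := (c1.mul a1).mul ((l7.smul i3).mul l3)
  have t2 := (c1.mul b1).mul ((l4.smul i23).mul l3)
  have t3 := (c2.mul a2).mul (((l13.smul i27).mul l713).mul ld)
  have t4 := (c2.mul b2).mul (((l7.smul i427).mul l47).mul ld)
  have t5 := (c2.mul (a1.mul b1)).mul ((lc.mul ((l7.smul i27).mul l28)).mul ld)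
  have t0 : s3 p 15 15 0 0 := ⟨n_15, zero_mem _, zero_mem _, cg.of_eq (by ring)⟩
  have tt := (lp.mul ((t0.add ((t1.add t2).smul (neg_mem n_10))).add (((t3.add t5).add t4).smul n_3))).smul i8
  rw [e1, e2, e3, e4, e5]
  refine ⟨_, ?_, tt.eq rfl (by ring) (by ring) (by ring)⟩
  clear tt t0 t1 t2 t3 t4 t5
  generalize EE p 1 (3*m) = z1
  generalize EE p 2 (3*m) = z2
  generalize (EE p 1 (2*m))⁻¹ = z3
  generalize (EE p 2 (2*m))⁻¹ = z4
  generalize (EE p 1 (m))⁻¹ = z5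
  generalize (EE p 2 (m))⁻¹ = z6
  ring

theorem un_choose {m : ℕ} (hm : p = 6*m+1) : un p ((3*m).choose m : ℚ_[p]) := by
  rw [choose_3m]
  exact (un_fact (by omega)).div ((un_fact (by omega)).mul (un_fact (by omega)))

/-- if `J` satisfies the congruence coming from the Gauss sum expansion then `J^2 ≡ T_0`. -/
theorem J_sq {m : ℕ} (hm : p = 6*m+1) (hp3 : 3 < p) {J : ℚ_[p]} 
    (hJ : cg p 3 (8*J) (((p:ℚ_[p])-1) * (15 * ((3*m).choose m : ℚ_[p]) - 10 * (((9*m).choose (2*m) : ℚ_[p]) + (9*m).choose m) + 3 * (((15*m).choose (2*m) : ℚ_[p]) + (15*m).choose (7*m) + (15*m).choose m)))) :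
    un p J ∧ cg p 3 (aS p 0 : ℚ_[p]) (J^2) := by
  obtain ⟨q, e, hq⟩ := Q_s3 hm hp3
  rw [e] at hJ
  have hJ1 := (un_8 hp3).cancel hJ
  have uC := un_choose (p := p) hm
  have uq : un p q := by
    have := (hq.smul (neg_mem (one_mem _))).eq rfl (show (1:ℚ_[p]) = _ by ring) rfl rfl
    have := this.un.neg
    convert this using 1; ring
  have uJ : un p J := un.cg (by norm_num) (uC.mul uq) hJ1
  obtain ⟨w, hw, hws⟩ := WW_s3 hm hp3
  have h2 := M0_cg hm hp3
  have hH := H2_half (p := p) (n := 3*m) (by omega) hp3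
  have mH := H2_mem (p := p) (k := m) (by omega)
  have hz : s3 p (4 + p^2 * H2 p m) 4 0 (H2 p m) := ⟨nmem 4, zero_mem _, mH, cg.of_eq (by ring)⟩
  have hqq := (hq.mul hq).mul hz
  have i9 : (-1/9:ℚ_[p]) ∈ Oi p := by have := neg_mem (un_nine (p := p) hp3).2.2; convert this using 1; ring
  have key : cg p 3 (4*w) (q*q*(4 + p^2 * H2 p m)) := by
    refine ((hws.2.2.2.mul_left (nmem 4)).trans ?_).trans hqq.2.2.2.symm
    obtain ⟨c, hc, hce⟩ := hH
    refine ⟨-1/9*c, mul_mem i9 hc, ?_⟩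
    linear_combination (-1/9*(p:ℚ_[p])^2)*hce
  have u4 : un p (4 + p^2 * H2 p m) := un.cg (r := 2) (by norm_num) (un_four hp3) ⟨H2 p m, mH, by ring⟩
  have hM : cg p 3 (M0 p) (J^2) := by
    refine u4.cancel ?_
    have mM := u4.2.1
    have k1 : cg p 3 (J^2*(4 + p^2 * H2 p m)) (((3*m).choose m * q)^2*(4 + p^2 * H2 p m)) := (hJ1.pow (uC.mul uq).2.1 2).mul_right mM
    have k2 := key.mul_left (uC.pow 2).2.1
    rw [hw] at h2
    refine (cg.of_eq (by ring)).trans (h2.symm.trans (((cg.of_eq (by ring)).trans k2).trans ?_))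
    exact ((cg.of_eq (by ring)).trans k1.symm).trans (cg.of_eq (by ring))
  refine ⟨uJ, (T0_cg3 hp3 ?_).trans hM⟩
  intro h0
  have h1 : cg p 1 0 (J^2) := h0.symm.trans (hM.mono (by norm_num))
  exact (un.cg (r := 1) (by norm_num) (uJ.pow 2) h1).1 rfl
end padicB

open Finset

section teich
variable {p : ℕ} [hp : Fact p.Prime]

theorem zmod_norm (z : ℤ_[p]) : PadicInt.toZMod z = 0 ↔ ‖z‖ < 1 := by
  rw [← RingHom.mem_ker, PadicInt.ker_toZMod, IsLocalRing.mem_maximalIdeal, PadicInt.mem_nonunits]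

theorem teich_exists (u : ZMod p) : ∃ z : ℤ_[p], z^p = z ∧ PadicInt.toZMod z = u := by
  obtain ⟨a, ha⟩ := ZMod.ringHom_surjective (PadicInt.toZMod (p := p)) u
  let F : Polynomial ℤ_[p] := Polynomial.X^p - Polynomial.X
  have e1 : Polynomial.aeval a F = a^p - a := by simp [F]
  have e2 : Polynomial.aeval a F.derivative = p * a^(p-1) - 1 := by simp [F, Polynomial.derivative_X_pow]
  have n1 : ‖a^p - a‖ < 1 := by
    rw [← zmod_norm, map_sub, map_pow, ZMod.pow_card, sub_self]
  have n2 : ‖(p:ℤ_[p]) * a^(p-1) - 1‖ = 1 := by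
    by_contra h
    have : ‖(p:ℤ_[p]) * a^(p-1) - 1‖ < 1 := lt_of_le_of_ne (PadicInt.norm_le_one _) h
    rw [← zmod_norm, map_sub, map_mul, map_natCast, ZMod.natCast_self, zero_mul, map_one, zero_sub, neg_eq_zero] at this
    exact one_ne_zero this
  obtain ⟨z, hz, hza, -, -⟩ := hensels_lemma (F := F) (a := a) (by rw [e1, e2, n2]; simpa using n1)
  refine ⟨z, ?_, ?_⟩
  · have : Polynomial.aeval z F = z^p - z := by simp [F]
    rw [this] at hz; exact sub_eq_zero.1 hz
  · rw [e2, n2, ← zmod_norm, map_sub, sub_eq_zero] at hza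
    rw [hza, ha]

theorem teich_unique {z w : ℤ_[p]} (hz : z^p = z) (hw : w^p = w) (h : PadicInt.toZMod z = PadicInt.toZMod w) : z = w := by
  have hs := (Commute.all z w).geom_sum₂_mul p
  rw [hz, hw] at hs
  set S := ∑ i ∈ range p, z^i * w^(p-1-i) with hS
  have h0 : PadicInt.toZMod S = 0 := by
    rw [hS, map_sum]
    have : ∀ i ∈ range p, PadicInt.toZMod (z^i * w^(p-1-i)) = (PadicInt.toZMod w)^(p-1) := by
      intro i hi; rw [mem_range] at hi
      rw [map_mul, map_pow, map_pow, h, ← pow_add]; congr 1; omega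
    rw [sum_congr rfl this, sum_const, card_range, nsmul_eq_mul, ZMod.natCast_self, zero_mul]
  have h1 : (S - 1) * (z - w) = 0 := by linear_combination hs
  rcases mul_eq_zero.1 h1 with h2 | h2
  · rw [sub_eq_zero.1 h2, map_one] at h0
    exact absurd h0 one_ne_zero
  · exact sub_eq_zero.1 h2

theorem teich_char (p : ℕ) [hp : Fact p.Prime] : ∃ χ : MulChar (ZMod p) ℚ_[p], ∀ u, ∃ z : ℤ_[p], (z:ℚ_[p]) = χ u ∧ PadicInt.toZMod z = u := by
  choose t ht1 ht2 using teich_exists (p := p)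
  have t1 : t 1 = 1 := teich_unique (ht1 1) (one_pow _) (by rw [ht2, map_one])
  have t0 : t 0 = 0 := teich_unique (ht1 0) (zero_pow hp.out.ne_zero) (by rw [ht2, map_zero])
  have tm : ∀ a b, t (a*b) = t a * t b := fun a b => 
    teich_unique (ht1 _) (by rw [mul_pow, ht1, ht1]) (by rw [map_mul, ht2, ht2, ht2])
  refine ⟨{ toFun := fun u => (t u : ℚ_[p]), map_one' := by simp [t1], map_mul' := fun a b => by simp [tm], 
            map_nonunit' := fun a ha => ?_ }, fun u => ⟨t u, rfl, ht2 u⟩⟩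
  have : a = 0 := by simpa using ha
  subst this; simp [t0]

/-- `χ` is the Teichmüller character. -/
def isT (p : ℕ) [Fact p.Prime] (χ : MulChar (ZMod p) ℚ_[p]) : Prop := ∀ u, ∃ z : ℤ_[p], (z:ℚ_[p]) = χ u ∧ PadicInt.toZMod z = u

variable {χ : MulChar (ZMod p) ℚ_[p]} 

theorem chi_mem (hχ : isT p χ) (u : ZMod p) : χ u ∈ Oi p := by
  obtain ⟨z, hz, -⟩ := hχ u
  rw [← hz]; exact z.2

theorem chi_sub (hχ : isT p χ) (u : ZMod p) : cg p 1 (1 - χ u) (χ (1-u)) := by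
  obtain ⟨z, hz, hz'⟩ := hχ u
  obtain ⟨w, hw, hw'⟩ := hχ (1-u)
  have : cg p 1 ((1 - z - w : ℤ_[p]) : ℚ_[p]) 0 := cg_of_zmod (by rw [map_sub, map_sub, map_one, hz', hw', sub_self])
  push_cast at this
  rw [hz, hw] at this
  obtain ⟨c, hc, h⟩ := this
  exact ⟨c, hc, by linear_combination h⟩

theorem chi_pow_one (hχ : isT p χ) (k : ℕ) : χ^k = 1 ↔ p - 1 ∣ k := by
  have hf := FiniteField.forall_pow_eq_one_iff (ZMod p) k
  rw [ZMod.card] at hf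
  rw [← hf]
  constructor
  · intro h u
    obtain ⟨z, hz, hz'⟩ := hχ (u:ZMod p)
    have h1 : (χ^k) (u:ZMod p) = 1 := by rw [h, MulChar.one_apply_coe]
    rw [MulChar.pow_apply_coe, ← hz] at h1
    have h2 : z^k = 1 := by apply Subtype.ext; push_cast; exact h1
    have h3 := congrArg PadicInt.toZMod h2
    rw [map_pow, hz', map_one] at h3
    apply Units.ext; push_cast; exact h3
  · intro h
    ext u
    rw [MulChar.pow_apply_coe, ← map_pow, MulChar.one_apply_coe]
    have : (u:ZMod p)^k = 1 := by rw [← Units.val_pow_eq_pow_val, h u, Units.val_one]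
    rw [this, map_one]

theorem chi_sum (hχ : isT p χ) {k : ℕ} (hk : 0 < k) : ∑ u, χ u ^ k = if p - 1 ∣ k then (p:ℚ_[p]) - 1 else 0 := by
  have e : ∀ u, χ u ^ k = (χ^k) u := fun u => (MulChar.pow_apply' χ hk.ne' u).symm
  simp only [e]
  split_ifs with h
  · rw [(chi_pow_one hχ k).2 h, MulChar.sum_one_eq_card_units, ZMod.card_units_eq_totient, Nat.totient_prime hp.out,
      Nat.cast_sub hp.out.one_le, Nat.cast_one]
  · exact MulChar.sum_eq_zero_of_ne_one (fun h' => h ((chi_pow_one hχ k).1 h'))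

theorem E_expand (hχ : isT p χ) {m : ℕ} (hm : p = 6*m+1) (hm0 : 0 < m) (N : ℕ) : 
    ∑ u, χ u ^ (4*m) * (1 - χ u)^N = ((p:ℚ_[p])-1) * ∑ k ∈ (range (N+1)).filter (fun k => 6*m ∣ 4*m+k), (-1)^k * (N.choose k : ℚ_[p]) := by
  have e : ∀ u, χ u ^ (4*m) * (1 - χ u)^N = ∑ k ∈ range (N+1), ((-1)^k * (N.choose k : ℚ_[p])) * χ u ^ (4*m+k) := by
    intro u
    rw [sub_eq_add_neg, add_comm, add_pow, mul_sum]
    apply sum_congr rfl; intro k _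
    rw [one_pow, neg_pow, pow_add]; ring
  simp only [e]
  rw [sum_comm, sum_filter, mul_sum]
  apply sum_congr rfl; intro k _
  rw [← mul_sum, chi_sum hχ (by omega), show p - 1 = 6*m by omega]
  split_ifs
  · ring
  · ring

theorem dvd_cases {m k : ℕ} (hm0 : 0 < m) (hk : k ≤ 15*m) (h : 6*m ∣ 4*m+k) : k = 2*m ∨ k = 8*m ∨ k = 14*m := by
  obtain ⟨c, hc⟩ := h
  have : c < 4 := by
    by_contra h
    have : 6*m*4 ≤ 6*m*c := Nat.mul_le_mul_left _ (by omega)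
    omega
  interval_cases c <;> omega

theorem E_vals (hχ : isT p χ) {m : ℕ} (hm : p = 6*m+1) (hm0 : 0 < m) : 
    ∑ u, χ u ^ (4*m) * (1 - χ u)^(3*m) = ((p:ℚ_[p])-1) * (3*m).choose m ∧
    ∑ u, χ u ^ (4*m) * (1 - χ u)^(9*m) = ((p:ℚ_[p])-1) * ((9*m).choose (2*m) + (9*m).choose m) ∧
    ∑ u, χ u ^ (4*m) * (1 - χ u)^(15*m) = ((p:ℚ_[p])-1) * ((15*m).choose (2*m) + (15*m).choose (7*m) + (15*m).choose m) := by
  have d1 : 6*m ∣ 4*m+2*m := ⟨1, by ring⟩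
  have d2 : 6*m ∣ 4*m+8*m := ⟨2, by ring⟩
  have d3 : 6*m ∣ 4*m+14*m := ⟨3, by ring⟩
  have s1 : (-1:ℚ_[p])^(2*m) = 1 := by rw [pow_mul]; norm_num
  have s2 : (-1:ℚ_[p])^(8*m) = 1 := by rw [pow_mul]; norm_num
  have s3 : (-1:ℚ_[p])^(14*m) = 1 := by rw [pow_mul]; norm_num
  refine ⟨?_, ?_, ?_⟩
  · rw [E_expand hχ hm hm0]
    have : (range (3*m+1)).filter (fun k => 6*m ∣ 4*m+k) = {2*m} := by
      ext k; simp only [mem_filter, mem_range, mem_singleton]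
      constructor
      · rintro ⟨h1, h2⟩
        have := dvd_cases hm0 (by omega) h2
        omega
      · rintro rfl; exact ⟨by omega, d1⟩
    rw [this, sum_singleton, s1, ← Nat.choose_symm (show m ≤ 3*m by omega), show 3*m-m = 2*m by omega]; ring
  · rw [E_expand hχ hm hm0]
    have : (range (9*m+1)).filter (fun k => 6*m ∣ 4*m+k) = {2*m, 8*m} := by
      ext k; simp only [mem_filter, mem_range, mem_singleton, mem_insert]
      constructor
      · rintro ⟨h1, h2⟩
        have := dvd_cases hm0 (by omega) h2
        omega
      · rintro (rfl | rfl)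
        · exact ⟨by omega, d1⟩
        · exact ⟨by omega, d2⟩
    rw [this, sum_pair (by omega), s1, s2, ← Nat.choose_symm (show m ≤ 9*m by omega), show 9*m-m = 8*m by omega]; ring
  · rw [E_expand hχ hm hm0]
    have : (range (15*m+1)).filter (fun k => 6*m ∣ 4*m+k) = {2*m, 8*m, 14*m} := by
      ext k; simp only [mem_filter, mem_range, mem_singleton, mem_insert]
      constructor
      · rintro ⟨h1, h2⟩
        have := dvd_cases hm0 (by omega) h2
        omega
      · rintro (rfl | rfl | rfl)
        · exact ⟨by omega, d1⟩
        · exact ⟨by omega, d2⟩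
        · exact ⟨by omega, d3⟩
    rw [this, sum_insert (by simp only [mem_insert, mem_singleton]; omega), sum_pair (by omega), s1, s2, s3, ← Nat.choose_symm (show m ≤ 15*m by omega), show 15*m-m = 14*m by omega, 
      ← Nat.choose_symm (show 7*m ≤ 15*m by omega), show 15*m-7*m = 8*m by omega]; ring

theorem chi_pow_p (hχ : isT p χ) {u : ZMod p} (hu : u ≠ 0) {k : ℕ} (hk : p - 1 ∣ k) : χ u ^ k = 1 := by
  rw [← map_pow]
  obtain ⟨c, rfl⟩ := hk
  rw [pow_mul, ZMod.pow_card_sub_one_eq_one hu, one_pow, map_one]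

theorem J_cong (hχ : isT p χ) {m : ℕ} (hm : p = 6*m+1) (hm0 : 0 < m) : 
    cg p 3 (8 * ∑ u, χ u ^ (4*m) * χ (1-u)^(3*m)) (((p:ℚ_[p])-1) * (15 * ((3*m).choose m : ℚ_[p]) - 10 * (((9*m).choose (2*m) : ℚ_[p]) + (9*m).choose m) + 3 * (((15*m).choose (2*m) : ℚ_[p]) + (15*m).choose (7*m) + (15*m).choose m))) := by
  obtain ⟨e1, e2, e3⟩ := E_vals hχ hm hm0
  have e : (((p:ℚ_[p])-1) * (15 * ((3*m).choose m : ℚ_[p]) - 10 * (((9*m).choose (2*m) : ℚ_[p]) + (9*m).choose m) + 3 * (((15*m).choose (2*m) : ℚ_[p]) + (15*m).choose (7*m) + (15*m).choose m))) = 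
     ∑ u, χ u ^ (4*m) * (15 * (1 - χ u)^(3*m) - 10 * (1 - χ u)^(9*m) + 3 * (1 - χ u)^(15*m)) := by
    have : ∀ u, χ u ^ (4*m) * (15 * (1 - χ u)^(3*m) - 10 * (1 - χ u)^(9*m) + 3 * (1 - χ u)^(15*m)) = 
      15 * (χ u ^ (4*m) * (1 - χ u)^(3*m)) - 10 * (χ u ^ (4*m) * (1 - χ u)^(9*m)) + 3 * (χ u ^ (4*m) * (1 - χ u)^(15*m)) := fun u => by ring
    simp only [this, sum_add_distrib, sum_sub_distrib, ← mul_sum, e1, e2, e3]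
    ring
  rw [e, mul_sum]
  apply cg.sum
  intro u _
  have hu4 : χ u ^ (4*m) ∈ Oi p := pow_mem (chi_mem hχ u) _
  rw [mul_left_comm]
  refine cg.mul_left hu4 ?_
  by_cases h1 : u = 1
  · subst h1
    rw [sub_self, map_one, MulChar.map_zero, sub_self, zero_pow (by omega), zero_pow (by omega), zero_pow (by omega)]
    exact cg.of_eq (by ring)
  · have hw : (χ (1-u)^(3*m))^2 = 1 := by
      rw [← pow_mul]; exact chi_pow_p hχ (sub_ne_zero.2 (Ne.symm h1)) ⟨1, by omega⟩
    have mw : χ (1-u)^(3*m) ∈ Oi p := pow_mem (chi_mem hχ _) _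
    have hv := (chi_sub hχ u).pow (chi_mem hχ _) (3*m)
    have mv := hv.mem mw
    rw [show 9*m = 3*m*3 by ring, show 15*m = 3*m*5 by ring, pow_mul _ (3*m) 3, pow_mul _ (3*m) 5]
    obtain ⟨c, hc, h⟩ := hv
    generalize (1 - χ u)^(3*m) = V at *
    generalize χ (1-u)^(3*m) = A at *
    refine ⟨-(c^3*(3*V^2+9*(A*V)+8)), neg_mem (mul_mem (pow_mem hc _) (add_mem (add_mem (mul_mem (nmem 3) (pow_mem mv _)) (mul_mem (nmem 9) (mul_mem mw mv))) (nmem 8))), ?_⟩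
    have : (p:ℚ_[p])^3 * -(c^3*(3*V^2+9*(A*V)+8)) = -((p^1*c)^3*(3*V^2+9*(A*V)+8)) := by ring
    rw [this, ← h]
    linear_combination (-18*V^3+24*A*V^2-(9*A^2-15)*V-8*A)*hw

end teich

open Finset

section jac
variable {p : ℕ} [hp : Fact p.Prime] {χ : MulChar (ZMod p) ℚ_[p]}

theorem J_mul (hχ : isT p χ) {m : ℕ} (hm : p = 6*m+1) (hm0 : 0 < m) : 
    (∑ u, χ u ^ (4*m) * χ (1-u)^(3*m)) * (∑ u, χ u ^ (2*m) * χ (1-u)^(3*m)) = p := by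
  have a2 : 2*m ≠ 0 := by omega
  have a3 : 3*m ≠ 0 := by omega
  have a4 : 4*m ≠ 0 := by omega
  have nd : ∀ k, 0 < k → k < 6*m → ¬ (p - 1 ∣ k) := by
    intro k h1 h2 h3
    have := Nat.le_of_dvd h1 h3
    omega
  have h6 : χ^(6*m) = 1 := (chi_pow_one hχ _).2 ⟨1, by omega⟩
  have i1 : (χ^(4*m))⁻¹ = χ^(2*m) := by
    rw [inv_eq_iff_mul_eq_one, ← pow_add, show 4*m+2*m = 6*m by ring, h6]
  have i2 : (χ^(3*m))⁻¹ = χ^(3*m) := by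
    rw [inv_eq_iff_mul_eq_one, ← pow_add, show 3*m+3*m = 6*m by ring, h6]
  have h := jacobiSum_mul_jacobiSum_inv (F := ZMod p) (F' := ℚ_[p]) (χ := χ^(4*m)) (φ := χ^(3*m)) ?_ ?_ ?_ ?_
  · rw [i1, i2, ZMod.card] at h
    rw [← h, jacobiSum, jacobiSum]
    simp only [MulChar.pow_apply' _ a2, MulChar.pow_apply' _ a3, MulChar.pow_apply' _ a4]
  · rw [ZMod.ringChar_zmod_n, ringChar.eq_zero]; exact hp.out.ne_zero.symm
  · rw [Ne, chi_pow_one hχ]; exact nd _ (by omega) (by omega)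
  · rw [Ne, chi_pow_one hχ]; exact nd _ (by omega) (by omega)
  · rw [← pow_add, Ne, chi_pow_one hχ]
    intro h
    rw [show p - 1 = 6*m by omega, show 4*m+3*m = 6*m+m by ring, Nat.dvd_add_right (dvd_refl _)] at h
    have := Nat.le_of_dvd hm0 h
    omega

theorem J_int (hχ : isT p χ) {m : ℕ} (hm : p = 6*m+1) (hm0 : 0 < m) : 
    ∃ c d : ℤ, (∑ u, χ u ^ (4*m) * χ (1-u)^(3*m)) + (∑ u, χ u ^ (2*m) * χ (1-u)^(3*m)) = (2*c:ℤ) ∧ (p:ℤ) = c^2+3*d^2 := by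
  have nd : ∀ k, 0 < k → k < 6*m → ¬ (p - 1 ∣ k) := by
    intro k h1 h2 h3
    have := Nat.le_of_dvd h1 h3
    omega
  have hne : χ^(2*m) ≠ 1 := by rw [Ne, chi_pow_one hχ]; exact nd _ (by omega) (by omega)
  obtain ⟨v, hv⟩ := MulChar.ne_one_iff.1 hne
  set ω := (χ^(2*m)) (v:ZMod p) with hω
  have w3 : ω^3 = 1 := by
    rw [hω, MulChar.pow_apply_coe, ← pow_mul]; exact chi_pow_p hχ v.ne_zero ⟨1, by omega⟩
  have w2 : ω^2+ω+1 = 0 := by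
    have : (ω-1)*(ω^2+ω+1) = 0 := by linear_combination w3
    exact (mul_eq_zero.1 this).resolve_left (sub_ne_zero.2 hv)
  have key : ∀ z : ℚ_[p], z^3 = 1 → z = 1 ∨ z = ω ∨ z = ω^2 := by
    intro z hz
    have : (z-1)*((z-ω)*(z-ω^2)) = 0 := by linear_combination hz + (z^2*(-1) + z)*w2 + (z-1)*w3
    rcases mul_eq_zero.1 this with h | h
    · left; exact sub_eq_zero.1 h
    · right; rcases mul_eq_zero.1 h with h | h
      · left; exact sub_eq_zero.1 h
      · right; exact sub_eq_zero.1 h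
  have hf : ∀ u : ZMod p, ∃ f : ℤ, χ u^(3*m) = f ∧ (u ≠ 0 → f = 1 ∨ f = -1) := by
    intro u
    by_cases hu : u = 0
    · refine ⟨0, ?_, fun h => absurd hu h⟩
      rw [hu, MulChar.map_zero, zero_pow (by omega), Int.cast_zero]
    · have : (χ u^(3*m))^2 = 1 := by rw [← pow_mul]; exact chi_pow_p hχ hu ⟨1, by omega⟩
      rcases (mul_self_eq_one_iff.1 ((sq _).symm.trans this)) with h | h
      · exact ⟨1, by rw [h]; simp, fun _ => Or.inl rfl⟩
      · exact ⟨-1, by rw [h]; simp, fun _ => Or.inr rfl⟩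
  have hg : ∀ u : ZMod p, ∃ g h : ℤ, χ u^(4*m) + χ u^(2*m) = g ∧ χ u^(4*m) - χ u^(2*m) = (ω^2-ω)*h := by
    intro u
    by_cases hu : u = 0
    · refine ⟨0, 0, ?_, ?_⟩ <;>
      rw [hu, MulChar.map_zero, zero_pow (by omega), zero_pow (by omega)] <;> simp
    · have h3 : (χ u^(2*m))^3 = 1 := by rw [← pow_mul]; exact chi_pow_p hχ hu ⟨1, by omega⟩
      have e : χ u^(4*m) = (χ u^(2*m))^2 := by rw [← pow_mul]; congr 1; ring
      rw [e]
      rcases key _ h3 with h | h | h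
      · refine ⟨2, 0, ?_, ?_⟩ <;> rw [h] <;> push_cast <;> ring
      · refine ⟨-1, 1, ?_, ?_⟩ <;> rw [h] <;> push_cast
        · linear_combination w2
        · ring
      · refine ⟨-1, -1, ?_, ?_⟩ <;> rw [h] <;> push_cast
        · linear_combination w2 + ω*w3
        · linear_combination ω * w3
  choose f hf1 hf2 using hf
  choose g h hg1 hg2 using hg
  set J1 := (∑ u, χ u ^ (4*m) * χ (1-u)^(3*m)) with hJ1
  set J2 := (∑ u, χ u ^ (2*m) * χ (1-u)^(3*m)) with hJ2
  have hc : J1 + J2 = ((∑ u, g u * f (1-u) : ℤ) : ℚ_[p]) := by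
    rw [hJ1, hJ2, ← sum_add_distrib]; push_cast
    apply sum_congr rfl; intro u _; rw [← hg1, ← hf1]; ring
  have hd : J1 - J2 = (ω^2-ω) * ((∑ u, h u * f (1-u) : ℤ) : ℚ_[p]) := by
    rw [hJ1, hJ2, ← sum_sub_distrib]; push_cast; rw [mul_sum]
    apply sum_congr rfl; intro u _; rw [← mul_assoc, ← hg2, ← hf1]; ring
  have hg0 : ∑ u, g u = 0 := by
    have : ((∑ u, g u : ℤ) : ℚ_[p]) = 0 := by
      push_cast; simp only [← hg1]
      rw [sum_add_distrib, chi_sum hχ (by omega), chi_sum hχ (by omega), if_neg (nd _ (by omega) (by omega)), if_neg (nd _ (by omega) (by omega)), add_zero]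
    exact_mod_cast this
  have hev : (2:ℤ) ∣ ∑ u, g u * f (1-u) := by
    have : ∑ u, g u * f (1-u) = ∑ u, g u * (f (1-u) - 1) := by
      simp only [mul_sub, mul_one, sum_sub_distrib, hg0, sub_zero]
    rw [this]
    apply dvd_sum; intro u _
    by_cases hu : u = 1
    · have : g u = 2 := by
        have := hg1 u
        rw [hu, map_one, one_pow, one_pow] at this
        rw [hu]
        have h2 : ((g 1 : ℤ):ℚ_[p]) = ((2:ℤ):ℚ_[p]) := by rw [← this]; push_cast; ring
        exact_mod_cast h2
      rw [this]; exact dvd_mul_right _ _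
    · apply Dvd.dvd.mul_left
      rcases hf2 (1-u) (sub_ne_zero.2 (Ne.symm hu)) with h | h <;> rw [h] <;> norm_num
  obtain ⟨c, hcc⟩ := hev
  set d := ∑ u, h u * f (1-u) with hdd
  rw [hcc] at hc
  have hJ := J_mul hχ hm hm0
  rw [← hJ1, ← hJ2] at hJ
  have h4 : (4 * (p:ℤ)) = (2*c)^2+3*d^2 := by
    have : ((4 * (p:ℤ) : ℤ) : ℚ_[p]) = (((2*c)^2+3*d^2 : ℤ) : ℚ_[p]) := by
      push_cast
      push_cast at hc
      have q : (ω^2-ω)^2 = -3 := by linear_combination (ω^2 - 3*ω + 3)*w2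
      linear_combination -4*hJ + (J1+J2+2*c)*hc - (J1-J2 + (ω^2-ω)*d)*hd - d^2*q
    exact_mod_cast this
  have hd2 : (2:ℤ) ∣ d := by
    have : (2:ℤ) ∣ d^2 := by
      have : (2:ℤ) ∣ 3*d^2 := ⟨2*p-2*c^2, by linarith⟩
      exact (Int.prime_two.dvd_mul.1 this).resolve_left (by norm_num)
    exact Int.prime_two.dvd_of_dvd_pow this
  obtain ⟨d', hd'⟩ := hd2
  refine ⟨c, d', hc, ?_⟩
  rw [hd'] at h4
  nlinarith

theorem rep_unique {p : ℤ} (hp : Prime p) (hp0 : 0 < p) {x y c d : ℤ} (h1 : p = x^2+3*y^2) (h2 : p = c^2+3*d^2) : x^2 = c^2 := by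
  have e : p ∣ (x*d-y*c)*(x*d+y*c) := ⟨d^2-y^2, by 
    have : (x*d-y*c)*(x*d+y*c) = x^2*d^2-y^2*c^2 := by ring
    rw [this]
    linear_combination (y^2)*h2 - d^2*h1⟩
  have fin : x^2*d^2 = y^2*c^2 → x^2 = c^2 := by
    intro h
    have : p*(x^2-c^2) = 0 := by linear_combination x^2*h2 - c^2*h1 + 3*h
    rcases mul_eq_zero.1 this with h | h
    · omega
    · linarith
  have sm : ∀ s t : ℤ, p^2 = s^2+3*(p*t)^2 → t = 0 := by
    intro s t h
    by_contra ht
    have : 1 ≤ t^2 := by have := sq_pos_of_ne_zero ht; omega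
    nlinarith [sq_nonneg s, mul_pos hp0 hp0, mul_le_mul_of_nonneg_left this (mul_pos hp0 hp0).le]
  rcases hp.dvd_or_dvd e with ⟨t, ht⟩ | ⟨t, ht⟩
  · have := sm (x*c+3*y*d) t (by rw [← ht]; linear_combination (p)*h1 + (x^2+3*y^2)*h2)
    rw [this, mul_zero] at ht
    exact fin (by linear_combination (x*d+y*c)*ht)
  · have := sm (x*c-3*y*d) t (by rw [← ht]; linear_combination (p)*h1 + (x^2+3*y^2)*h2)
    rw [this, mul_zero] at ht
    exact fin (by linear_combination (x*d-y*c)*ht)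

/-- Summary: `T_0 ≡ s` with `4 x^2 = s + 2p + p^2/s`. -/
theorem T0_x {m : ℕ} (hm : p = 6*m+1) (hp3 : 3 < p) {x y : ℤ} (h : (p:ℤ) = x^2+3*y^2) : 
    ∃ s : ℚ_[p], un p s ∧ cg p 3 (aS p 0 : ℚ_[p]) s ∧ 4*(x:ℚ_[p])^2 * s = (s + p)^2 := by
  have hm0 : 0 < m := by omega
  obtain ⟨χ, hχ⟩ := teich_char p
  have hχ' : isT p χ := hχ
  obtain ⟨c, d, h1, h2⟩ := J_int hχ' hm hm0
  have h3 := J_mul hχ' hm hm0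
  obtain ⟨uJ, hJ⟩ := J_sq hm hp3 (J_cong hχ' hm hm0)
  have hx := rep_unique (Nat.prime_iff_prime_int.1 hp.out) (by exact_mod_cast hp.out.pos) h h2
  have hx' : (x:ℚ_[p])^2 = (c:ℚ_[p])^2 := by exact_mod_cast hx
  refine ⟨_, uJ.pow 2, hJ, ?_⟩
  rw [hx']
  generalize (∑ u, χ u ^ (4*m) * χ (1-u)^(3*m)) = J1 at *
  generalize (∑ u, χ u ^ (2*m) * χ (1-u)^(3*m)) = J2 at *
  push_cast at h1
  have : (J1^2 + p) = J1*(2*c) := by rw [← h1, ← h3]; ring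
  rw [this]; ring

end jac

open Finset

section fin
variable {p : ℕ} [hp : Fact p.Prime]

theorem case_one {m : ℕ} (hm : p = 6*m+1) (hp3 : 3 < p) {x y : ℤ} (h : (p:ℤ) = x^2+3*y^2) : 
    cg p 3 (aS p 2 : ℚ_[p]) ((8/9*(x:ℚ)^2 - 17/18*(p:ℚ) + (p:ℚ)^2/(72*(x:ℚ)^2) : ℚ)) ∧
    cg p 3 (aS p 3 : ℚ_[p]) ((-(1/3)*(x:ℚ)^2 + (p:ℚ)/2 - (p:ℚ)^2/(12*(x:ℚ)^2) : ℚ)) := by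
  obtain ⟨s, us, h0, hx⟩ := T0_x hm hp3 h
  have u2 := un_two (p := p) hp3
  have u9 := un_nine (p := p) hp3
  have u18 : un p (18:ℚ_[p]) := by have := u2.mul u9; norm_num at this; exact this
  have u72 : un p (72:ℚ_[p]) := by have := (un_four (p := p) hp3).mul u18; norm_num at this; exact this
  have U0 := U0_cg (p := p) hp3
  have hch : ch3 p = 1 := by
    unfold ch3; rw [hm]; push_cast
    have : (6*(m:ℤ)+1) % 3 = 1 := by omega
    simp [this]
  rw [hch] at U0
  have U1 : cg p 3 (18*(2*aS p 3+3*aS p 2+aS p 1)+6*(2*aS p 1+aS p 0) : ℚ_[p]) 0 := by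
    have := cg_int_iff (p := p) (r := 3) (a := 18*(2*aS p 3+3*aS p 2+aS p 1)+6*(2*aS p 1+aS p 0)) (b := 0)
    have := (this.2 (by simpa using U1_cg (p := p)))
    push_cast at this; exact this
  have S2 : cg p 3 (72*aS p 0*(aS p 2+aS p 1)+20*(aS p 0)^2-9*(2*aS p 1+aS p 0)^2-11*(p:ℚ_[p])^2 : ℚ_[p]) 0 := by
    have := cg_int_iff (p := p) (r := 3) (a := 72*aS p 0*(aS p 2+aS p 1)+20*(aS p 0)^2-9*(2*aS p 1+aS p 0)^2-11*(p:ℤ)^2) (b := 0)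
    have := (this.2 (by simpa using step2 hp.out hp3))
    push_cast at this; exact this
  have m0 : ((aS p 0:ℤ):ℚ_[p]) ∈ Oi p := intCast_mem _ _
  have m1 : ((aS p 1:ℤ):ℚ_[p]) ∈ Oi p := intCast_mem _ _
  have m2 : ((aS p 2:ℤ):ℚ_[p]) ∈ Oi p := intCast_mem _ _
  have m3 : ((aS p 3:ℤ):ℚ_[p]) ∈ Oi p := intCast_mem _ _
  push_cast at U0 ⊢
  rw [mul_one] at U0
  generalize ((aS p 0:ℤ):ℚ_[p]) = a0 at *
  generalize ((aS p 1:ℤ):ℚ_[p]) = a1 at *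
  generalize ((aS p 2:ℤ):ℚ_[p]) = a2 at *
  generalize ((aS p 3:ℤ):ℚ_[p]) = a3 at *
  have ms := us.2.1
  have mi := us.2.2
  have hi : s * s⁻¹ = 1 := mul_inv_cancel₀ us.1
  have hT : cg p 3 (a2+a1) (-5/18*s + 5/18*p^2*s⁻¹) := by
    refine (u72.mul us).cancel ?_
    have k1 := (h0.mul_right (mul_mem (nmem 72) (add_mem m2 m1)))
    have k2 := (h0.pow ms 2).mul_left (nmem 20)
    have k3 := (U0.pow pmem 2).mul_left (nmem 9)
    have k4 := ((k1.add k2).sub k3).symm.trans ((cg.of_eq (by ring)).trans (S2.add (cg.refl (11*(p:ℚ_[p])^2))))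
    obtain ⟨c, hc, e⟩ := k4
    refine ⟨c, hc, ?_⟩
    have e' : s * (72 * (a2+a1)) + 20*s^2 - 9*(p:ℚ_[p])^2 - (0 + 11*(p:ℚ_[p])^2) = (p:ℚ_[p])^3*c := e
    linear_combination e' - 20*p^2*hi
  have i18 : (1/18:ℚ_[p]) ∈ Oi p := by rw [one_div]; exact u18.2.2
  have q2 : (1/2:ℚ_[p]) ∈ Oi p := by rw [one_div]; exact u2.2.2
  have usp : un p (s+p) := un.cg (r := 1) (by norm_num) us ⟨1, one_mem _, by ring⟩
  have hX : cg p 3 ((p:ℚ_[p])^2/(72*(x:ℚ_[p])^2)) (1/18*p^2*s⁻¹) := by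
    have hx2 : (x:ℚ_[p])^2 = (s+p)^2 / (4*s) := by
      have := us.1
      field_simp; linear_combination hx
    refine ⟨1/18*(-2*s-p)*s⁻¹*((s+p)⁻¹)^2, mul_mem (mul_mem (mul_mem i18 (sub_mem (mul_mem (neg_mem (nmem 2)) ms) pmem)) mi) (pow_mem usp.2.2 _), ?_⟩
    rw [hx2]
    have a := us.1
    have b := usp.1
    field_simp
    ring
  have hx3 : (x:ℚ_[p])^2 = 1/4*(s + 2*p + p^2*s⁻¹) := by
    have := us.1
    field_simp; linear_combination hx
  have A2 : cg p 3 a2 (2/9*s - 1/2*p + 5/18*p^2*s⁻¹) := by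
    have := (hT.sub (U0.mul_left q2)).add (h0.mul_left q2)
    exact (cg.of_eq (by ring)).trans (this.trans (cg.of_eq (by ring)))
  have A3 : cg p 3 a3 (-1/12*s + 1/3*p - 5/12*p^2*s⁻¹) := by
    have k1 := (U1.mul_left (mul_mem q2 i18)).sub (((A2.mul_left (nmem 3)).add (U0.mul_left q2)).mul_left q2)
    have k2 := (k1.add (h0.mul_left (mul_mem q2 q2))).sub (U0.mul_left (mul_mem (mul_mem q2 (nmem 6)) i18))
    refine (cg.of_eq ?_).trans (k2.trans (cg.of_eq ?_))
    · have : (OfNat.ofNat 3 : ℚ_[p]) = 3 := rfl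
      have : (OfNat.ofNat 6 : ℚ_[p]) = 6 := rfl
      simp only [*]; ring
    · have : (OfNat.ofNat 3 : ℚ_[p]) = 3 := rfl
      have : (OfNat.ofNat 6 : ℚ_[p]) = 6 := rfl
      simp only [*]; ring
  constructor
  · refine A2.trans ((cg.of_eq ?_).trans ((cg.refl _).add hX.symm))
    rw [hx3]; ring
  · refine A3.trans (((cg.of_eq ?_).trans ((cg.refl (-(1/3)*(x:ℚ_[p])^2 + (p:ℚ_[p])/2)).sub (hX.symm.mul_left (nmem 6)))).trans (cg.of_eq ?_))
    · rw [hx3]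
      have : (OfNat.ofNat 6 : ℚ_[p]) = 6 := rfl
      rw [this]; ring
    · have : (OfNat.ofNat 6 : ℚ_[p]) = 6 := rfl
      rw [this]; ring

end fin

theorem aS_eq (p i : ℕ) : (∑ n ∈ Finset.range p, (-1:ℚ)^n * (n:ℚ)^i * apery n) = (aS p i : ℚ) := by
  rw [aS]; push_cast
  apply Finset.sum_congr rfl; intro n _
  rw [apery, az]; push_cast; rfl

theorem statement16 (p : ℕ) (hp : p.Prime) (hp3 : 3 < p) :
    (∀ x y : ℤ, p % 3 = 1 → (p : ℤ) = x^2 + 3*y^2 →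
      ratCongr p 3
        (∑ n ∈ Finset.range p, (-1:ℚ)^n * (n:ℚ)^2 * apery n)
        (8/9*(x:ℚ)^2 - 17/18*(p:ℚ) + (p:ℚ)^2/(72*(x:ℚ)^2)) ∧
      ratCongr p 3
        (∑ n ∈ Finset.range p, (-1:ℚ)^n * (n:ℚ)^3 * apery n)
        (-(1/3)*(x:ℚ)^2 + (p:ℚ)/2 - (p:ℚ)^2/(12*(x:ℚ)^2))) ∧
    (p % 3 = 2 →
      ratCongr p 2
        (∑ n ∈ Finset.range p, (-1:ℚ)^n * (n:ℚ)^2 * apery n)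
        (2/9*R3 p + (p:ℚ)/2) ∧
      ratCongr p 2
        (∑ n ∈ Finset.range p, (-1:ℚ)^n * (n:ℚ)^3 * apery n)
        (-(1/3)*R3 p - (p:ℚ)/3)) := by
  haveI : Fact p.Prime := ⟨hp⟩
  have hodd : p % 2 = 1 := (hp.eq_two_or_odd).resolve_left (by omega)
  simp only [aS_eq]
  constructor
  · intro x y h1 h
    obtain ⟨c1, c2⟩ := case_one (p := p) (m := p/6) (by omega) hp3 h
    refine ⟨ratCongr_of_cg ?_, ratCongr_of_cg ?_⟩
    · rw [Rat.cast_intCast]; exact c1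
    · rw [Rat.cast_intCast]; exact c2
  · intro h1
    obtain ⟨c1, c2⟩ := case_two (p := p) (m := p/6) (by omega) hp3
    refine ⟨ratCongr_of_cg ?_, ratCongr_of_cg ?_⟩
    · rw [Rat.cast_intCast]; exact c1
    · rw [Rat.cast_intCast]; exact c2
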